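/- Suppose π(Y) ⊆ V//G is the zero set of invariants f_1, …, f_k, that Y_apr is Zariski dense in Y, and that every stratum S of V which intersects Y ∖ Y_apr has codimension at least k+1 in V. Then Y is G-saturated. -/

import Mathlib

/-!
Common framework: a "compact Lie group / complex reductive group acting on a
finite-dimensional module" is modelled as a subgroup of invertible `n × n`
matrices over `𝕜 = ℝ` or `ℂ` acting on `Fin n → 𝕜` by `Matrix.mulVec`.
Polynomial functions on the module are `MvPolynomial (Fin n) 𝕜`.
-/

set_option synthInstance.maxHeartbeats 1000000
set_option maxHeartbeats 1000000

noncomputable section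

open MvPolynomial

namespace ZPaper

variable (𝕜 : Type) [RCLike 𝕜] (n : ℕ)

/-- The zero set of a family of polynomials. -/
def zeroSet (S : Set (MvPolynomial (Fin n) 𝕜)) : Set (Fin n → 𝕜) :=
  {v | ∀ p ∈ S, eval v p = 0}

/-- A subset of `𝕜ⁿ` is algebraic if it is the zero set of a family of polynomials. -/
def IsAlgebraicSet (X : Set (Fin n → 𝕜)) : Prop :=
  ∃ S : Set (MvPolynomial (Fin n) 𝕜), X = zeroSet 𝕜 n S

/-- The vanishing ideal `I(X)` of a subset `X ⊆ 𝕜ⁿ`. -/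
def vanishingIdeal (X : Set (Fin n → 𝕜)) : Ideal (MvPolynomial (Fin n) 𝕜) where
  carrier := {p | ∀ x ∈ X, eval x p = 0}
  zero_mem' := by intro x _; simp
  add_mem' := by intro a b ha hb x hx; simp [ha x hx, hb x hx]
  smul_mem' := by intro c p hp x hx; simp [smul_eq_mul, hp x hx]

/-- The Zariski closure of a subset of `𝕜ⁿ`. -/
def zclosure (A : Set (Fin n → 𝕜)) : Set (Fin n → 𝕜) :=
  zeroSet 𝕜 n (vanishingIdeal 𝕜 n A : Set (MvPolynomial (Fin n) 𝕜))

/-- `A` is Zariski dense in `X`: every polynomial vanishing on `A` vanishes on `X`. -/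
def ZDenseIn (A X : Set (Fin n → 𝕜)) : Prop :=
  ∀ p : MvPolynomial (Fin n) 𝕜, (∀ a ∈ A, eval a p = 0) → ∀ x ∈ X, eval x p = 0

/-- A set of matrices is a subgroup of `GL_n(𝕜)`. -/
def IsMatSubgroup (G : Set (Matrix (Fin n) (Fin n) 𝕜)) : Prop :=
  (1 : Matrix (Fin n) (Fin n) 𝕜) ∈ G ∧ (∀ a ∈ G, ∀ b ∈ G, a * b ∈ G) ∧
    ∀ a ∈ G, IsUnit a ∧ a⁻¹ ∈ G

/-- `X` is a `G`-stable subset of `𝕜ⁿ`. -/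
def Stabilizes (G : Set (Matrix (Fin n) (Fin n) 𝕜)) (X : Set (Fin n → 𝕜)) : Prop :=
  ∀ g ∈ G, ∀ x ∈ X, Matrix.mulVec g x ∈ X

/-- A polynomial is `G`-invariant. -/
def Invariant (G : Set (Matrix (Fin n) (Fin n) 𝕜)) (p : MvPolynomial (Fin n) 𝕜) : Prop :=
  ∀ g ∈ G, ∀ v : Fin n → 𝕜, eval (Matrix.mulVec g v) p = eval v p

/-- `I_G(X)`: the ideal generated by the `G`-invariant polynomials vanishing on `X`,
i.e. by `I(X)^G = I(X) ∩ 𝕜[V]^G`. -/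
def invariantIdeal (G : Set (Matrix (Fin n) (Fin n) 𝕜)) (X : Set (Fin n → 𝕜)) :
    Ideal (MvPolynomial (Fin n) 𝕜) :=
  Ideal.span {p | Invariant 𝕜 n G p ∧ ∀ x ∈ X, eval x p = 0}

/-- `X` is `G`-reduced: `I_G(X) = I(X)`. -/
def IsGReduced (G : Set (Matrix (Fin n) (Fin n) 𝕜)) (X : Set (Fin n → 𝕜)) : Prop :=
  invariantIdeal 𝕜 n G X = vanishingIdeal 𝕜 n X

/-- `X` is almost `G`-reduced: `√I_G(X) = I(X)`. -/
def IsAlmostGReduced (G : Set (Matrix (Fin n) (Fin n) 𝕜)) (X : Set (Fin n → 𝕜)) : Prop :=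
  (invariantIdeal 𝕜 n G X).radical = vanishingIdeal 𝕜 n X

/-- The orbit `G·v`. -/
def orbit (G : Set (Matrix (Fin n) (Fin n) 𝕜)) (v : Fin n → 𝕜) : Set (Fin n → 𝕜) :=
  (fun g => Matrix.mulVec g v) '' G

/-- The isotropy group `G_v`. -/
def isotropy (G : Set (Matrix (Fin n) (Fin n) 𝕜)) (v : Fin n → 𝕜) :
    Set (Matrix (Fin n) (Fin n) 𝕜) :=
  {g ∈ G | Matrix.mulVec g v = v}

/-- Matrix exponential. -/
def mexp (A : Matrix (Fin n) (Fin n) 𝕜) : Matrix (Fin n) (Fin n) 𝕜 :=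
  ∑' k : ℕ, ((k.factorial : 𝕜)⁻¹) • A ^ k

/-- The Lie algebra of a matrix group: matrices whose one-parameter subgroup lies in `G`. -/
def lieAlgebra (G : Set (Matrix (Fin n) (Fin n) 𝕜)) : Set (Matrix (Fin n) (Fin n) 𝕜) :=
  {A | ∀ t : 𝕜, mexp 𝕜 n (t • A) ∈ G}

/-- The tangent space `T_v(G·v)` to the orbit, i.e. `𝔤·v`. -/
def orbitTangent (G : Set (Matrix (Fin n) (Fin n) 𝕜)) (v : Fin n → 𝕜) :
    Submodule 𝕜 (Fin n → 𝕜) :=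
  Submodule.span 𝕜 ((fun A => Matrix.mulVec A v) '' lieAlgebra 𝕜 n G)

/-- `N` is a `G_v`-stable complement to `T_v(G·v)` in `𝕜ⁿ` (a slice at `v`). -/
def IsSliceComplement (G : Set (Matrix (Fin n) (Fin n) 𝕜)) (v : Fin n → 𝕜)
    (N : Submodule 𝕜 (Fin n → 𝕜)) : Prop :=
  IsCompl (orbitTangent 𝕜 n G v) N ∧
    ∀ g ∈ isotropy 𝕜 n G v, ∀ x ∈ N, Matrix.mulVec g x ∈ N

/-- The image of `H` in `GL(N)` is trivial. -/
def ActsTriviallyOn (H : Set (Matrix (Fin n) (Fin n) 𝕜))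
    (N : Submodule 𝕜 (Fin n → 𝕜)) : Prop :=
  ∀ g ∈ H, ∀ x ∈ N, Matrix.mulVec g x = x

/-- The image of `H` in `GL(N)` is finite. -/
def HasFiniteImageOn (H : Set (Matrix (Fin n) (Fin n) 𝕜))
    (N : Submodule 𝕜 (Fin n → 𝕜)) : Prop :=
  Set.Finite ((fun g => fun x : N => Matrix.mulVec g (x : Fin n → 𝕜)) '' H)

/-- The orbit `G·v` is (Zariski) closed. -/
def HasClosedOrbit (G : Set (Matrix (Fin n) (Fin n) 𝕜)) (v : Fin n → 𝕜) : Prop :=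
  zclosure 𝕜 n (orbit 𝕜 n G v) ⊆ orbit 𝕜 n G v

/-- `v` lies on a principal orbit: `G·v` is closed and the isotropy group acts trivially on
some (hence any) slice at `v`. -/
def IsPrincipalPt (G : Set (Matrix (Fin n) (Fin n) 𝕜)) (v : Fin n → 𝕜) : Prop :=
  HasClosedOrbit 𝕜 n G v ∧
    ∃ N, IsSliceComplement 𝕜 n G v N ∧ ActsTriviallyOn 𝕜 n (isotropy 𝕜 n G v) N

/-- `v` lies on an almost principal orbit. -/
def IsAlmostPrincipalPt (G : Set (Matrix (Fin n) (Fin n) 𝕜)) (v : Fin n → 𝕜) : Prop :=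
  HasClosedOrbit 𝕜 n G v ∧
    ∃ N, IsSliceComplement 𝕜 n G v N ∧ HasFiniteImageOn 𝕜 n (isotropy 𝕜 n G v) N

/-- The set of principal points `V_pr`. -/
def prPoints (G : Set (Matrix (Fin n) (Fin n) 𝕜)) : Set (Fin n → 𝕜) :=
  {v | IsPrincipalPt 𝕜 n G v}

/-- The set of almost principal points `V_apr`. -/
def aprPoints (G : Set (Matrix (Fin n) (Fin n) 𝕜)) : Set (Fin n → 𝕜) :=
  {v | IsAlmostPrincipalPt 𝕜 n G v}

/-- `π⁻¹(π(Y))`: all points that the invariants cannot separate from `Y`. -/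
def saturation (G : Set (Matrix (Fin n) (Fin n) 𝕜)) (Y : Set (Fin n → 𝕜)) :
    Set (Fin n → 𝕜) :=
  {v | ∃ y ∈ Y, ∀ p, Invariant 𝕜 n G p → eval v p = eval y p}

/-- `Y` is `G`-saturated: `Y = π⁻¹(π(Y))`. -/
def IsSaturated (G : Set (Matrix (Fin n) (Fin n) 𝕜)) (Y : Set (Fin n → 𝕜)) : Prop :=
  Y = saturation 𝕜 n G Y

/-- The fiber `π⁻¹(π(v))` of the quotient morphism. -/
def piFiber (G : Set (Matrix (Fin n) (Fin n) 𝕜)) (v : Fin n → 𝕜) : Set (Fin n → 𝕜) :=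
  {u | ∀ p, Invariant 𝕜 n G p → eval u p = eval v p}

/-- The invariant ring `𝕜[V]^G` as a subalgebra of `𝕜[V]`. -/
def invariantSubalgebra (G : Set (Matrix (Fin n) (Fin n) 𝕜)) :
    Subalgebra 𝕜 (MvPolynomial (Fin n) 𝕜) where
  carrier := {p | Invariant 𝕜 n G p}
  mul_mem' := by intro a b ha hb g hg v; simp [ha g hg v, hb g hg v]
  one_mem' := by intro g hg v; simp
  add_mem' := by intro a b ha hb g hg v; simp [ha g hg v, hb g hg v]
  zero_mem' := by intro g hg v; simp
  algebraMap_mem' := by intro r g hg v; simp [MvPolynomial.algebraMap_eq]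

/-- The representation is cofree: `𝕜[V]` is a free module over `𝕜[V]^G`. -/
def IsCofree (G : Set (Matrix (Fin n) (Fin n) 𝕜)) : Prop :=
  Module.Free ↥(invariantSubalgebra 𝕜 n G) (MvPolynomial (Fin n) 𝕜)

/-- The vanishing ideal of `π(Y)` in `𝕜[V//G] = 𝕜[V]^G`. -/
def quotVanishingIdeal (G : Set (Matrix (Fin n) (Fin n) 𝕜)) (Y : Set (Fin n → 𝕜)) :
    Ideal ↥(invariantSubalgebra 𝕜 n G) where
  carrier := {p | ∀ y ∈ Y, eval y (p : MvPolynomial (Fin n) 𝕜) = 0}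
  zero_mem' := by intro y hy; simp
  add_mem' := by intro a b ha hb y hy; simp [ha y hy, hb y hy]
  smul_mem' := by intro c p hp y hy; simp [smul_eq_mul, hp y hy]

/-- The module is stable: there is a nonempty Zariski-open set of points with closed orbit. -/
def IsStableModule (G : Set (Matrix (Fin n) (Fin n) 𝕜)) : Prop :=
  ∃ U : Set (Fin n → 𝕜), U.Nonempty ∧ IsAlgebraicSet 𝕜 n Uᶜ ∧
    ∀ v ∈ U, HasClosedOrbit 𝕜 n G v

/-- `G` is Zariski closed in `GL_n(𝕜)`. -/
def IsZClosedInGL (G : Set (Matrix (Fin n) (Fin n) 𝕜)) : Prop :=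
  ∃ P : Set (MvPolynomial (Fin n × Fin n) 𝕜),
    G = {g | IsUnit g ∧ ∀ p ∈ P, eval (fun ij => g ij.1 ij.2) p = 0}

/-- `G` is a (linearly) reductive algebraic group: a Zariski closed subgroup of `GL_n`
containing a Zariski-dense compact subgroup (the unitarian trick characterization). -/
def IsReductiveGroup (G : Set (Matrix (Fin n) (Fin n) 𝕜)) : Prop :=
  IsMatSubgroup 𝕜 n G ∧ IsZClosedInGL 𝕜 n G ∧
    ∃ K : Set (Matrix (Fin n) (Fin n) 𝕜), K ⊆ G ∧ IsCompact K ∧ IsMatSubgroup 𝕜 n K ∧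
      ∀ p : MvPolynomial (Fin n × Fin n) 𝕜,
        (∀ k ∈ K, eval (fun ij => k ij.1 ij.2) p = 0) →
          ∀ g ∈ G, eval (fun ij => g ij.1 ij.2) p = 0

/-- The isotropy groups of `v` and `w` are conjugate in `G`. -/
def ConjIsotropy (G : Set (Matrix (Fin n) (Fin n) 𝕜)) (v w : Fin n → 𝕜) : Prop :=
  ∃ g ∈ G, isotropy 𝕜 n G w = (fun h => g * h * g⁻¹) '' isotropy 𝕜 n G v

/-- The (Luna) stratum of `V` determined by a point `v` with closed orbit: the inverse image
under `π` of the set of closed orbits with isotropy group conjugate to `G_v`. -/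
def stratumOf (G : Set (Matrix (Fin n) (Fin n) 𝕜)) (v : Fin n → 𝕜) : Set (Fin n → 𝕜) :=
  {u | ∃ w, HasClosedOrbit 𝕜 n G w ∧ w ∈ zclosure 𝕜 n (orbit 𝕜 n G u) ∧
    ConjIsotropy 𝕜 n G v w}

/-- Dimension of (the Zariski closure of) a subset of `𝕜ⁿ`, as the Krull dimension of its
coordinate ring. -/
def adim (X : Set (Fin n → 𝕜)) : WithBot ℕ∞ :=
  ringKrullDim (MvPolynomial (Fin n) 𝕜 ⧸ vanishingIdeal 𝕜 n X)

/-- A nonempty algebraic set with prime vanishing ideal, i.e. an irreducible algebraic set. -/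
def IsIrredAlg (Z : Set (Fin n → 𝕜)) : Prop :=
  IsAlgebraicSet 𝕜 n Z ∧ Z.Nonempty ∧ (vanishingIdeal 𝕜 n Z).IsPrime

/-- `Z` is an irreducible component of `Y`. -/
def IsIrredComponentOf (Y Z : Set (Fin n → 𝕜)) : Prop :=
  IsIrredAlg 𝕜 n Z ∧ Z ⊆ Y ∧
    ∀ Z', IsIrredAlg 𝕜 n Z' → Z ⊆ Z' → Z' ⊆ Y → Z' = Z

/-- The rank at `v` of the differential of `f = (f_1, …, f_d) : V → 𝕜^d`. -/
def jacRank {d : ℕ} (f : Fin d → MvPolynomial (Fin n) 𝕜) (v : Fin n → 𝕜) : ℕ :=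
  (Matrix.of fun (i : Fin d) (j : Fin n) => eval v (pderiv j (f i))).rank

/-- A polynomial is `H`-invariant as a function on the submodule `N`. -/
def InvariantOn (H : Set (Matrix (Fin n) (Fin n) 𝕜)) (N : Submodule 𝕜 (Fin n → 𝕜))
    (p : MvPolynomial (Fin n) 𝕜) : Prop :=
  ∀ g ∈ H, ∀ x ∈ N, eval (Matrix.mulVec g x) p = eval x p

/-- The null cone of the `H`-module `N`: points of `N` which the `H`-invariant functions on `N`
cannot separate from `0`. -/
def sliceNullCone (H : Set (Matrix (Fin n) (Fin n) 𝕜)) (N : Submodule 𝕜 (Fin n → 𝕜)) :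
    Set (Fin n → 𝕜) :=
  {x | x ∈ N ∧ ∀ p, InvariantOn 𝕜 n H N p → eval x p = eval (0 : Fin n → 𝕜) p}

/-- The `H`-module `N` is coreduced: the vanishing ideal of its null cone in `𝕜[N]` is
generated by `H`-invariant functions.  (Stated in `𝕜[V]`: the vanishing ideal of the null
cone equals the ideal generated by the invariant functions vanishing on it together with the
vanishing ideal of `N`.) -/
def CoreducedOn (H : Set (Matrix (Fin n) (Fin n) 𝕜)) (N : Submodule 𝕜 (Fin n → 𝕜)) : Prop :=
  vanishingIdeal 𝕜 n (sliceNullCone 𝕜 n H N) =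
    Ideal.span ({p | InvariantOn 𝕜 n H N p ∧ ∀ x ∈ sliceNullCone 𝕜 n H N, eval x p = 0} ∪
      {p | ∀ x ∈ (N : Set (Fin n → 𝕜)), eval x p = 0})

/-- Complexification of a real vector. -/
def cVec (w : Fin n → ℝ) : Fin n → ℂ := fun i => (w i : ℂ)

/-- The complexification `G = K_ℂ` of a compact matrix group `K ⊆ GL_n(ℝ)`: the Zariski
closure of `K` in the complex matrices. -/
def complexifiedGroup (K : Set (Matrix (Fin n) (Fin n) ℝ)) :
    Set (Matrix (Fin n) (Fin n) ℂ) :=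
  {g | ∀ p : MvPolynomial (Fin n × Fin n) ℂ,
    (∀ k ∈ K, eval (fun ij => (k ij.1 ij.2 : ℂ)) p = 0) →
      eval (fun ij => g ij.1 ij.2) p = 0}

/-- The complexification `Y = X_ℂ ⊆ ℂⁿ` of `X ⊆ ℝⁿ`: the Zariski closure of `X` in `ℂⁿ`. -/
def complexification (X : Set (Fin n → ℝ)) : Set (Fin n → ℂ) :=
  zclosure ℂ n (cVec n '' X)

theorem height_of_isMaximal_mvPolynomial {k : Type} [Field k] (n : ℕ)
    (m : Ideal (MvPolynomial (Fin n) k)) [hm : m.IsMaximal] : m.height = n := by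
  induction n with
  | zero =>
    have e := MvPolynomial.isEmptyRingEquiv k (Fin 0)
    have : IsField (MvPolynomial (Fin 0) k) := e.toMulEquiv.isField (Field.toIsField k)
    let _ := this.toField
    have : m = ⊥ := (Ideal.eq_bot_or_top m).resolve_right hm.ne_top
    subst this
    simp
  | succ n ih =>
    let e := (finSuccEquiv k n).toRingEquiv
    have h1 : (m.map e).height = m.height := RingEquiv.height_map e m
    have hMm : (m.map e).IsMaximal := Ideal.map_isMaximal_of_equiv e
    set M := m.map e with hM
    have hu : (M.under (MvPolynomial (Fin n) k)).IsMaximal :=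
      Polynomial.isMaximal_comap_C_of_isJacobsonRing M
    rw [← h1, Polynomial.height_eq_height_add_one (M.under (MvPolynomial (Fin n) k)) M, ih]
    simp

/-- Some element avoids a given minimal prime but lies in all the other ones. -/
theorem exists_mem_other_minimalPrimes {R : Type*} [CommRing R] [IsNoetherianRing R]
    (I P : Ideal R) (hP : P ∈ I.minimalPrimes) :
    ∃ g ∉ P, ∀ Q ∈ I.minimalPrimes, Q ≠ P → g ∈ Q := by
  classical
  have hfin : I.minimalPrimes.Finite := Ideal.finite_minimalPrimes_of_isNoetherianRing _ I
  have hJP : ¬ (hfin.toFinset.erase P).inf id ≤ P := by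
    intro h
    obtain ⟨Q, hQ, hQP⟩ := (Ideal.IsPrime.inf_le' hP.1.1).1 h
    rw [Finset.mem_erase, Set.Finite.mem_toFinset] at hQ
    exact hQ.1 (le_antisymm hQP (hP.2 hQ.2.1 hQP))
  obtain ⟨g, hgJ, hgP⟩ := Set.not_subset.1 hJP
  refine ⟨g, hgP, fun Q hQ hne => ?_⟩
  have hle : (hfin.toFinset.erase P).inf id ≤ Q :=
    Finset.inf_le (f := id) (Finset.mem_erase.2 ⟨hne, hfin.mem_toFinset.2 hQ⟩)
  exact hle hgJ

theorem height_map_quotient_le_ringKrullDim {R : Type*} [CommRing R] (I P m : Ideal R)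
    [m.IsPrime] (hIm : I ≤ m) (hmQ : ∀ Q ∈ I.minimalPrimes, Q ≤ m → Q = P) :
    ((m.map (Ideal.Quotient.mk I)).height : WithBot ℕ∞) ≤ ringKrullDim (R ⧸ P) := by
  have hp : (m.map (Ideal.Quotient.mk I)).IsPrime := Ideal.isPrime_map_quotientMk_of_isPrime hIm
  have hcm : (m.map (Ideal.Quotient.mk I)).comap (Ideal.Quotient.mk I) = m := by
    rw [Ideal.comap_map_of_surjective _ Ideal.Quotient.mk_surjective]
    simpa [← RingHom.ker_eq_comap_bot] using hIm
  rw [PrimeSpectrum.height_eq_orderHeight ⟨_, hp⟩, Order.height_eq_krullDim_Iic,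
    ringKrullDim_quotient]
  have key : ∀ q : Set.Iic (⟨m.map (Ideal.Quotient.mk I), hp⟩ : PrimeSpectrum (R ⧸ I)),
      PrimeSpectrum.comap (Ideal.Quotient.mk I) q.1 ∈ PrimeSpectrum.zeroLocus (R := R) P := by
    intro q
    have h1 : I ≤ (PrimeSpectrum.comap (Ideal.Quotient.mk I) q.1).asIdeal := by
      intro x hx
      simp [PrimeSpectrum.comap, Ideal.Quotient.eq_zero_iff_mem.2 hx]
    have h2 : (PrimeSpectrum.comap (Ideal.Quotient.mk I) q.1).asIdeal ≤ m := by
      conv_rhs => rw [← hcm]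
      exact Ideal.comap_mono q.2
    obtain ⟨Q, hQ, hQq⟩ := Ideal.exists_minimalPrimes_le h1
    rw [PrimeSpectrum.mem_zeroLocus, SetLike.coe_subset_coe, ← hmQ Q hQ (hQq.trans h2)]
    exact hQq
  refine Order.krullDim_le_of_strictMono
    (fun q => (⟨PrimeSpectrum.comap (Ideal.Quotient.mk I) q.1, key q⟩ :
      PrimeSpectrum.zeroLocus (R := R) P)) ?_
  intro a b hab
  have hmono : StrictMono (PrimeSpectrum.comap (Ideal.Quotient.mk I)) := by
    refine Monotone.strictMono_of_injective (fun x y h => Ideal.comap_mono h) ?_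
    exact PrimeSpectrum.comap_injective_of_surjective _ Ideal.Quotient.mk_surjective
  exact hmono hab

/-- Irreducible components of a zero set of `k` polynomials have codimension at most `k`. -/
theorem le_ringKrullDim_quotient_of_mem_minimalPrimes (n k : ℕ)
    (f : Fin k → MvPolynomial (Fin n) ℂ) (P : Ideal (MvPolynomial (Fin n) ℂ))
    (hP : P ∈ (Ideal.span (Set.range f)).minimalPrimes) :
    (n : WithBot ℕ∞) ≤ ringKrullDim (MvPolynomial (Fin n) ℂ ⧸ P) + (k : WithBot ℕ∞) := by
  set I := Ideal.span (Set.range f) with hI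
  have hPp := hP.1.1
  obtain ⟨m, hm, hPm, hmQ⟩ : ∃ m : Ideal (MvPolynomial (Fin n) ℂ), m.IsMaximal ∧ P ≤ m ∧
      ∀ Q ∈ I.minimalPrimes, Q ≤ m → Q = P := by
    obtain ⟨g, hgP, hgJ⟩ := exists_mem_other_minimalPrimes I P hP
    have hrad : P.jacobson = P := by
      have := (inferInstance : IsJacobsonRing (MvPolynomial (Fin n) ℂ)).out (I := P)
        (Ideal.IsPrime.isRadical inferInstance)
      exact this
    have : g ∉ P.jacobson := by rw [hrad]; exact hgP
    rw [Ideal.jacobson, Ideal.mem_sInf] at this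
    push Not at this
    obtain ⟨m, ⟨hPm, hm⟩, hgm⟩ := this
    refine ⟨m, hm, hPm, fun Q hQ hQm => ?_⟩
    by_contra hne
    exact hgm (hQm (hgJ Q hQ hne))
  have hsub : Set.range f ⊆ (m : Set (MvPolynomial (Fin n) ℂ)) :=
    (Ideal.subset_span).trans (hP.1.2.trans hPm)
  have h1 := Ideal.height_le_height_add_encard_of_subset (Set.range f) (p := m) hsub
  rw [height_of_isMaximal_mvPolynomial] at h1
  have hcard : (Set.range f).encard ≤ k := by
    rw [← Set.image_univ]
    exact (Set.encard_image_le _ _).trans (by simp)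
  have h2 : ((m.map (Ideal.Quotient.mk I)).height : WithBot ℕ∞) ≤
      ringKrullDim (MvPolynomial (Fin n) ℂ ⧸ P) :=
    height_map_quotient_le_ringKrullDim I P m (hP.1.2.trans hPm) hmQ
  calc (n : WithBot ℕ∞) = ((n : ℕ∞) : WithBot ℕ∞) := rfl
    _ ≤ (((m.map (Ideal.Quotient.mk I)).height + (Set.range f).encard : ℕ∞) : WithBot ℕ∞) :=
      WithBot.coe_le_coe.2 h1
    _ ≤ (((m.map (Ideal.Quotient.mk I)).height + (k : ℕ∞) : ℕ∞) : WithBot ℕ∞) :=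
      WithBot.coe_le_coe.2 (by gcongr)
    _ = ((m.map (Ideal.Quotient.mk I)).height : WithBot ℕ∞) + (k : WithBot ℕ∞) := rfl
    _ ≤ _ := by gcongr

/-- A set of codimension greater than `k` is not dense in a component of the zero set of `k`
polynomials. -/
theorem not_vanishingIdeal_le_of_adim (n k : ℕ)
    (f : Fin k → MvPolynomial (Fin n) ℂ) (P : Ideal (MvPolynomial (Fin n) ℂ))
    (hP : P ∈ (Ideal.span (Set.range f)).minimalPrimes) (S : Set (Fin n → ℂ))
    (hS : adim ℂ n S + ((k + 1 : ℕ) : WithBot ℕ∞) ≤ (n : WithBot ℕ∞)) :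
    ¬ vanishingIdeal ℂ n S ≤ P := by
  intro hle
  have hPp := hP.1.1
  have h1 := le_ringKrullDim_quotient_of_mem_minimalPrimes n k f P hP
  have h2 : ringKrullDim (MvPolynomial (Fin n) ℂ ⧸ P) ≤ adim ℂ n S :=
    ringKrullDim_le_of_surjective (Ideal.Quotient.factor hle) (Ideal.Quotient.factor_surjective hle)
  have h3 : ringKrullDim (MvPolynomial (Fin n) ℂ ⧸ P) + (k : WithBot ℕ∞) + 1 ≤
      ringKrullDim (MvPolynomial (Fin n) ℂ ⧸ P) + (k : WithBot ℕ∞) := by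
    refine le_trans ?_ (hS.trans h1)
    rw [add_assoc]
    push_cast
    gcongr
  have h4 : ringKrullDim (MvPolynomial (Fin n) ℂ ⧸ P) ≤ n := by
    refine (ringKrullDim_quotient_le P).trans ?_
    simp
  have h5 : 0 ≤ ringKrullDim (MvPolynomial (Fin n) ℂ ⧸ P) := ringKrullDim_nonneg_of_nontrivial
  obtain ⟨d, hd⟩ : ∃ d : ℕ, ringKrullDim (MvPolynomial (Fin n) ℂ ⧸ P) = d := by
    cases h : ringKrullDim (MvPolynomial (Fin n) ℂ ⧸ P) with
    | bot => rw [h] at h5; simp at h5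
    | coe x =>
      rw [h] at h4
      have : x ≤ n := WithBot.coe_le_coe.1 h4
      obtain ⟨d, hd⟩ := ENat.ne_top_iff_exists.1 (ne_top_of_le_ne_top (ENat.natCast_ne_top n) this)
      exact ⟨d, by rw [← hd]; rfl⟩
  rw [hd] at h3
  norm_cast at h3
  omega

theorem rank_mvPolynomial_quotient_le_aleph0 {σ : Type} [Countable σ]
    (M : Ideal (MvPolynomial σ ℂ)) :
    Module.rank ℂ (MvPolynomial σ ℂ ⧸ M) ≤ Cardinal.aleph0 := by
  refine (LinearMap.rank_le_of_surjective (Ideal.Quotient.mkₐ ℂ M).toLinearMap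
    (Ideal.Quotient.mkₐ_surjective ℂ M)).trans ?_
  rw [← (MvPolynomial.basisMonomials σ ℂ).mk_eq_rank'']
  exact Cardinal.mk_le_aleph0

/-- The Nullstellensatz over `ℂ` in countably many variables. -/
theorem exists_zero_of_ne_top {σ : Type} [Countable σ] (J : Ideal (MvPolynomial σ ℂ))
    (hJ : J ≠ ⊤) : ∃ z : σ → ℂ, ∀ p ∈ J, eval z p = 0 := by
  obtain ⟨M, hM, hJM⟩ := Ideal.exists_le_maximal J hJ
  let _ : Field (MvPolynomial σ ℂ ⧸ M) := Ideal.Quotient.field M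
  have halg : Algebra.IsAlgebraic ℂ (MvPolynomial σ ℂ ⧸ M) := by
    rw [Algebra.isAlgebraic_def]
    intro x
    by_contra hx
    have h := (Transcendental.linearIndependent_sub_inv hx).cardinal_le_rank
    have h2 := h.trans (rank_mvPolynomial_quotient_le_aleph0 M)
    rw [Cardinal.mk_le_aleph0_iff, ← Set.countable_univ_iff] at h2
    exact not_countable_complex h2
  have hbij := IsAlgClosed.algebraMap_bijective_of_isIntegral (k := ℂ)
    (K := MvPolynomial σ ℂ ⧸ M)
  choose z hz using fun i => hbij.2 (Ideal.Quotient.mk M (X i))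
  refine ⟨z, fun p hp => hbij.1 ?_⟩
  have key : ((Algebra.ofId ℂ (MvPolynomial σ ℂ ⧸ M)).comp (aeval z)) =
      Ideal.Quotient.mkₐ ℂ M := by
    ext i
    simpa [Algebra.ofId_apply] using hz i
  have := DFunLike.congr_fun key p
  rw [map_zero]
  simpa [Algebra.ofId_apply, Ideal.Quotient.eq_zero_iff_mem.2 (hJM hp),
    MvPolynomial.aeval_eq_eval] using this

/-- A prime ideal has a zero avoiding countably many hypersurfaces not containing its
zero locus. -/
theorem exists_zero_forall_ne_zero {n : ℕ} (P : Ideal (MvPolynomial (Fin n) ℂ)) [P.IsPrime]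
    {ι : Type} [Countable ι] (r : ι → MvPolynomial (Fin n) ℂ) (hr : ∀ i, r i ∉ P) :
    ∃ z : Fin n → ℂ, (∀ p ∈ P, eval z p = 0) ∧ ∀ i, eval z (r i) ≠ 0 := by
  let K := FractionRing (MvPolynomial (Fin n) ℂ ⧸ P)
  let φ : MvPolynomial (Fin n) ℂ →ₐ[ℂ] K :=
    (IsScalarTower.toAlgHom ℂ (MvPolynomial (Fin n) ℂ ⧸ P) K).comp (Ideal.Quotient.mkₐ ℂ P)
  have hφ : ∀ p, φ p = 0 ↔ p ∈ P := by
    intro p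
    simp [φ, K, Ideal.Quotient.eq_zero_iff_mem]
  let S : Set (MvPolynomial (Fin n ⊕ ι) ℂ) :=
    (rename Sum.inl '' (P : Set _)) ∪ Set.range fun i => rename Sum.inl (r i) * X (Sum.inr i) - 1
  let ψ : MvPolynomial (Fin n ⊕ ι) ℂ →ₐ[ℂ] K :=
    aeval (Sum.elim (fun j => φ (X j)) fun i => (φ (r i))⁻¹)
  have hψ : ∀ p, ψ (rename Sum.inl p) = φ p := by
    intro p
    rw [aeval_rename]
    exact (DFunLike.congr_fun (MvPolynomial.aeval_unique φ) p).symm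
  have hne : Ideal.span S ≠ ⊤ := by
    intro h
    have : Ideal.span S ≤ RingHom.ker ψ := by
      rw [Ideal.span_le]
      rintro _ (⟨p, hp, rfl⟩ | ⟨i, rfl⟩)
      · exact (hψ p).trans ((hφ p).2 hp)
      · have : φ (r i) ≠ 0 := fun h => hr i ((hφ _).1 h)
        have h2 : ψ (X (Sum.inr i)) = (φ (r i))⁻¹ := by simp [ψ]
        simp only [SetLike.mem_coe, RingHom.mem_ker, map_sub, map_mul, hψ, h2, map_one]
        rw [mul_inv_cancel₀ this, sub_self]
    have h1 : (1 : MvPolynomial (Fin n ⊕ ι) ℂ) ∈ RingHom.ker ψ := this (h ▸ Submodule.mem_top)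
    simp [RingHom.mem_ker] at h1
  obtain ⟨z, hz⟩ := exists_zero_of_ne_top _ hne
  refine ⟨z ∘ Sum.inl, fun p hp => ?_, fun i h => ?_⟩
  · simpa [eval_rename] using hz _ (Ideal.subset_span (Or.inl ⟨p, hp, rfl⟩))
  · have := hz _ (Ideal.subset_span (Or.inr ⟨i, rfl⟩))
    simp [eval_rename, h] at this

/-- A compact group of linear maps has a fixed point in every stable nonempty closed
convex set. -/
theorem exists_fixed_of_compact {κ E : Type*} [TopologicalSpace κ] [NormedAddCommGroup E]
    [NormedSpace ℝ E] [FiniteDimensional ℝ E] (K : Set κ) (hK : IsCompact K) (hne : K.Nonempty)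
    (ρ : κ → E →ₗ[ℝ] E) (hρ : Continuous fun x : κ × E => ρ x.1 x.2)
    (hmul : ∀ h ∈ K, ∀ k ∈ K, ∃ l ∈ K, ∀ x, ρ l x = ρ k (ρ h x))
    (hinv : ∀ k ∈ K, ∃ l ∈ K, ∀ x, ρ l (ρ k x) = x)
    (C : Set E) (hCc : IsClosed C) (hCv : Convex ℝ C) (hCn : C.Nonempty)
    (hCs : ∀ k ∈ K, ∀ x ∈ C, ρ k x ∈ C) :
    ∃ x ∈ C, ∀ k ∈ K, ρ k x = x := by
  obtain ⟨N, hNdef⟩ : ∃ N : κ → E → ℝ, ∀ k x, N k x = ‖toEuclidean (ρ k x)‖ :=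
    ⟨_, fun _ _ => rfl⟩
  have hN : Continuous fun x : κ × E => N x.1 x.2 := by
    simp only [hNdef]
    exact (toEuclidean.continuous.comp hρ).norm
  have hNx : ∀ x, Continuous fun k => N k x := fun x =>
    hN.comp (continuous_id.prodMk continuous_const)
  obtain ⟨Φ, hΦdef⟩ : ∃ Φ : E → ℝ, ∀ x, Φ x = sSup ((fun k => N k x) '' K) :=
    ⟨_, fun _ => rfl⟩
  have hΦ : Continuous Φ := by
    simp only [funext hΦdef]
    exact hK.continuous_sSup (f := fun x k => N k x) (hN.comp continuous_swap)
  have hle : ∀ x, ∀ k ∈ K, N k x ≤ Φ x := fun x k hk => by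
    rw [hΦdef]
    exact le_csSup (hK.image (hNx x)).bddAbove (Set.mem_image_of_mem (fun k => N k x) hk)
  have hatt : ∀ x, ∃ k ∈ K, Φ x = N k x := fun x => by
    obtain ⟨k, hk, h⟩ := (hK.image (hNx x)).sSup_mem (hne.image _)
    exact ⟨k, hk, by rw [hΦdef]; exact h.symm⟩
  have hone : ∃ e ∈ K, ∀ x, ρ e x = x := by
    obtain ⟨k, hk⟩ := hne
    obtain ⟨l, hl, h⟩ := hinv k hk
    obtain ⟨e, he, h2⟩ := hmul k hk l hl
    exact ⟨e, he, fun x => by rw [h2, h]⟩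
  obtain ⟨e, heK, he⟩ := hone
  obtain ⟨x0, hx0⟩ := hCn
  have hcpt : IsCompact (C ∩ toEuclidean ⁻¹' Metric.closedBall 0 (Φ x0)) :=
    ((toEuclidean (E := E)).toHomeomorph.isClosedEmbedding.isCompact_preimage
      (isCompact_closedBall _ _)).inter_left hCc
  have hx0m : x0 ∈ C ∩ toEuclidean ⁻¹' Metric.closedBall 0 (Φ x0) := by
    refine ⟨hx0, ?_⟩
    have := hle x0 e heK
    simpa [hNdef, he] using this
  obtain ⟨x, hx, hmin⟩ := hcpt.exists_isMinOn ⟨x0, hx0m⟩ hΦ.continuousOn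
  have hmin' : ∀ y ∈ C, Φ x ≤ Φ y := by
    intro y hy
    by_cases h : Φ y ≤ Φ x0
    · refine hmin ⟨hy, ?_⟩
      have := (hle y e heK).trans h
      simpa [hNdef, he] using this
    · exact (hmin hx0m).trans (not_le.1 h).le
  refine ⟨x, hx.1, fun k hk => ?_⟩
  by_contra hkx
  have hkC := hCs k hk x hx.1
  have h1 : Φ (ρ k x) ≤ Φ x := by
    obtain ⟨l, hl, h⟩ := hatt (ρ k x)
    obtain ⟨m, hm, h2⟩ := hmul k hk l hl
    rw [h]
    have := hle x m hm
    rwa [hNdef, h2, ← hNdef] at this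
  let y := (1 / 2 : ℝ) • ρ k x + (1 / 2 : ℝ) • x
  have hy : y ∈ C := hCv hkC hx.1 (by norm_num) (by norm_num) (by norm_num)
  obtain ⟨l, hl, hly⟩ := hatt y
  have h2 := hmin' y hy
  rw [hly] at h2
  have h3 := (hle _ l hl).trans h1
  have h4 := hle x l hl
  have hdiff : ρ l (ρ k x) - ρ l x ≠ 0 := by
    intro h
    rw [← map_sub] at h
    obtain ⟨l', -, hl'⟩ := hinv l hl
    have := hl' (ρ k x - x)
    rw [h, map_zero] at this
    exact hkx (sub_eq_zero.1 this.symm)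
  set a := toEuclidean (ρ l (ρ k x)) with ha
  set b := toEuclidean (ρ l x) with hb
  have hab : 0 < ‖a - b‖ := by
    rw [norm_pos_iff, ha, hb, ← map_sub]
    exact fun h => hdiff (toEuclidean.map_eq_zero_iff.1 h)
  have hNy : N l y = ‖(1 / 2 : ℝ) • (a + b)‖ := by
    simp only [hNdef, y, map_add, map_smul, smul_add, ha, hb]
  have h5 : N l y = 1 / 2 * ‖a + b‖ := by rw [hNy, norm_smul]; norm_num
  have hpar := parallelogram_law_with_norm ℝ a b
  rw [hNdef, ← ha] at h3
  rw [hNdef, ← hb] at h4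
  have h0 : 0 ≤ Φ x := (norm_nonneg _).trans h3
  rw [h5] at h2
  nlinarith [norm_nonneg a, norm_nonneg b, norm_nonneg (a + b), mul_pos hab hab]

/-- The polynomial `p ∘ k`, for a matrix `k`. -/
def compMatrix {n : ℕ} (k : Matrix (Fin n) (Fin n) ℂ) :
    MvPolynomial (Fin n) ℂ →ₐ[ℂ] MvPolynomial (Fin n) ℂ :=
  aeval fun i => ∑ j, C (k i j) * X j

theorem eval_compMatrix {n : ℕ} (k : Matrix (Fin n) (Fin n) ℂ) (p : MvPolynomial (Fin n) ℂ)
    (v : Fin n → ℂ) : eval v (compMatrix k p) = eval (k.mulVec v) p := by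
  induction p using MvPolynomial.induction_on with
  | C a => simp [compMatrix, MvPolynomial.algebraMap_eq]
  | add p q hp hq => simp [hp, hq]
  | mul_X p i hp =>
    rw [map_mul, map_mul, map_mul, hp]
    simp [compMatrix, Matrix.mulVec, dotProduct]

/-- The polynomial `g ↦ p (g v)` in the entries of a matrix `g`. -/
def orbitPoly {n : ℕ} (v : Fin n → ℂ) :
    MvPolynomial (Fin n) ℂ →ₐ[ℂ] MvPolynomial (Fin n × Fin n) ℂ :=
  aeval fun i => ∑ j, X (i, j) * C (v j)

theorem eval_orbitPoly {n : ℕ} (v : Fin n → ℂ) (p : MvPolynomial (Fin n) ℂ)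
    (g : Matrix (Fin n) (Fin n) ℂ) :
    eval (fun ij => g ij.1 ij.2) (orbitPoly v p) = eval (g.mulVec v) p := by
  induction p using MvPolynomial.induction_on with
  | C a => simp [orbitPoly, MvPolynomial.algebraMap_eq]
  | add p q hp hq => rw [map_add, map_add, map_add, hp, hq]
  | mul_X p i hp =>
    rw [map_mul, map_mul, map_mul, hp]
    simp [orbitPoly, Matrix.mulVec, dotProduct]

theorem totalDegree_compMatrix_le {n : ℕ} (k : Matrix (Fin n) (Fin n) ℂ)
    (p : MvPolynomial (Fin n) ℂ) : (compMatrix k p).totalDegree ≤ p.totalDegree := by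
  have hlin : ∀ i, (∑ j, C (k i j) * X j : MvPolynomial (Fin n) ℂ).totalDegree ≤ 1 := by
    intro i
    refine totalDegree_finsetSum_le fun j _ => ?_
    refine (totalDegree_mul _ _).trans ?_
    simp [totalDegree_C, totalDegree_X]
  rw [compMatrix, aeval_def, eval₂_eq]
  refine totalDegree_finsetSum_le fun m hm => ?_
  refine (totalDegree_mul _ _).trans ?_
  rw [MvPolynomial.algebraMap_eq, totalDegree_C, zero_add]
  refine (totalDegree_finsetProd _ _).trans ?_
  refine le_trans ?_ (le_totalDegree hm)
  refine Finset.sum_le_sum fun i _ => ?_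
  refine (totalDegree_pow _ _).trans ?_
  simpa using Nat.mul_le_mul_left (m i) (hlin i)

theorem continuous_coeff_compMatrix {n : ℕ} (p : MvPolynomial (Fin n) ℂ) (m : Fin n →₀ ℕ) :
    Continuous fun k : Matrix (Fin n) (Fin n) ℂ => coeff m (compMatrix k p) := by
  have hmul : ∀ F H : Matrix (Fin n) (Fin n) ℂ → MvPolynomial (Fin n) ℂ,
      (∀ m, Continuous fun k => coeff m (F k)) → (∀ m, Continuous fun k => coeff m (H k)) →
      ∀ m, Continuous fun k => coeff m (F k * H k) := by
    intro F H hF hH m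
    simp only [coeff_mul]
    exact continuous_finsetSum _ fun x _ => (hF _).mul (hH _)
  induction p using MvPolynomial.induction_on generalizing m with
  | C a => simpa [compMatrix] using continuous_const
  | add p q hp hq =>
    simp only [map_add, coeff_add]
    exact (hp m).add (hq m)
  | mul_X p i hp =>
    simp only [map_mul]
    refine hmul _ _ hp (fun m => ?_) m
    simp only [compMatrix, aeval_X, coeff_sum, coeff_C_mul]
    exact continuous_finsetSum _ fun j _ => (continuous_id.matrix_elem i j).mul continuous_const

/-- Separation of disjoint closed stable sets by invariants. -/
theorem exists_invariant_separating {n : ℕ} {G : Set (Matrix (Fin n) (Fin n) ℂ)}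
    (hG : IsReductiveGroup ℂ n G) (A B : Set (Fin n → ℂ))
    (hA : Stabilizes ℂ n G A) (hB : Stabilizes ℂ n G B)
    (hAB : Disjoint (zclosure ℂ n A) (zclosure ℂ n B)) :
    ∃ q, Invariant ℂ n G q ∧ (∀ v ∈ A, eval v q = 0) ∧ ∀ v ∈ B, eval v q = 1 := by
  obtain ⟨hGs, -, K, hKG, hK, hKs, hKd⟩ := hG
  have htop : vanishingIdeal ℂ n A ⊔ vanishingIdeal ℂ n B = ⊤ := by
    by_contra h
    obtain ⟨z, hz⟩ := exists_zero_of_ne_top _ h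
    exact Set.disjoint_left.1 hAB (fun p hp => hz p (Ideal.mem_sup_left hp)) fun p hp =>
      hz p (Ideal.mem_sup_right hp)
  obtain ⟨a, ha, b, hb, hab⟩ := Submodule.mem_sup.1
    (htop ▸ Submodule.mem_top : (1 : _) ∈ vanishingIdeal ℂ n A ⊔ vanishingIdeal ℂ n B)
  have haA : ∀ v ∈ A, eval v a = 0 := ha
  have haB : ∀ v ∈ B, eval v a = 1 := by
    intro v hv
    have := congrArg (eval v) hab
    rwa [map_add, hb v hv, add_zero, map_one] at this
  let s := (Finsupp.finite_of_degree_le (σ := Fin n) a.totalDegree).toFinset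
  have hs : ∀ m, m ∈ s ↔ m.degree ≤ a.totalDegree := fun m => by simp [s]
  let T : (s → ℂ) → MvPolynomial (Fin n) ℂ := fun c => ∑ m : s, monomial m.1 (c m)
  have hT : ∀ p : MvPolynomial (Fin n) ℂ, p.totalDegree ≤ a.totalDegree →
      T (fun m => coeff m.1 p) = p := by
    intro p hp
    simp only [T]
    rw [Finset.sum_coe_sort s (fun m => monomial m (coeff m p))]
    conv_rhs => rw [p.as_sum]
    refine (Finset.sum_subset (fun m hm => ?_) fun m _ hm => ?_).symm
    · rw [hs]
      exact (le_totalDegree hm).trans hp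
    · rw [notMem_support_iff.1 hm, monomial_zero]
  have hTdeg : ∀ c, (T c).totalDegree ≤ a.totalDegree := by
    intro c
    refine totalDegree_finsetSum_le fun m _ => (totalDegree_monomial_le _ _).trans ?_
    exact (hs m.1).1 m.2
  let ρ : Matrix (Fin n) (Fin n) ℂ → (s → ℂ) →ₗ[ℝ] (s → ℂ) := fun k =>
    { toFun := fun c m => coeff m.1 (compMatrix k (T c))
      map_add' := by
        intro c d
        ext m
        simp [T, Finset.sum_add_distrib]
      map_smul' := by
        intro r c
        ext m
        simp only [T, map_sum, coeff_sum, Pi.smul_apply, RingHom.id_apply, Finset.smul_sum]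
        refine Finset.sum_congr rfl fun i _ => ?_
        have : monomial i.1 (r • c i) = (r : ℂ) • monomial i.1 (c i) := by
          rw [smul_monomial]; rfl
        rw [this, map_smul, coeff_smul]
        rfl }
  have hTρ : ∀ k c, T (ρ k c) = compMatrix k (T c) := fun k c =>
    hT _ ((totalDegree_compMatrix_le k _).trans (hTdeg c))
  have hTinj : Function.Injective T := by
    intro c d h
    ext m
    have := congrArg (coeff m.1) h
    simpa [T, coeff_sum, coeff_monomial, Subtype.coe_inj] using this
  have hρc : Continuous fun x : Matrix (Fin n) (Fin n) ℂ × (s → ℂ) => ρ x.1 x.2 := by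
    refine continuous_pi fun m => ?_
    have : ∀ x : Matrix (Fin n) (Fin n) ℂ × (s → ℂ), ρ x.1 x.2 m =
        ∑ i : s, x.2 i * coeff m.1 (compMatrix x.1 (monomial i.1 1)) := by
      intro x
      simp only [ρ, T, LinearMap.coe_mk, AddHom.coe_mk, map_sum, coeff_sum]
      refine Finset.sum_congr rfl fun i _ => ?_
      have : monomial i.1 (x.2 i) = x.2 i • monomial i.1 (1 : ℂ) := by
        rw [smul_monomial, smul_eq_mul, mul_one]
      rw [this, map_smul, coeff_smul, smul_eq_mul]
    simp only [this]
    exact continuous_finsetSum _ fun i _ => ((continuous_apply i).comp continuous_snd).mul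
      ((continuous_coeff_compMatrix _ _).comp continuous_fst)
  have hev : ∀ k c v, eval v (T (ρ k c)) = eval (k.mulVec v) (T c) := fun k c v => by
    rw [hTρ, eval_compMatrix]
  have hTev : ∀ v, Continuous fun c => eval v (T c) := by
    intro v
    simp only [T, map_sum, eval_monomial]
    exact continuous_finsetSum _ fun i _ => (continuous_apply i).mul continuous_const
  have hTlin : ∀ (v) (x y : ℝ) (c d), eval v (T (x • c + y • d)) =
      x * eval v (T c) + y * eval v (T d) := by
    intro v x y c d
    simp only [T, map_sum, eval_monomial, Finset.mul_sum, ← Finset.sum_add_distrib]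
    refine Finset.sum_congr rfl fun i _ => ?_
    simp
    ring
  obtain ⟨c, hc, hfix⟩ := exists_fixed_of_compact K hK ⟨1, hKs.1⟩ ρ hρc
    (fun h hh k hk => ⟨h * k, hKs.2.1 h hh k hk, fun x => hTinj (MvPolynomial.funext fun v => by
      rw [hev, hev, hev, Matrix.mulVec_mulVec])⟩)
    (fun k hk => ⟨k⁻¹, (hKs.2.2 k hk).2, fun x => hTinj (MvPolynomial.funext fun v => by
      have := (Matrix.isUnit_iff_isUnit_det _).1 (hKs.2.2 k hk).1
      rw [hev, hev, Matrix.mulVec_mulVec, Matrix.mul_nonsing_inv _ this, Matrix.one_mulVec])⟩)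
    {c | (∀ v ∈ A, eval v (T c) = 0) ∧ ∀ v ∈ B, eval v (T c) = 1}
    (by
      have h1 : IsClosed {c | ∀ v ∈ A, eval v (T c) = 0} := by
        simp only [Set.ofPred_forall]
        exact isClosed_iInter fun v => isClosed_iInter fun _ =>
          isClosed_eq (hTev v) continuous_const
      have h2 : IsClosed {c | ∀ v ∈ B, eval v (T c) = 1} := by
        simp only [Set.ofPred_forall]
        exact isClosed_iInter fun v => isClosed_iInter fun _ =>
          isClosed_eq (hTev v) continuous_const
      exact h1.inter h2)
    (by
      intro c hc d hd x y _ _ hxy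
      refine ⟨fun v hv => ?_, fun v hv => ?_⟩
      · rw [hTlin, hc.1 v hv, hd.1 v hv]; simp
      · rw [hTlin, hc.2 v hv, hd.2 v hv, mul_one, mul_one]; exact_mod_cast hxy)
    ⟨fun m => coeff m.1 a, by
      refine ⟨fun v hv => ?_, fun v hv => ?_⟩ <;> rw [hT a le_rfl]
      exacts [haA v hv, haB v hv]⟩
    (fun k hk c hc => ⟨fun v hv => by rw [hev, hc.1 _ (hA k (hKG hk) v hv)],
      fun v hv => by rw [hev, hc.2 _ (hB k (hKG hk) v hv)]⟩)
  refine ⟨T c, ?_, hc.1, hc.2⟩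
  intro g hg v
  have h0 : ∀ g : Matrix (Fin n) (Fin n) ℂ,
      eval (fun ij => g ij.1 ij.2) (orbitPoly v (T c) - C (eval v (T c))) =
        eval (g.mulVec v) (T c) - eval v (T c) := fun g => by
    rw [map_sub, eval_C, eval_orbitPoly]
  have := hKd _ (fun k hk => by rw [h0, ← hev, hfix k hk, sub_self]) g hg
  rwa [h0, sub_eq_zero] at this

/-- The image of a polynomial map contains a dense open subset of its closure. -/
theorem exists_dense_open_subset_image {σ τ : Type} [Finite σ] [Finite τ]
    (α : MvPolynomial σ ℂ →ₐ[ℂ] MvPolynomial τ ℂ) (q : Ideal (MvPolynomial τ ℂ)) [q.IsPrime] :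
    ∃ h ∉ q.comap α, ∀ z : σ → ℂ, (∀ p ∈ q.comap α, eval z p = 0) → eval z h ≠ 0 →
      ∃ g : τ → ℂ, (∀ p ∈ q, eval g p = 0) ∧ ∀ p, eval z p = eval g (α p) := by
  let f : MvPolynomial σ ℂ →ₐ[ℂ] MvPolynomial τ ℂ ⧸ q := (Ideal.Quotient.mkₐ ℂ q).comp α
  have hf0 : ∀ p, f p = 0 ↔ p ∈ q.comap α := fun p => by
    simp [f, Ideal.Quotient.eq_zero_iff_mem, Ideal.mem_comap]
  have hft : f.toRingHom.FiniteType := by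
    refine RingHom.FiniteType.of_comp_finiteType (f := algebraMap ℂ (MvPolynomial σ ℂ)) ?_
    rw [show f.toRingHom.comp (algebraMap ℂ (MvPolynomial σ ℂ)) = algebraMap ℂ _ from
      f.comp_algebraMap]
    exact RingHom.finiteType_algebraMap.2 inferInstance
  obtain ⟨S, hS⟩ := PrimeSpectrum.exists_constructibleSetData_iff.2
    (PrimeSpectrum.isConstructible_range_comap (RingHom.FinitePresentation.of_finiteType.1 hft))
  have hbot : PrimeSpectrum.comap f.toRingHom ⟨⊥, Ideal.isPrime_bot⟩ ∈ S.toSet :=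
    hS ▸ Set.mem_range_self _
  simp only [PrimeSpectrum.ConstructibleSetData.toSet, Set.mem_iUnion] at hbot
  obtain ⟨D, hDS, hD⟩ := hbot
  have hD1 : ∀ i, D.g i ∈ q.comap α := fun i => by
    have := hD.1 (Set.mem_range_self i)
    rw [← hf0]
    simpa using this
  refine ⟨D.f, fun h => hD.2 ?_, fun z hz hne => ?_⟩
  · rintro _ rfl
    rw [← hf0] at h
    simpa using h
  have hmem : (⟨RingHom.ker (eval z), RingHom.ker_isPrime _⟩ : PrimeSpectrum (MvPolynomial σ ℂ)) ∈
      S.toSet := by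
    simp only [PrimeSpectrum.ConstructibleSetData.toSet, Set.mem_iUnion]
    refine ⟨D, hDS, ?_, fun h => hne (h rfl)⟩
    rintro _ ⟨i, rfl⟩
    exact hz _ (hD1 i)
  rw [hS] at hmem
  obtain ⟨Q, hQ⟩ := hmem
  have hQ' : Q.asIdeal.comap f.toRingHom = RingHom.ker (eval z) :=
    congrArg PrimeSpectrum.asIdeal hQ
  obtain ⟨g, hg⟩ := exists_zero_of_ne_top (Q.asIdeal.comap (Ideal.Quotient.mk q))
    (Ideal.IsPrime.ne_top (Ideal.IsPrime.comap _ (hK := Q.isPrime)))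
  refine ⟨g, fun p hp => hg p ?_, fun p => ?_⟩
  · rw [Ideal.mem_comap, Ideal.Quotient.eq_zero_iff_mem.2 hp]
    exact Q.asIdeal.zero_mem
  · have h1 : p - C (eval z p) ∈ Q.asIdeal.comap f.toRingHom := by
      rw [hQ', RingHom.mem_ker, map_sub, eval_C, sub_self]
    have h2 : α (p - C (eval z p)) ∈ Q.asIdeal.comap (Ideal.Quotient.mk q) := h1
    have h3 := hg _ h2
    rw [map_sub, map_sub, ← MvPolynomial.algebraMap_eq, AlgHom.commutes,
      MvPolynomial.algebraMap_eq, eval_C] at h3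
    exact (sub_eq_zero.1 h3).symm

/-- A component of an orbit closure, composed with a polynomial map: the image of the orbit
contains a dense open subset of the closure of the image. -/
theorem exists_dense_open_subset_orbit {n : ℕ} {σ : Type} [Finite σ]
    {G : Set (Matrix (Fin n) (Fin n) ℂ)} (hG : IsZClosedInGL ℂ n G) (x : Fin n → ℂ)
    (p : Ideal (MvPolynomial (Fin n) ℂ))
    (hp : p ∈ (vanishingIdeal ℂ n (orbit ℂ n G x)).minimalPrimes)
    (β : MvPolynomial σ ℂ →ₐ[ℂ] MvPolynomial (Fin n) ℂ) :
    ∃ h ∉ p.comap β, ∀ z : σ → ℂ, (∀ r ∈ p.comap β, eval z r = 0) → eval z h ≠ 0 →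
      ∃ y ∈ orbit ℂ n G x, ∀ r, eval z r = eval y (β r) := by
  let pt : Matrix (Fin n) (Fin n) ℂ → Option (Fin n × Fin n) → ℂ :=
    fun g o => o.elim g.det⁻¹ fun ij => g ij.1 ij.2
  let J : Ideal (MvPolynomial (Option (Fin n × Fin n)) ℂ) :=
    ⨅ g ∈ G, RingHom.ker (eval (pt g))
  have hJ : ∀ r, r ∈ J ↔ ∀ g ∈ G, eval (pt g) r = 0 := fun r => by
    simp [J, RingHom.mem_ker]
  obtain ⟨P, hP⟩ := hG
  have hJ0 : ∀ t : Option (Fin n × Fin n) → ℂ, (∀ r ∈ J, eval t r = 0) →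
      Matrix.of (fun i j => t (some (i, j))) ∈ G := by
    intro t ht
    rw [hP]
    refine ⟨?_, fun r hr => ?_⟩
    · let D : MvPolynomial (Option (Fin n × Fin n)) ℂ :=
        (Matrix.of fun i j => X (some (i, j)) : Matrix (Fin n) (Fin n) _).det
      have hD : ∀ s : Option (Fin n × Fin n) → ℂ,
          eval s D = (Matrix.of fun i j => s (some (i, j))).det := by
        intro s
        simp only [D]
        rw [RingHom.map_det]
        congr 1
        ext i j
        simp
      have h1 : D * X none - 1 ∈ J := by
        rw [hJ]
        intro g hg
        have hg := (hP ▸ hg : g ∈ {g | _}).1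
        have hne : g.det ≠ 0 := ((Matrix.isUnit_iff_isUnit_det _).1 hg).ne_zero
        rw [map_sub, map_mul, hD, eval_X, map_one]
        change g.det * g.det⁻¹ - 1 = 0
        rw [mul_inv_cancel₀ hne, sub_self]
      have h2 := ht _ h1
      rw [map_sub, map_mul, hD, map_one, sub_eq_zero] at h2
      rw [Matrix.isUnit_iff_isUnit_det]
      exact IsUnit.of_mul_eq_one _ h2
    · have h1 : rename some r ∈ J := by
        rw [hJ]
        intro g hg
        have hg := (hP ▸ hg : g ∈ {g | _}).2
        rw [eval_rename]
        exact hg r hr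
      have h2 := ht _ h1
      rw [eval_rename] at h2
      exact h2
  let α : MvPolynomial (Fin n) ℂ →ₐ[ℂ] MvPolynomial (Option (Fin n × Fin n)) ℂ :=
    (rename some).comp (orbitPoly x)
  have hα : ∀ t r, eval t (α r) = eval ((Matrix.of fun i j => t (some (i, j))).mulVec x) r := by
    intro t r
    rw [AlgHom.comp_apply, eval_rename, ← eval_orbitPoly]
    rfl
  have hI : vanishingIdeal ℂ n (orbit ℂ n G x) = J.comap α := by
    ext r
    rw [Ideal.mem_comap, hJ]
    constructor
    · intro h g hg
      rw [hα]
      exact h _ ⟨g, hg, rfl⟩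
    · rintro h _ ⟨g, hg, rfl⟩
      have := h g hg
      rw [hα] at this
      exact this
  rw [hI] at hp
  obtain ⟨q, hq, hJq, hqp⟩ := Ideal.exists_comap_eq_of_mem_minimalPrimes α.toRingHom p hp
  obtain ⟨h, hh, H⟩ := exists_dense_open_subset_image (α.comp β) q
  have hcomap : q.comap (α.comp β) = p.comap β := by rw [← hqp]; rfl
  rw [hcomap] at hh H
  refine ⟨h, hh, fun z hz hne => ?_⟩
  obtain ⟨t, ht, hzt⟩ := H z hz hne
  refine ⟨_, ⟨_, hJ0 t fun r hr => ht r (hJq hr), rfl⟩, fun r => ?_⟩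
  rw [hzt, AlgHom.comp_apply, hα]

theorem mulVec_mem_zclosure_orbit {n : ℕ} {G : Set (Matrix (Fin n) (Fin n) ℂ)}
    (hG : IsMatSubgroup ℂ n G) (x : Fin n → ℂ) :
    Stabilizes ℂ n G (zclosure ℂ n (orbit ℂ n G x)) := by
  intro g hg z hz p hp
  rw [← eval_compMatrix]
  refine hz _ ?_
  rintro _ ⟨a, ha, rfl⟩
  rw [eval_compMatrix]
  exact hp _ ⟨g * a, hG.2.1 g hg a ha, (Matrix.mulVec_mulVec _ _ _).symm⟩

theorem subset_zclosure {n : ℕ} (A : Set (Fin n → ℂ)) : A ⊆ zclosure ℂ n A :=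
  fun _ ha _ hp => hp _ ha

theorem mem_orbit_self {n : ℕ} {G : Set (Matrix (Fin n) (Fin n) ℂ)}
    (hG : IsMatSubgroup ℂ n G) (x : Fin n → ℂ) : x ∈ orbit ℂ n G x :=
  ⟨1, hG.1, Matrix.one_mulVec x⟩

theorem mem_orbit_of_mulVec_mem {n : ℕ} {G : Set (Matrix (Fin n) (Fin n) ℂ)}
    (hG : IsMatSubgroup ℂ n G) {x z : Fin n → ℂ} {g : Matrix (Fin n) (Fin n) ℂ} (hg : g ∈ G)
    (h : g.mulVec z ∈ orbit ℂ n G x) : z ∈ orbit ℂ n G x := by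
  obtain ⟨a, ha, hax⟩ := h
  refine ⟨g⁻¹ * a, hG.2.1 _ (hG.2.2 g hg).2 a ha, ?_⟩
  have := (Matrix.isUnit_iff_isUnit_det _).1 (hG.2.2 g hg).1
  change (g⁻¹ * a).mulVec x = z
  rw [← Matrix.mulVec_mulVec]
  simp only at hax
  rw [hax, Matrix.mulVec_mulVec, Matrix.nonsing_inv_mul _ this, Matrix.one_mulVec]

theorem vanishingIdeal_le_of_mem_zclosure {n : ℕ} {G : Set (Matrix (Fin n) (Fin n) ℂ)}
    (hG : IsMatSubgroup ℂ n G) {x z : Fin n → ℂ} (hz : z ∈ zclosure ℂ n (orbit ℂ n G x)) :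
    vanishingIdeal ℂ n (orbit ℂ n G x) ≤ vanishingIdeal ℂ n (orbit ℂ n G z) := by
  rintro p hp _ ⟨g, hg, rfl⟩
  exact mulVec_mem_zclosure_orbit hG x g hg z hz p hp

/-- An orbit contains a nonempty open subset of its closure. -/
theorem exists_open_subset_orbit {n : ℕ} {G : Set (Matrix (Fin n) (Fin n) ℂ)}
    (hG : IsMatSubgroup ℂ n G) (hGz : IsZClosedInGL ℂ n G) (x : Fin n → ℂ) :
    ∃ h ∉ vanishingIdeal ℂ n (orbit ℂ n G x), ∀ z ∈ zclosure ℂ n (orbit ℂ n G x),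
      eval z h ≠ 0 → z ∈ orbit ℂ n G x := by
  have hne : vanishingIdeal ℂ n (orbit ℂ n G x) ≠ ⊤ := by
    intro h
    have h1 : (1 : MvPolynomial (Fin n) ℂ) ∈ vanishingIdeal ℂ n (orbit ℂ n G x) :=
      h ▸ Submodule.mem_top
    simpa using h1 x (mem_orbit_self hG x)
  obtain ⟨p, hp⟩ := Ideal.nonempty_minimalPrimes hne
  have : p.IsPrime := hp.1.1
  obtain ⟨h, hh, H⟩ := exists_dense_open_subset_orbit hGz x p hp (AlgHom.id ℂ _)
  obtain ⟨g, hg, hgQ⟩ := exists_mem_other_minimalPrimes _ p hp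
  have hhp : h ∉ p := hh
  refine ⟨h * g, fun hm => ?_, fun z hz hzne => ?_⟩
  · rcases this.mem_or_mem (hp.1.2 hm) with h1 | h1
    exacts [hhp h1, hg h1]
  rw [map_mul, mul_ne_zero_iff] at hzne
  have hker : vanishingIdeal ℂ n (orbit ℂ n G x) ≤ RingHom.ker (eval z) := fun r hr => hz r hr
  have := RingHom.ker_isPrime (eval z)
  obtain ⟨Q, hQ, hQz⟩ := Ideal.exists_minimalPrimes_le hker
  have hQp : Q = p := by
    by_contra hne
    exact hzne.2 (hQz (hgQ Q hQ hne))
  obtain ⟨y, hy, hyz⟩ := H z (fun r hr => hQz (hQp ▸ hr)) hzne.1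
  have : z = y := by
    ext i
    simpa using hyz (X i)
  exact this ▸ hy

/-- Every orbit closure contains a closed orbit. -/
theorem exists_closed_orbit {n : ℕ} {G : Set (Matrix (Fin n) (Fin n) ℂ)}
    (hG : IsMatSubgroup ℂ n G) (hGz : IsZClosedInGL ℂ n G) (u : Fin n → ℂ) :
    ∃ w ∈ zclosure ℂ n (orbit ℂ n G u), HasClosedOrbit ℂ n G w := by
  obtain ⟨M, ⟨w, hw, rfl⟩, hmax⟩ := set_has_maximal_iff_noetherian.2
    (inferInstance : IsNoetherian (MvPolynomial (Fin n) ℂ) (MvPolynomial (Fin n) ℂ))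
    ((fun v => vanishingIdeal ℂ n (orbit ℂ n G v)) '' zclosure ℂ n (orbit ℂ n G u))
    ⟨_, u, subset_zclosure _ (mem_orbit_self hG u), rfl⟩
  refine ⟨w, hw, fun z hz => ?_⟩
  obtain ⟨h, hh, H⟩ := exists_open_subset_orbit hG hGz w
  have hle := vanishingIdeal_le_of_mem_zclosure hG hz
  have hzu : z ∈ zclosure ℂ n (orbit ℂ n G u) := fun p hp =>
    hz p (vanishingIdeal_le_of_mem_zclosure hG hw hp)
  have heq : vanishingIdeal ℂ n (orbit ℂ n G w) = vanishingIdeal ℂ n (orbit ℂ n G z) := by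
    by_contra hne
    exact hmax _ ⟨z, hzu, rfl⟩ (lt_of_le_of_ne hle hne)
  rw [heq] at hh
  obtain ⟨g, hg, hgz⟩ : ∃ g ∈ G, eval (g.mulVec z) h ≠ 0 := by
    by_contra hcon
    push Not at hcon
    apply hh
    rintro _ ⟨g, hg, rfl⟩
    exact hcon g hg
  exact mem_orbit_of_mulVec_mem hG hg
    (H _ (mulVec_mem_zclosure_orbit hG w g hg z hz) hgz)

/-- The closed orbits below a point of the saturation of `Y` lie in `Y`. -/
theorem mem_of_closed_orbit_of_mem_saturation {n : ℕ} {G : Set (Matrix (Fin n) (Fin n) ℂ)}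
    (hG : IsReductiveGroup ℂ n G) {Y : Set (Fin n → ℂ)} (hYalg : IsAlgebraicSet ℂ n Y)
    (hY : Stabilizes ℂ n G Y) {z w : Fin n → ℂ} (hz : z ∈ saturation ℂ n G Y)
    (hw : w ∈ zclosure ℂ n (orbit ℂ n G z)) (hwc : HasClosedOrbit ℂ n G w) : w ∈ Y := by
  by_contra hwY
  obtain ⟨y, hy, hyz⟩ := hz
  have hYc : zclosure ℂ n Y ⊆ Y := by
    obtain ⟨S, rfl⟩ := hYalg
    exact fun v hv p hp => hv p fun x hx => hx p hp
  have hd : Disjoint (zclosure ℂ n (orbit ℂ n G w)) (zclosure ℂ n Y) := by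
    rw [Set.disjoint_left]
    intro v hv hvY
    obtain ⟨g, hg, rfl⟩ := hwc hv
    apply hwY
    have h1 := hY g⁻¹ (hG.1.2.2 g hg).2 _ (hYc hvY)
    have h2 := (Matrix.isUnit_iff_isUnit_det _).1 (hG.1.2.2 g hg).1
    rwa [Matrix.mulVec_mulVec, Matrix.nonsing_inv_mul _ h2, Matrix.one_mulVec] at h1
  have hs : Stabilizes ℂ n G (orbit ℂ n G w) := by
    rintro g hg _ ⟨a, ha, rfl⟩
    exact ⟨g * a, hG.1.2.1 g hg a ha, (Matrix.mulVec_mulVec _ _ _).symm⟩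
  obtain ⟨q, hq, hq0, hq1⟩ := exists_invariant_separating hG _ _ hs hY hd
  have h1 : eval w (q - 1) = 0 := by
    refine hw _ ?_
    rintro _ ⟨g, hg, rfl⟩
    rw [map_sub, hq g hg, hyz q hq, hq1 y hy, map_one, sub_self]
  rw [map_sub, hq0 w (mem_orbit_self hG.1 w), map_one] at h1
  norm_num at h1

section ExpSubgroup

open Filter Topology

variable {𝔸 : Type} [NormedRing 𝔸] {Γ : Set 𝔸}

/-- A subgroup of the units of a Banach algebra, closed among the units. -/
structure IsClosedUnitSubgroup (Γ : Set 𝔸) : Prop where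
  one_mem : 1 ∈ Γ
  mul_mem : ∀ a ∈ Γ, ∀ b ∈ Γ, a * b ∈ Γ
  exists_inv : ∀ a ∈ Γ, ∃ b ∈ Γ, a * b = 1 ∧ b * a = 1
  mem_of_mem_closure : ∀ a ∈ closure Γ, IsUnit a → a ∈ Γ

theorem IsClosedUnitSubgroup.pow_mem (hΓ : IsClosedUnitSubgroup Γ) {a : 𝔸} (ha : a ∈ Γ) (m : ℕ) :
    a ^ m ∈ Γ := by
  induction m with
  | zero => simpa using hΓ.one_mem
  | succ m ih => rw [pow_succ]; exact hΓ.mul_mem _ ih _ ha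

variable [NormedAlgebra ℝ 𝔸] [CompleteSpace 𝔸]

theorem continuous_nexp : Continuous (NormedSpace.exp : 𝔸 → 𝔸) := by
  let _ : NormedAlgebra ℚ 𝔸 := .restrictScalars ℚ ℝ 𝔸
  exact NormedSpace.exp_continuous

theorem isUnit_nexp (x : 𝔸) : IsUnit (NormedSpace.exp x) := by
  let _ : NormedAlgebra ℚ 𝔸 := .restrictScalars ℚ ℝ 𝔸
  exact NormedSpace.isUnit_exp x

theorem nexp_add_of_commute {x y : 𝔸} (h : Commute x y) :
    NormedSpace.exp (x + y) = NormedSpace.exp x * NormedSpace.exp y := by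
  let _ : NormedAlgebra ℚ 𝔸 := .restrictScalars ℚ ℝ 𝔸
  exact NormedSpace.exp_add_of_commute h

theorem nexp_nsmul (m : ℕ) (x : 𝔸) : NormedSpace.exp (m • x) = NormedSpace.exp x ^ m := by
  let _ : NormedAlgebra ℚ 𝔸 := .restrictScalars ℚ ℝ 𝔸
  exact NormedSpace.exp_nsmul m x

theorem nexp_neg_mul (x : 𝔸) : NormedSpace.exp (-x) * NormedSpace.exp x = 1 := by
  rw [← nexp_add_of_commute ((Commute.refl x).neg_left), neg_add_cancel, NormedSpace.exp_zero]

theorem nexp_mul_neg (x : 𝔸) : NormedSpace.exp x * NormedSpace.exp (-x) = 1 := by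
  rw [← nexp_add_of_commute ((Commute.refl x).neg_right), add_neg_cancel, NormedSpace.exp_zero]

theorem IsClosedUnitSubgroup.exp_neg_mem (hΓ : IsClosedUnitSubgroup Γ) {x : 𝔸}
    (hx : NormedSpace.exp x ∈ Γ) : NormedSpace.exp (-x) ∈ Γ := by
  obtain ⟨b, hb, h1, -⟩ := hΓ.exists_inv _ hx
  have : NormedSpace.exp (-x) = b := by
    calc _ = NormedSpace.exp (-x) * (NormedSpace.exp x * b) := by rw [h1, mul_one]
      _ = b := by rw [← mul_assoc, nexp_neg_mul, one_mul]
  rwa [this]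

theorem IsClosedUnitSubgroup.exp_smul_mem_of_tendsto (hΓ : IsClosedUnitSubgroup Γ)
    {ι : Type} {l : Filter ι} [l.NeBot] {Z : ι → 𝔸}
    {ε : ι → ℝ} {X : 𝔸} (hZ : ∀ᶠ i in l, NormedSpace.exp (Z i) ∈ Γ) (hε : ∀ᶠ i in l, 0 < ε i)
    (hε0 : Tendsto ε l (𝓝 0)) (hX : Tendsto (fun i => (ε i)⁻¹ • Z i) l (𝓝 X)) (t : ℝ) :
    NormedSpace.exp (t • X) ∈ Γ := by
  have key : ∀ t : ℝ, 0 ≤ t → NormedSpace.exp (t • X) ∈ Γ := by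
    intro t ht
    refine hΓ.mem_of_mem_closure _ ?_ (isUnit_nexp _)
    have h1 : Tendsto (fun i => (⌊t / ε i⌋₊ : ℝ) * ε i) l (𝓝 t) := by
      have h0 : Tendsto (fun i => t - ε i) l (𝓝 t) := by simpa using hε0.const_sub t
      refine tendsto_of_tendsto_of_tendsto_of_le_of_le' h0 tendsto_const_nhds ?_ ?_
      · filter_upwards [hε] with i hi
        have := (Nat.lt_floor_add_one (t / ε i)).le
        rw [div_le_iff₀ hi] at this
        linarith
      · filter_upwards [hε] with i hi
        have := Nat.floor_le (div_nonneg ht hi.le)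
        rwa [le_div_iff₀ hi] at this
    have h2 : Tendsto (fun i => (⌊t / ε i⌋₊ : ℕ) • Z i) l (𝓝 (t • X)) := by
      refine (h1.smul hX).congr' ?_
      filter_upwards [hε] with i hi
      rw [smul_smul, mul_assoc, mul_inv_cancel₀ hi.ne', mul_one, Nat.cast_smul_eq_nsmul]
    refine mem_closure_of_tendsto ((continuous_nexp.tendsto _).comp h2) ?_
    filter_upwards [hZ] with i hi
    change NormedSpace.exp (⌊t / ε i⌋₊ • Z i) ∈ Γ
    rw [nexp_nsmul]
    exact hΓ.pow_mem hi _
  rcases le_total 0 t with ht | ht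
  · exact key t ht
  · have := hΓ.exp_neg_mem (key (-t) (by linarith))
    simpa using this

/-- The real Lie algebra of a closed group of units, as a set. -/
def lieSet (Γ : Set 𝔸) : Set 𝔸 := {X | ∀ t : ℝ, NormedSpace.exp (t • X) ∈ Γ}

theorem IsClosedUnitSubgroup.add_mem_lieSet (hΓ : IsClosedUnitSubgroup Γ) {X Y : 𝔸}
    (hX : X ∈ lieSet Γ) (hY : Y ∈ lieSet Γ) : X + Y ∈ lieSet Γ := by
  have hexp : HasStrictFDerivAt (NormedSpace.exp : 𝔸 → 𝔸)
      ((ContinuousLinearEquiv.refl ℝ 𝔸 : 𝔸 ≃L[ℝ] 𝔸) : 𝔸 →L[ℝ] 𝔸) 0 := hasStrictFDerivAt_exp_zero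
  obtain ⟨L, hL⟩ : ∃ L, L = hexp.localInverse := ⟨_, rfl⟩
  have hL1 : HasFDerivAt L ((ContinuousLinearEquiv.refl ℝ 𝔸 : 𝔸 ≃L[ℝ] 𝔸) : 𝔸 →L[ℝ] 𝔸) 1 := by
    have := hexp.to_localInverse.hasFDerivAt
    rw [NormedSpace.exp_zero] at this
    simpa [hL] using this
  have hL2 : ∀ᶠ y in 𝓝 (1 : 𝔸), NormedSpace.exp (L y) = y := by
    have := hexp.eventually_right_inverse
    rwa [NormedSpace.exp_zero, ← hL] at this
  have hL3 : L 1 = 0 := by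
    have := hexp.localInverse_apply_image
    rwa [NormedSpace.exp_zero, ← hL] at this
  have hd : ∀ W : 𝔸, HasDerivAt (fun s : ℝ => NormedSpace.exp (s • W)) W 0 := fun W => by
    have h1 : HasDerivAt (fun s : ℝ => s • W) W 0 := by
      simpa using (hasDerivAt_id (0 : ℝ)).smul_const W
    have h2 : HasFDerivAt (NormedSpace.exp : 𝔸 → 𝔸) (1 : 𝔸 →L[ℝ] 𝔸) ((0 : ℝ) • W) := by
      rw [zero_smul]; exact hasFDerivAt_exp_zero
    exact h2.comp_hasDerivAt 0 h1
  have hf : HasDerivAt (fun s : ℝ => NormedSpace.exp (s • X) * NormedSpace.exp (s • Y))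
      (X + Y) 0 := by
    have := (hd X).mul (hd Y)
    simp only [zero_smul, NormedSpace.exp_zero, mul_one, one_mul] at this
    exact this
  have hLf : HasDerivAt
      (fun s : ℝ => L (NormedSpace.exp (s • X) * NormedSpace.exp (s • Y))) (X + Y) 0 := by
    have h2 : HasFDerivAt L ((ContinuousLinearEquiv.refl ℝ 𝔸 : 𝔸 ≃L[ℝ] 𝔸) : 𝔸 →L[ℝ] 𝔸)
      (NormedSpace.exp ((0 : ℝ) • X) * NormedSpace.exp ((0 : ℝ) • Y)) := by simpa using hL1
    exact h2.comp_hasDerivAt 0 hf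
  have hlim := hLf.tendsto_slope_zero_right
  have hcont : Tendsto (fun s : ℝ => NormedSpace.exp (s • X) * NormedSpace.exp (s • Y)) (𝓝[>] 0)
      (𝓝 1) := by
    have := hf.continuousAt.tendsto
    simp only [zero_smul, NormedSpace.exp_zero, mul_one] at this
    exact this.mono_left nhdsWithin_le_nhds
  refine hΓ.exp_smul_mem_of_tendsto (l := 𝓝[>] (0 : ℝ)) (ε := fun s => s)
    (Z := fun s => L (NormedSpace.exp (s • X) * NormedSpace.exp (s • Y))) ?_
    (eventually_mem_nhdsWithin) (tendsto_id.mono_left nhdsWithin_le_nhds) ?_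
  · filter_upwards [hcont.eventually hL2] with s hs
    rw [hs]
    exact hΓ.mul_mem _ (hX s) _ (hY s)
  · simpa [hL3] using hlim

/-- The real Lie algebra of a closed group of units. -/
def IsClosedUnitSubgroup.lie (hΓ : IsClosedUnitSubgroup Γ) : Submodule ℝ 𝔸 where
  carrier := lieSet Γ
  add_mem' := hΓ.add_mem_lieSet
  zero_mem' := fun t => by simpa using hΓ.one_mem
  smul_mem' := fun c X hX t => by rw [smul_smul]; exact hX _

theorem IsClosedUnitSubgroup.exp_mem (hΓ : IsClosedUnitSubgroup Γ) {X : 𝔸} (hX : X ∈ hΓ.lie) :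
    NormedSpace.exp X ∈ Γ := by
  simpa using hX 1

theorem IsClosedUnitSubgroup.eventually_eq_zero_of_exp_mem [FiniteDimensional ℝ 𝔸]
    (hΓ : IsClosedUnitSubgroup Γ) {d : Submodule ℝ 𝔸} (hd : Disjoint d hΓ.lie) :
    ∀ᶠ D : d in 𝓝 0, NormedSpace.exp (D : 𝔸) ∈ Γ → (D : 𝔸) = 0 := by
  by_contra hcon
  rw [Filter.not_eventually] at hcon
  obtain ⟨D, hD0, hD⟩ := Filter.exists_seq_forall_of_frequently hcon
  push Not at hD
  have hne : ∀ i, 0 < ‖D i‖ := fun i => norm_pos_iff.2 fun h => (hD i).2 (by simp [h])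
  obtain ⟨u, hu, φ, hφ, hlim⟩ := (isCompact_sphere (0 : d) 1).tendsto_subseq
    (x := fun i => ‖D i‖⁻¹ • D i) (fun i => by
      rw [mem_sphere_zero_iff_norm, norm_smul, norm_inv, norm_norm, inv_mul_cancel₀ (hne i).ne'])
  have hmem : (u : 𝔸) ∈ hΓ.lie := by
    refine hΓ.exp_smul_mem_of_tendsto (l := atTop) (Z := fun i => (D (φ i) : 𝔸))
      (ε := fun i => ‖D (φ i)‖) (.of_forall fun i => (hD _).1) (.of_forall fun i => hne _) ?_ ?_
    · simpa using (hD0.comp hφ.tendsto_atTop).norm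
    · exact (continuous_subtype_val.tendsto u).comp hlim
  have h0 : (u : 𝔸) = 0 := Submodule.disjoint_def.1 hd _ u.2 hmem
  have : u = 0 := by simpa using h0
  simp [this] at hu

theorem hasStrictFDerivAt_exp_coe_zero (c : Submodule ℝ 𝔸) {E : Type} [NormedAddCommGroup E]
    [NormedSpace ℝ E] (f : E →L[ℝ] c) :
    HasStrictFDerivAt (fun x : E => NormedSpace.exp (f x : 𝔸)) (c.subtypeL.comp f) 0 := by
  have h1 : HasStrictFDerivAt (NormedSpace.exp : 𝔸 → 𝔸) (1 : 𝔸 →L[ℝ] 𝔸)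
      ((c.subtypeL.comp f) 0) := by
    rw [map_zero]; exact hasStrictFDerivAt_exp_zero
  exact h1.comp 0 (c.subtypeL.comp f).hasStrictFDerivAt

theorem IsClosedUnitSubgroup.eventually_eq_exp_mul_exp [FiniteDimensional ℝ 𝔸]
    (hΓ : IsClosedUnitSubgroup Γ) {c h : Submodule ℝ 𝔸} (hch : c ⊔ h = hΓ.lie) {ε : ℝ}
    (hε : 0 < ε) :
    ∀ᶠ g in 𝓝 (1 : 𝔸), g ∈ Γ → ∃ A ∈ c, ∃ B ∈ h, ‖A‖ < ε ∧ ‖B‖ < ε ∧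
      g = NormedSpace.exp A * NormedSpace.exp B := by
  obtain ⟨d, hd⟩ := exists_isCompl hΓ.lie
  let F : c × h × d → 𝔸 := fun x =>
    NormedSpace.exp (x.1 : 𝔸) * NormedSpace.exp (x.2.1 : 𝔸) * NormedSpace.exp (x.2.2 : 𝔸)
  let F' : c × h × d →L[ℝ] 𝔸 := c.subtypeL.comp (.fst ℝ _ _) +
    h.subtypeL.comp ((ContinuousLinearMap.fst ℝ _ _).comp (.snd ℝ _ _)) +
    d.subtypeL.comp ((ContinuousLinearMap.snd ℝ _ _).comp (.snd ℝ _ _))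
  have hF : HasStrictFDerivAt F F' 0 := by
    have := ((hasStrictFDerivAt_exp_coe_zero c (.fst ℝ c (h × d))).mul'
      (hasStrictFDerivAt_exp_coe_zero h
        ((ContinuousLinearMap.fst ℝ h d).comp (.snd ℝ c (h × d))))).mul'
      (hasStrictFDerivAt_exp_coe_zero d
        ((ContinuousLinearMap.snd ℝ h d).comp (.snd ℝ c (h × d))))
    refine this.congr_fderiv ?_
    ext x <;> simp [F']
  have hsurj : F'.range = ⊤ := by
    rw [eq_top_iff]
    intro x _
    have hx : x ∈ (c ⊔ h) ⊔ d := by rw [hch, hd.sup_eq_top]; trivial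
    obtain ⟨y, hy, D, hD, rfl⟩ := Submodule.mem_sup.1 hx
    obtain ⟨A, hA, B, hB, rfl⟩ := Submodule.mem_sup.1 hy
    exact ⟨(⟨A, hA⟩, ⟨B, hB⟩, ⟨D, hD⟩), by simp [F']⟩
  have hmap := hF.map_nhds_eq_of_surj hsurj
  have hF0 : F 0 = 1 := by simp [F]
  rw [hF0] at hmap
  rw [← hmap, Filter.eventually_map]
  have e1 : ∀ᶠ x : c × h × d in 𝓝 0, NormedSpace.exp (x.2.2 : 𝔸) ∈ Γ → (x.2.2 : 𝔸) = 0 := by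
    have : Tendsto (fun x : c × h × d => x.2.2) (𝓝 0) (𝓝 0) :=
      (continuous_snd.comp continuous_snd).tendsto' _ _ rfl
    exact this.eventually (hΓ.eventually_eq_zero_of_exp_mem hd.disjoint.symm)
  filter_upwards [e1, Metric.ball_mem_nhds (0 : c × h × d) hε] with x hx hxε hxΓ
  rw [mem_ball_zero_iff] at hxε
  have n1 := (norm_fst_le x).trans_lt hxε
  have n2 := ((norm_fst_le x.2).trans (norm_snd_le x)).trans_lt hxε
  have m1 : NormedSpace.exp (x.1 : 𝔸) ∈ Γ := hΓ.exp_mem (hch ▸ Submodule.mem_sup_left x.1.2)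
  have m2 : NormedSpace.exp (x.2.1 : 𝔸) ∈ Γ := hΓ.exp_mem (hch ▸ Submodule.mem_sup_right x.2.1.2)
  have m3 : NormedSpace.exp (x.2.2 : 𝔸) ∈ Γ := by
    have := hΓ.mul_mem _ (hΓ.exp_neg_mem m2) _ (hΓ.mul_mem _ (hΓ.exp_neg_mem m1) _ hxΓ)
    have e : NormedSpace.exp (-(x.2.1 : 𝔸)) * (NormedSpace.exp (-(x.1 : 𝔸)) * F x) =
        NormedSpace.exp (x.2.2 : 𝔸) := by
      simp only [F]
      rw [mul_assoc (NormedSpace.exp (x.1 : 𝔸)), ← mul_assoc (NormedSpace.exp (-(x.1 : 𝔸))),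
        nexp_neg_mul, one_mul, ← mul_assoc, nexp_neg_mul, one_mul]
    rwa [e] at this
  refine ⟨x.1, x.1.2, x.2.1, x.2.1.2, n1, n2, ?_⟩
  simp [F, hx m3]

end ExpSubgroup

section MatrixLie

open Filter Topology
open scoped Matrix.Norms.Operator

theorem mexp_eq_exp {n : ℕ} (A : Matrix (Fin n) (Fin n) ℂ) : mexp ℂ n A = NormedSpace.exp A := by
  rw [NormedSpace.exp_eq_tsum ℂ]
  rfl

theorem IsMatSubgroup.isClosedUnitSubgroup {n : ℕ} {G : Set (Matrix (Fin n) (Fin n) ℂ)}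
    (hG : IsMatSubgroup ℂ n G) (hcl : ∀ a ∈ closure G, IsUnit a → a ∈ G) :
    IsClosedUnitSubgroup G where
  one_mem := hG.1
  mul_mem := hG.2.1
  exists_inv a ha := by
    obtain ⟨hu, hi⟩ := hG.2.2 a ha
    have hd := (Matrix.isUnit_iff_isUnit_det a).1 hu
    exact ⟨a⁻¹, hi, a.mul_nonsing_inv hd, a.nonsing_inv_mul hd⟩
  mem_of_mem_closure := hcl

theorem isClosedUnitSubgroup_of_isZClosedInGL {n : ℕ} {G : Set (Matrix (Fin n) (Fin n) ℂ)}
    (hG : IsMatSubgroup ℂ n G) (hz : IsZClosedInGL ℂ n G) : IsClosedUnitSubgroup G := by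
  refine hG.isClosedUnitSubgroup fun a ha hu => ?_
  obtain ⟨P, rfl⟩ := hz
  refine ⟨hu, fun p hp => ?_⟩
  have hc : IsClosed {g : Matrix (Fin n) (Fin n) ℂ | eval (fun ij => g ij.1 ij.2) p = 0} := by
    refine isClosed_eq ?_ continuous_const
    refine (MvPolynomial.continuous_eval p).comp ?_
    exact continuous_pi fun ij => (continuous_id.matrix_elem ij.1 ij.2)
  exact (closure_minimal (fun g hg => hg.2 p hp) hc ha :)

theorem analyticOnNhd_exp_smul_entry {n : ℕ} (A : Matrix (Fin n) (Fin n) ℂ) (i j : Fin n) :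
    AnalyticOnNhd ℂ (fun t : ℂ => NormedSpace.exp (t • A) i j) Set.univ := by
  refine DifferentiableOn.analyticOnNhd (fun t _ => ?_) isOpen_univ
  have h := (hasDerivAt_exp_smul_const (𝕂 := ℂ) A t).differentiableAt
  have e : (fun t : ℂ => NormedSpace.exp (t • A) i j) =
      (Matrix.entryLinearMap ℂ ℂ i j).toContinuousLinearMap ∘ fun t : ℂ => NormedSpace.exp (t • A) := rfl
  rw [e]
  exact ((ContinuousLinearMap.differentiableAt _).comp t h).differentiableWithinAt

theorem exp_smul_mem_of_real {n : ℕ} {G : Set (Matrix (Fin n) (Fin n) ℂ)}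
    (hz : IsZClosedInGL ℂ n G) {A : Matrix (Fin n) (Fin n) ℂ}
    (hA : ∀ t : ℝ, NormedSpace.exp (t • A) ∈ G) (t : ℂ) : NormedSpace.exp (t • A) ∈ G := by
  obtain ⟨P, rfl⟩ := hz
  refine ⟨isUnit_nexp _, fun p hp => ?_⟩
  have han : AnalyticOnNhd ℂ
      (fun t : ℂ => eval (fun ij : Fin n × Fin n => NormedSpace.exp (t • A) ij.1 ij.2) p)
      Set.univ := by
    have := AnalyticOnNhd.aeval_mvPolynomial
      (f := fun (t : ℂ) (ij : Fin n × Fin n) => NormedSpace.exp (t • A) ij.1 ij.2) (s := Set.univ)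
      (fun ij => analyticOnNhd_exp_smul_entry A ij.1 ij.2) p
    simpa [aeval_eq_eval] using this
  have hfreq : ∃ᶠ z : ℂ in 𝓝[≠] 0,
      eval (fun ij : Fin n × Fin n => NormedSpace.exp (z • A) ij.1 ij.2) p = 0 := by
    have h1 : Tendsto (fun t : ℝ => (t : ℂ)) (𝓝[≠] 0) (𝓝[≠] 0) := by
      refine tendsto_nhdsWithin_iff.2 ⟨?_, ?_⟩
      · exact (Complex.continuous_ofReal.tendsto' 0 0 rfl).mono_left nhdsWithin_le_nhds
      · filter_upwards [self_mem_nhdsWithin] with t ht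
        simpa using ht
    refine h1.frequently (Eventually.of_forall fun t => ?_).frequently
    have := (hA t).2 p hp
    rwa [← Complex.coe_smul] at this
  exact han.eqOn_zero_of_preconnected_of_frequently_eq_zero isPreconnected_univ
    (Set.mem_univ 0) hfreq (Set.mem_univ t)

theorem mem_lieAlgebra_iff {n : ℕ} {G : Set (Matrix (Fin n) (Fin n) ℂ)}
    (hz : IsZClosedInGL ℂ n G) {A : Matrix (Fin n) (Fin n) ℂ} :
    A ∈ lieAlgebra ℂ n G ↔ A ∈ lieSet G := by
  refine ⟨fun h t => ?_, fun h t => ?_⟩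
  · have := h (t : ℂ)
    rwa [mexp_eq_exp, Complex.coe_smul] at this
  · rw [mexp_eq_exp]
    exact exp_smul_mem_of_real hz h t

/-- The Lie algebra of a Zariski closed group of complex matrices, as a complex subspace. -/
def complexLie {n : ℕ} {G : Set (Matrix (Fin n) (Fin n) ℂ)} (hG : IsMatSubgroup ℂ n G)
    (hz : IsZClosedInGL ℂ n G) : Submodule ℂ (Matrix (Fin n) (Fin n) ℂ) where
  carrier := lieAlgebra ℂ n G
  add_mem' ha hb := by
    rw [mem_lieAlgebra_iff hz] at *
    exact (isClosedUnitSubgroup_of_isZClosedInGL hG hz).add_mem_lieSet ha hb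
  zero_mem' := by
    rw [mem_lieAlgebra_iff hz]
    exact (isClosedUnitSubgroup_of_isZClosedInGL hG hz).lie.zero_mem
  smul_mem' c A hA t := by
    rw [smul_smul]; exact hA _

theorem exp_mem_of_mem_complexLie {n : ℕ} {G : Set (Matrix (Fin n) (Fin n) ℂ)}
    (hG : IsMatSubgroup ℂ n G) (hz : IsZClosedInGL ℂ n G) {A : Matrix (Fin n) (Fin n) ℂ}
    (hA : A ∈ complexLie hG hz) : NormedSpace.exp A ∈ G := by
  have := hA 1
  rwa [mexp_eq_exp, one_smul] at this

theorem restrictScalars_complexLie {n : ℕ} {G : Set (Matrix (Fin n) (Fin n) ℂ)}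
    (hG : IsMatSubgroup ℂ n G) (hz : IsZClosedInGL ℂ n G) :
    (complexLie hG hz).restrictScalars ℝ = (isClosedUnitSubgroup_of_isZClosedInGL hG hz).lie :=
  SetLike.ext fun _ => mem_lieAlgebra_iff hz

end MatrixLie

section OrbitTangent

open Filter Topology
open scoped Matrix.Norms.Operator

/-- Matrix-vector multiplication as a continuous bilinear map. -/
def mulVecL (n : ℕ) : Matrix (Fin n) (Fin n) ℂ →L[ℂ] (Fin n → ℂ) →L[ℂ] (Fin n → ℂ) :=
  LinearMap.toContinuousLinearMap
    ((LinearMap.toContinuousLinearMap (𝕜 := ℂ) (E := Fin n → ℂ) (F' := Fin n → ℂ)).toLinearMap ∘ₗ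
      (Matrix.toLin' (R := ℂ) (m := Fin n) (n := Fin n)).toLinearMap)

@[simp] theorem mulVecL_apply {n : ℕ} (A : Matrix (Fin n) (Fin n) ℂ) (v : Fin n → ℂ) :
    mulVecL n A v = A.mulVec v := rfl

/-- Evaluation of matrices at a vector. -/
def evalVecL {n : ℕ} (v : Fin n → ℂ) : Matrix (Fin n) (Fin n) ℂ →L[ℂ] (Fin n → ℂ) :=
  (mulVecL n).flip v

@[simp] theorem evalVecL_apply {n : ℕ} (A : Matrix (Fin n) (Fin n) ℂ) (v : Fin n → ℂ) :
    evalVecL v A = A.mulVec v := rfl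

theorem exp_mulVec_of_mulVec_eq_zero {n : ℕ} {A : Matrix (Fin n) (Fin n) ℂ} {v : Fin n → ℂ}
    (h : A.mulVec v = 0) : (NormedSpace.exp A).mulVec v = v := by
  have hs := NormedSpace.exp_series_hasSum_exp' (𝕂 := ℂ) A
  have h1 := (evalVecL v).hasSum hs
  have h2 : HasSum (fun k : ℕ => (evalVecL v) ((k.factorial : ℂ)⁻¹ • A ^ k)) v := by
    have := hasSum_single (f := fun k : ℕ => (evalVecL v) ((k.factorial : ℂ)⁻¹ • A ^ k)) 0
      (fun k hk => by
        obtain ⟨j, rfl⟩ := Nat.exists_eq_succ_of_ne_zero hk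
        simp [pow_succ, ← Matrix.mulVec_mulVec, h])
    simpa using this
  exact h1.unique h2

/-- The infinitesimal orbit map of a Zariski closed group. -/
def infOrbit {n : ℕ} {G : Set (Matrix (Fin n) (Fin n) ℂ)} (hG : IsMatSubgroup ℂ n G)
    (hz : IsZClosedInGL ℂ n G) (v : Fin n → ℂ) : complexLie hG hz →ₗ[ℂ] (Fin n → ℂ) :=
  (evalVecL v).toLinearMap ∘ₗ (complexLie hG hz).subtype

@[simp] theorem infOrbit_apply {n : ℕ} {G : Set (Matrix (Fin n) (Fin n) ℂ)}
    (hG : IsMatSubgroup ℂ n G) (hz : IsZClosedInGL ℂ n G) (v : Fin n → ℂ) (A : complexLie hG hz) :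
    infOrbit hG hz v A = (A : Matrix (Fin n) (Fin n) ℂ).mulVec v := rfl

theorem orbitTangent_eq_range {n : ℕ} {G : Set (Matrix (Fin n) (Fin n) ℂ)}
    (hG : IsMatSubgroup ℂ n G) (hz : IsZClosedInGL ℂ n G) (v : Fin n → ℂ) :
    orbitTangent ℂ n G v = (infOrbit hG hz v).range := by
  refine le_antisymm (Submodule.span_le.2 ?_) ?_
  · rintro _ ⟨A, hA, rfl⟩
    exact ⟨⟨A, hA⟩, rfl⟩
  · rintro _ ⟨A, rfl⟩
    exact Submodule.subset_span ⟨A, A.2, rfl⟩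

theorem finrank_range_le_of_ker_le {E F F' : Type} [AddCommGroup E] [Module ℂ E]
    [FiniteDimensional ℂ E] [AddCommGroup F] [Module ℂ F] [AddCommGroup F'] [Module ℂ F']
    {f : E →ₗ[ℂ] F} {g : E →ₗ[ℂ] F'} (h : f.ker ≤ g.ker) :
    Module.finrank ℂ g.range ≤ Module.finrank ℂ f.range := by
  have h1 := f.finrank_range_add_finrank_ker
  have h2 := g.finrank_range_add_finrank_ker
  have h3 := Submodule.finrank_mono h
  omega

theorem conj_mem_complexLie {n : ℕ} {G : Set (Matrix (Fin n) (Fin n) ℂ)}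
    (hG : IsMatSubgroup ℂ n G) (hz : IsZClosedInGL ℂ n G) {g A : Matrix (Fin n) (Fin n) ℂ}
    (hg : g ∈ G) (hA : A ∈ complexLie hG hz) : g⁻¹ * A * g ∈ complexLie hG hz := by
  intro t
  have h1 := hA t
  rw [mexp_eq_exp] at h1 ⊢
  have h2 : t • (g⁻¹ * A * g) = g⁻¹ * (t • A) * g := by simp
  rw [h2, Matrix.exp_conj' g _ (hG.2.2 g hg).1]
  exact hG.2.1 _ (hG.2.1 _ (hG.2.2 g hg).2 _ h1) _ hg

theorem finrank_orbitTangent_mulVec_le {n : ℕ} {G : Set (Matrix (Fin n) (Fin n) ℂ)}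
    (hG : IsMatSubgroup ℂ n G) (hz : IsZClosedInGL ℂ n G) {g : Matrix (Fin n) (Fin n) ℂ}
    (hg : g ∈ G) (v : Fin n → ℂ) :
    Module.finrank ℂ (orbitTangent ℂ n G (g.mulVec v)) ≤
      Module.finrank ℂ (orbitTangent ℂ n G v) := by
  have hle : orbitTangent ℂ n G (g.mulVec v) ≤
      (orbitTangent ℂ n G v).map (Matrix.toLin' g) := by
    rw [orbitTangent_eq_range hG hz, orbitTangent_eq_range hG hz]
    rintro _ ⟨A, rfl⟩
    refine ⟨_, ⟨⟨_, conj_mem_complexLie hG hz hg A.2⟩, rfl⟩, ?_⟩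
    have hd := (Matrix.isUnit_iff_isUnit_det g).1 (hG.2.2 g hg).1
    simp [Matrix.mulVec_mulVec, ← mul_assoc, Matrix.mul_nonsing_inv g hd]
  exact (Submodule.finrank_mono hle).trans (Submodule.finrank_map_le _ _)

theorem exp_smul_mem_isotropy {n : ℕ} {G : Set (Matrix (Fin n) (Fin n) ℂ)}
    (hG : IsMatSubgroup ℂ n G) (hz : IsZClosedInGL ℂ n G) {A : Matrix (Fin n) (Fin n) ℂ}
    (hA : A ∈ complexLie hG hz) {v : Fin n → ℂ} (hv : A.mulVec v = 0) (t : ℂ) :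
    NormedSpace.exp (t • A) ∈ isotropy ℂ n G v :=
  ⟨exp_mem_of_mem_complexLie hG hz ((complexLie hG hz).smul_mem t hA),
    exp_mulVec_of_mulVec_eq_zero (by rw [Matrix.smul_mulVec, hv, smul_zero])⟩

theorem mulVec_eq_zero_of_hasFiniteImageOn {n : ℕ} {G : Set (Matrix (Fin n) (Fin n) ℂ)}
    (hG : IsMatSubgroup ℂ n G) (hz : IsZClosedInGL ℂ n G) {A : Matrix (Fin n) (Fin n) ℂ}
    (hA : A ∈ complexLie hG hz) {w : Fin n → ℂ} (hw : A.mulVec w = 0)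
    {N : Submodule ℂ (Fin n → ℂ)} (hN : HasFiniteImageOn ℂ n (isotropy ℂ n G w) N)
    {x : Fin n → ℂ} (hx : x ∈ N) : A.mulVec x = 0 := by
  let φ : ℝ → (Fin n → ℂ) := fun t => (NormedSpace.exp (t • A)).mulVec x
  have hfin : (Set.range φ).Finite := by
    refine (hN.image fun f => f ⟨x, hx⟩).subset ?_
    rintro _ ⟨t, rfl⟩
    exact ⟨_, ⟨_, exp_smul_mem_isotropy hG hz hA hw t, rfl⟩, by simp only [Complex.coe_smul]; rfl⟩
  have hd : HasDerivAt φ (A.mulVec x) 0 := by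
    have h1 := hasDerivAt_exp_smul_const (𝕂 := ℝ) A (0 : ℝ)
    have h2 : HasDerivAt φ (evalVecL x (NormedSpace.exp ((0 : ℝ) • A) * A)) 0 :=
      ((evalVecL x).restrictScalars ℝ).hasFDerivAt.comp_hasDerivAt (0 : ℝ) h1
    simpa using h2
  have hcont : Continuous φ := by
    have h1 : Continuous fun t : ℝ => NormedSpace.exp (t • A) :=
      continuous_nexp.comp (continuous_id.smul continuous_const)
    exact (evalVecL x).continuous.comp h1
  have hconst : ∀ t, φ t = φ 0 := fun t =>
    (isPreconnected_range hcont).isDiscrete_iff_subsingleton.1 hfin.isDiscrete ⟨t, rfl⟩ ⟨0, rfl⟩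
  have h3 : HasDerivAt φ 0 0 := by
    rw [show φ = fun _ => φ 0 from funext hconst]
    exact hasDerivAt_const _ _
  exact hd.unique h3

end OrbitTangent

section AlmostPrincipalRank

open Filter Topology
open scoped Matrix.Norms.Operator

theorem hasStrictFDerivAt_exp_mulVec {n : ℕ} (c : Submodule ℂ (Matrix (Fin n) (Fin n) ℂ))
    (w : Fin n → ℂ) :
    HasStrictFDerivAt (fun A : c => (NormedSpace.exp (A : Matrix (Fin n) (Fin n) ℂ)).mulVec w)
      ((evalVecL w).comp c.subtypeL) 0 := by
  have h1 : HasStrictFDerivAt (NormedSpace.exp : Matrix (Fin n) (Fin n) ℂ → _)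
      (1 : Matrix (Fin n) (Fin n) ℂ →L[ℂ] Matrix (Fin n) (Fin n) ℂ) (c.subtypeL 0) := by
    rw [map_zero]; exact hasStrictFDerivAt_exp_zero
  exact (evalVecL w).hasStrictFDerivAt.comp 0 (h1.comp 0 c.subtypeL.hasStrictFDerivAt)

theorem eventually_eq_exp_mulVec_add {n : ℕ} {G : Set (Matrix (Fin n) (Fin n) ℂ)}
    (hG : IsMatSubgroup ℂ n G) (hz : IsZClosedInGL ℂ n G) {w : Fin n → ℂ}
    {N : Submodule ℂ (Fin n → ℂ)} (hN : orbitTangent ℂ n G w ⊔ N = ⊤) :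
    ∀ᶠ v in 𝓝 w, ∃ A ∈ complexLie hG hz, ∃ x ∈ N,
      v = (NormedSpace.exp A).mulVec (w + x) := by
  let c := complexLie hG hz
  let F : c × N → (Fin n → ℂ) := fun y =>
    (NormedSpace.exp (y.1 : Matrix (Fin n) (Fin n) ℂ)).mulVec (w + y.2)
  let F' : c × N →L[ℂ] (Fin n → ℂ) :=
    ((evalVecL w).comp c.subtypeL).comp (.fst ℂ c N) + N.subtypeL.comp (.snd ℂ c N)
  have hF : HasStrictFDerivAt F F' 0 := by
    have h1 : HasStrictFDerivAt (NormedSpace.exp : Matrix (Fin n) (Fin n) ℂ → _)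
        (1 : Matrix (Fin n) (Fin n) ℂ →L[ℂ] Matrix (Fin n) (Fin n) ℂ)
        ((c.subtypeL.comp (.fst ℂ c N)) 0) := by
      rw [map_zero]; exact hasStrictFDerivAt_exp_zero
    have h2 := (mulVecL n).hasStrictFDerivAt.comp 0
      (h1.comp 0 (c.subtypeL.comp (.fst ℂ c N)).hasStrictFDerivAt)
    have h3 := (N.subtypeL.comp (.snd ℂ c N)).hasStrictFDerivAt.const_add w (x := 0)
    have h4 := h2.clm_apply h3
    refine h4.congr_fderiv ?_
    refine ContinuousLinearMap.ext fun y => ?_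
    change (NormedSpace.exp ((0 : c) : Matrix (Fin n) (Fin n) ℂ)).mulVec (y.2 : Fin n → ℂ) +
      (y.1 : Matrix (Fin n) (Fin n) ℂ).mulVec (w + ((0 : N) : Fin n → ℂ)) =
      (y.1 : Matrix (Fin n) (Fin n) ℂ).mulVec w + y.2
    simp [add_comm]
  have hsurj : F'.range = ⊤ := by
    rw [eq_top_iff]
    intro x _
    obtain ⟨y, hy, z, hz', rfl⟩ := Submodule.mem_sup.1 (hN ▸ Submodule.mem_top : x ∈ _ ⊔ N)
    rw [orbitTangent_eq_range hG hz] at hy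
    obtain ⟨A, rfl⟩ := hy
    exact ⟨(A, ⟨z, hz'⟩), by simp [F']⟩
  have hmap := hF.map_nhds_eq_of_surj hsurj
  have hF0 : F 0 = w := by simp [F]
  rw [hF0] at hmap
  rw [← hmap, Filter.eventually_map]
  exact .of_forall fun y => ⟨y.1, y.1.2, y.2, y.2.2, rfl⟩

theorem eventually_finrank_orbitTangent_le {n : ℕ} {G : Set (Matrix (Fin n) (Fin n) ℂ)}
    (hG : IsMatSubgroup ℂ n G) (hz : IsZClosedInGL ℂ n G) {w : Fin n → ℂ}
    (hw : IsAlmostPrincipalPt ℂ n G w) :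
    ∀ᶠ v in 𝓝 w, Module.finrank ℂ (orbitTangent ℂ n G v) ≤
      Module.finrank ℂ (orbitTangent ℂ n G w) := by
  obtain ⟨-, N, ⟨hN, -⟩, hfin⟩ := hw
  filter_upwards [eventually_eq_exp_mulVec_add hG hz hN.sup_eq_top] with v hv
  obtain ⟨A, hA, x, hx, rfl⟩ := hv
  refine (finrank_orbitTangent_mulVec_le hG hz (exp_mem_of_mem_complexLie hG hz hA) _).trans ?_
  rw [orbitTangent_eq_range hG hz, orbitTangent_eq_range hG hz]
  refine finrank_range_le_of_ker_le fun B hB => ?_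
  have hB0 : (B : Matrix (Fin n) (Fin n) ℂ).mulVec w = 0 := hB
  have := mulVec_eq_zero_of_hasFiniteImageOn hG hz B.2 hB0 hfin hx
  simp [Matrix.mulVec_add, this, hB0]

/-- A lower bound for the rank of a family of linear maps which holds at one point of a line holds
at points of the line arbitrarily close to any other. -/
theorem frequently_le_finrank_range {E V : Type} [AddCommGroup E] [Module ℂ E]
    [FiniteDimensional ℂ E] [AddCommGroup V] [Module ℂ V] [FiniteDimensional ℂ V]
    (f g : E →ₗ[ℂ] V) :
    ∃ᶠ t : ℂ in 𝓝 0, Module.finrank ℂ (f + g).range ≤ Module.finrank ℂ (f + t • g).range := by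
  obtain ⟨m, hm⟩ : ∃ m, m = Module.finrank ℂ (f + g).range := ⟨_, rfl⟩
  let e : (f + g).range ≃ₗ[ℂ] (Fin m → ℂ) := LinearEquiv.ofFinrankEq _ _ (by simp [hm])
  obtain ⟨y, hy⟩ := LinearMap.exists_extend e.toLinearMap
  choose a ha using fun i : Fin m => (e.symm (Pi.single i 1)).2
  let M0 : Matrix (Fin m) (Fin m) ℂ := .of fun i => y (f (a i))
  let M1 : Matrix (Fin m) (Fin m) ℂ := .of fun i => y (g (a i))
  let p : Polynomial ℂ := (M0.map Polynomial.C + (Polynomial.X : Polynomial ℂ) •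
    M1.map Polynomial.C).det
  have hp : ∀ t, p.eval t = (M0 + t • M1).det := fun t => by
    have := (Polynomial.evalRingHom t).map_det (M0.map Polynomial.C +
      (Polynomial.X : Polynomial ℂ) • M1.map Polynomial.C)
    rw [Polynomial.coe_evalRingHom] at this
    rw [this]
    congr 1
    ext i j
    simp
    ring
  have hM1 : M0 + (1 : ℂ) • M1 = 1 := by
    ext i j
    have h1 : y ((f + g) (a i)) = Pi.single i 1 := by
      rw [ha i]
      have := LinearMap.congr_fun hy (e.symm (Pi.single i 1))
      simpa using this
    have h2 := congrFun h1 j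
    simp only [LinearMap.add_apply, map_add, Pi.add_apply] at h2
    rw [one_smul, Matrix.add_apply, Matrix.one_eq_pi_single]
    exact h2
  have hp0 : p ≠ 0 := fun h => by
    have := hp 1
    rw [hM1, h] at this
    simp at this
  have hfreq : ∃ᶠ t : ℂ in 𝓝 0, ¬ p.IsRoot t := by
    have : ∀ᶠ t : ℂ in 𝓝[≠] 0, ¬ p.IsRoot t := by
      have hfin : (p.rootSet ℂ).Finite := p.rootSet_finite ℂ
      have h1 := (hfin.subset (Set.sdiff_subset (t := {0}))).isClosed.isOpen_compl.mem_nhds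
        (x := 0) (by simp)
      filter_upwards [nhdsWithin_le_nhds h1, self_mem_nhdsWithin] with t ht ht0 hr
      exact ht ⟨Polynomial.mem_rootSet.2 ⟨hp0, by simpa using hr⟩, ht0⟩
    exact this.frequently.filter_mono nhdsWithin_le_nhds
  refine hfreq.mono fun t ht => ?_
  have hdet : IsUnit (M0 + t • M1) := by
    rw [Matrix.isUnit_iff_isUnit_det, ← hp, isUnit_iff_ne_zero]
    exact ht
  have hli := Matrix.linearIndependent_rows_iff_isUnit.2 hdet
  have hli2 : LinearIndependent ℂ (fun i => (f + t • g) (a i)) := by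
    refine LinearIndependent.of_comp y ?_
    have e : (y ∘ fun i => (f + t • g) (a i)) = (M0 + t • M1).row := by
      ext i j
      simp [M0, M1, Matrix.row]
    rw [e]
    exact hli
  have hli3 : LinearIndependent ℂ (fun i => (f + t • g).rangeRestrict (a i)) :=
    LinearIndependent.of_comp (Submodule.subtype _) hli2
  simpa [hm] using hli3.fintype_card_le_finrank

theorem finrank_orbitTangent_le_of_isAlmostPrincipalPt {n : ℕ}
    {G : Set (Matrix (Fin n) (Fin n) ℂ)} (hG : IsMatSubgroup ℂ n G) (hz : IsZClosedInGL ℂ n G)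
    {w : Fin n → ℂ} (hw : IsAlmostPrincipalPt ℂ n G w) (u : Fin n → ℂ) :
    Module.finrank ℂ (orbitTangent ℂ n G u) ≤ Module.finrank ℂ (orbitTangent ℂ n G w) := by
  have h1 := frequently_le_finrank_range (infOrbit hG hz w) (infOrbit hG hz (u - w))
  have hadd : ∀ t : ℂ, infOrbit hG hz w + t • infOrbit hG hz (u - w) =
      infOrbit hG hz (w + t • (u - w)) := fun t => by
    ext A i
    simp [Matrix.mulVec_add, Matrix.mulVec_smul]
  have hone : infOrbit hG hz w + infOrbit hG hz (u - w) = infOrbit hG hz u := by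
    have := hadd 1
    rwa [one_smul, one_smul, add_sub_cancel] at this
  have hev : ∀ᶠ t : ℂ in 𝓝 0, Module.finrank ℂ (orbitTangent ℂ n G (w + t • (u - w))) ≤
      Module.finrank ℂ (orbitTangent ℂ n G w) := by
    have hc : Tendsto (fun t : ℂ => w + t • (u - w)) (𝓝 0) (𝓝 w) :=
      (by fun_prop : Continuous fun t : ℂ => w + t • (u - w)).tendsto' _ _ (by simp)
    exact hc.eventually (eventually_finrank_orbitTangent_le hG hz hw)
  obtain ⟨t, ht, ht'⟩ := (h1.and_eventually hev).exists
  rw [hone, hadd, ← orbitTangent_eq_range, ← orbitTangent_eq_range] at ht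
  exact ht.trans ht'

end AlmostPrincipalRank

section OrbitDimension

open Filter Topology
open scoped Matrix.Norms.Operator ENNReal

theorem eq_zero_of_eventually_eval_eq_zero {σ : Type} [Finite σ] {p : MvPolynomial σ ℂ}
    {z : σ → ℂ} (h : ∀ᶠ x in 𝓝 z, eval x p = 0) : p = 0 := by
  have := Fintype.ofFinite σ
  obtain ⟨ε, hε, hb⟩ := Metric.eventually_nhds_iff_ball.1 h
  refine MvPolynomial.funext_set (fun i => Metric.ball (z i) ε) (fun i => ?_) fun x hx => ?_
  · exact infinite_of_mem_nhds (z i) (Metric.ball_mem_nhds _ hε)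
  · rw [map_zero]
    refine hb x ?_
    rw [← ball_pi z hε] at hx
    exact hx

theorem exists_eval_eq_linearMap {n : ℕ} (f : (Fin n → ℂ) →ₗ[ℂ] ℂ) :
    ∃ q : MvPolynomial (Fin n) ℂ, ∀ v, eval v q = f v := by
  refine ⟨∑ j, C (f (Pi.single j 1)) * X j, fun v => ?_⟩
  conv_rhs => rw [pi_eq_sum_univ' v, map_sum]
  simp [mul_comm]

theorem contDiff_eval_exp_mulVec {n : ℕ} (c : Submodule ℂ (Matrix (Fin n) (Fin n) ℂ))
    (g : Matrix (Fin n) (Fin n) ℂ) (u : Fin n → ℂ) {σ : Type} [Fintype σ]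
    (q : σ → MvPolynomial (Fin n) ℂ) :
    ContDiff ℂ 1 fun (A : c) (i : σ) =>
      eval (g.mulVec ((NormedSpace.exp (A : Matrix (Fin n) (Fin n) ℂ)).mulVec u)) (q i) := by
  refine contDiff_pi.2 fun i => AnalyticOnNhd.contDiff ?_
  have h1 : AnalyticOnNhd ℂ (fun A : c => NormedSpace.exp (A : Matrix (Fin n) (Fin n) ℂ))
      Set.univ := fun A _ =>
    (NormedSpace.exp_analytic (𝕂 := ℂ) (A : Matrix (Fin n) (Fin n) ℂ)).comp
      (c.subtypeL.analyticAt A)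
  have h2 : ∀ j, AnalyticOnNhd ℂ (fun A : c =>
      g.mulVec ((NormedSpace.exp (A : Matrix (Fin n) (Fin n) ℂ)).mulVec u) j) Set.univ :=
    fun j A _ => (((ContinuousLinearMap.proj j).comp
      ((mulVecL n g).comp (evalVecL u))).analyticAt _).comp (h1 A trivial)
  have h3 := AnalyticOnNhd.aeval_mvPolynomial (f := fun (A : c) j =>
      g.mulVec ((NormedSpace.exp (A : Matrix (Fin n) (Fin n) ℂ)).mulVec u) j) h2 (q i)
  simpa [aeval_eq_eval] using h3

theorem exists_complement_isotropyLie {n : ℕ} {G : Set (Matrix (Fin n) (Fin n) ℂ)}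
    (hG : IsMatSubgroup ℂ n G) (hz : IsZClosedInGL ℂ n G) (u : Fin n → ℂ) :
    ∃ c h : Submodule ℂ (Matrix (Fin n) (Fin n) ℂ), c ⊔ h = complexLie hG hz ∧
      Module.finrank ℂ c = Module.finrank ℂ (orbitTangent ℂ n G u) ∧ ∀ B ∈ h, B.mulVec u = 0 := by
  obtain ⟨c, hc⟩ := exists_isCompl (infOrbit hG hz u).ker
  refine ⟨c.map (Submodule.subtype _), (infOrbit hG hz u).ker.map (Submodule.subtype _), ?_, ?_, ?_⟩
  · rw [← Submodule.map_sup, hc.symm.sup_eq_top, Submodule.map_top, Submodule.range_subtype]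
  · rw [Submodule.finrank_map_subtype_eq]
    have h1 := Submodule.finrank_add_eq_of_isCompl hc
    have h2 := (infOrbit hG hz u).finrank_range_add_finrank_ker
    rw [orbitTangent_eq_range hG hz]
    omega
  · rintro _ ⟨B, hB, rfl⟩
    exact hB

theorem card_le_finrank_orbitTangent {n : ℕ} {G : Set (Matrix (Fin n) (Fin n) ℂ)}
    (hG : IsMatSubgroup ℂ n G) (hz : IsZClosedInGL ℂ n G) (u : Fin n → ℂ)
    {p : Ideal (MvPolynomial (Fin n) ℂ)}
    (hp : p ∈ (vanishingIdeal ℂ n (orbit ℂ n G u)).minimalPrimes) {σ : Type} [Fintype σ]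
    (β : MvPolynomial σ ℂ →ₐ[ℂ] MvPolynomial (Fin n) ℂ) (hβ : p.comap β = ⊥) :
    Fintype.card σ ≤ Module.finrank ℂ (orbitTangent ℂ n G u) := by
  obtain ⟨h, hh, himg⟩ := exists_dense_open_subset_orbit hz u p hp β
  rw [hβ, Ideal.mem_bot] at hh
  obtain ⟨z, hzh⟩ : ∃ z, eval z h ≠ 0 := by
    by_contra! hcon
    exact hh (MvPolynomial.funext fun x => by simpa using hcon x)
  obtain ⟨c, k, hck, hc, hk⟩ := exists_complement_isotropyLie hG hz u
  have hΓ := isClosedUnitSubgroup_of_isZClosedInGL hG hz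
  have hck' : c.restrictScalars ℝ ⊔ k.restrictScalars ℝ = hΓ.lie := by
    rw [← Submodule.restrictScalars_sup, hck, restrictScalars_complexLie]
  let f : Matrix (Fin n) (Fin n) ℂ → c → σ → ℂ := fun g A i =>
    eval (g.mulVec ((NormedSpace.exp (A : Matrix (Fin n) (Fin n) ℂ)).mulVec u)) (β (X i))
  have : SecondCountableTopology (Matrix (Fin n) (Fin n) ℂ) :=
    inferInstanceAs (SecondCountableTopology (Fin n → Fin n → ℂ))
  obtain ⟨t, -, ht, hcov⟩ := TopologicalSpace.countable_cover_nhdsWithin (s := G)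
    (f := fun g => {a | ∃ A : c, a.mulVec u =
      g.mulVec ((NormedSpace.exp (A : Matrix (Fin n) (Fin n) ℂ)).mulVec u)}) (by
    intro g hg
    have hd := (Matrix.isUnit_iff_isUnit_det g).1 (hG.2.2 g hg).1
    have hcont : Tendsto (fun a : Matrix (Fin n) (Fin n) ℂ => g⁻¹ * a) (𝓝[G] g) (𝓝 1) := by
      have h1 : Continuous fun a : Matrix (Fin n) (Fin n) ℂ => g⁻¹ * a := by fun_prop
      exact (h1.tendsto' _ _ (Matrix.nonsing_inv_mul g hd)).mono_left nhdsWithin_le_nhds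
    filter_upwards [hcont.eventually (hΓ.eventually_eq_exp_mul_exp hck' one_pos),
      self_mem_nhdsWithin] with a ha haG
    obtain ⟨A, hA, B, hB, -, -, hAB⟩ := ha (hG.2.1 _ (hG.2.2 g hg).2 _ haG)
    rw [Submodule.restrictScalars_mem] at hA hB
    refine ⟨⟨A, hA⟩, ?_⟩
    have hBu := exp_mulVec_of_mulVec_eq_zero (hk B hB)
    calc a.mulVec u = (g * (g⁻¹ * a)).mulVec u := by
          rw [← mul_assoc, Matrix.mul_nonsing_inv g hd, one_mul]
      _ = g.mulVec ((NormedSpace.exp A).mulVec ((NormedSpace.exp B).mulVec u)) := by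
          rw [hAB, ← Matrix.mulVec_mulVec, ← Matrix.mulVec_mulVec]
          rfl
      _ = _ := congrArg (fun x => g.mulVec ((NormedSpace.exp A).mulVec x)) hBu)
  have hsub : {x : σ → ℂ | eval x h ≠ 0} ⊆ ⋃ g ∈ t, Set.range (f g) := by
    intro x hx
    obtain ⟨y, ⟨a, ha, rfl⟩, hy⟩ := himg x (by simp [hβ]) hx
    obtain ⟨g, hg, A, hA⟩ := Set.mem_iUnion₂.1 (hcov ha)
    refine Set.mem_iUnion₂.2 ⟨g, hg, A, funext fun i => ?_⟩
    have := hy (X i)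
    simp only [eval_X] at this
    rw [this, hA]
  have hopen : {x : σ → ℂ | eval x h ≠ 0} ∈ 𝓝 z :=
    (MvPolynomial.continuous_eval h).continuousAt.eventually_ne hzh
  have hle : dimH {x : σ → ℂ | eval x h ≠ 0} ≤ (Module.finrank ℝ c : ℝ≥0∞) := by
    refine (dimH_mono hsub).trans ?_
    rw [dimH_bUnion ht]
    refine iSup₂_le fun g _ => ?_
    exact ((contDiff_eval_exp_mulVec c g u fun i => β (X i)).restrict_scalars ℝ).dimH_range_le
  rw [Real.dimH_of_mem_nhds hopen, Nat.cast_le, finrank_real_of_complex, finrank_real_of_complex,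
    Module.finrank_fintype_fun_eq_card, hc] at hle
  omega

theorem exists_coordinates_orbit {n : ℕ} {G : Set (Matrix (Fin n) (Fin n) ℂ)}
    (hG : IsMatSubgroup ℂ n G) (hz : IsZClosedInGL ℂ n G) (w : Fin n → ℂ) :
    ∃ β : MvPolynomial (Fin (Module.finrank ℂ (orbitTangent ℂ n G w))) ℂ →ₐ[ℂ]
      MvPolynomial (Fin n) ℂ, (vanishingIdeal ℂ n (orbit ℂ n G w)).comap β = ⊥ := by
  let e : orbitTangent ℂ n G w ≃ₗ[ℂ] (Fin (Module.finrank ℂ (orbitTangent ℂ n G w)) → ℂ) :=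
    LinearEquiv.ofFinrankEq _ _ (by simp)
  obtain ⟨y, hy⟩ := LinearMap.exists_extend e.toLinearMap
  choose q hq using fun i => exists_eval_eq_linearMap ((LinearMap.proj i).comp y)
  have hev : ∀ v p, eval v (aeval q p) = eval (y v) p := fun v p => by
    have h1 : (fun i => eval v (q i)) = y v := funext fun i => hq i v
    rw [← h1]
    induction p using MvPolynomial.induction_on with
    | C a => simp
    | add p q hp hq => simp only [map_add, hp, hq]
    | mul_X p i hp => simp only [map_mul, hp, aeval_X, eval_X]
  refine ⟨aeval q, (Submodule.eq_bot_iff _).2 fun p hp => ?_⟩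
  have hF := (LinearMap.toContinuousLinearMap y).hasStrictFDerivAt.comp 0
    (hasStrictFDerivAt_exp_mulVec (complexLie hG hz) w)
  have hmap := hF.map_nhds_eq_of_surj (by
    rw [eq_top_iff]
    intro x _
    obtain ⟨A, hA⟩ := (orbitTangent_eq_range hG hz w).le (e.symm x).2
    refine ⟨A, ?_⟩
    have h1 := LinearMap.congr_fun hy (e.symm x)
    simp only [LinearMap.comp_apply, Submodule.subtype_apply, LinearEquiv.coe_coe,
      LinearEquiv.apply_symm_apply] at h1
    rw [← h1, ← hA]
    rfl)
  refine eq_zero_of_eventually_eval_eq_zero (z := y w) ?_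
  have h0 : LinearMap.toContinuousLinearMap y ((NormedSpace.exp
      ((0 : complexLie hG hz) : Matrix (Fin n) (Fin n) ℂ)).mulVec w) = y w := by simp
  rw [← h0, ← hmap, Filter.eventually_map]
  refine .of_forall fun A => ?_
  have := hp _ ⟨_, exp_mem_of_mem_complexLie hG hz A.2, rfl⟩
  exact (hev _ _).symm.trans this

end OrbitDimension

section AlmostPrincipalOrbit

theorem exists_comap_option_eq_bot {σ : Type} {R : Type} [CommRing R] [Algebra ℂ R]
    {p q : Ideal R} (hp : p.IsPrime) (hpq : p ≤ q) {r : R} (hrp : r ∉ p) (hrq : r ∈ q)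
    (β : MvPolynomial σ ℂ →ₐ[ℂ] R) (hβ : q.comap β = ⊥) :
    ∃ γ : MvPolynomial (Option σ) ℂ →ₐ[ℂ] R, p.comap γ = ⊥ := by
  have key : ∀ Q : Polynomial (MvPolynomial σ ℂ),
      Polynomial.eval₂ (β : MvPolynomial σ ℂ →+* R) r Q ∈ p → Q = 0 := by
    intro Q hQ
    by_contra hne
    obtain ⟨T, hT, hdvd⟩ := Polynomial.exists_eq_pow_rootMultiplicity_mul_and_not_dvd Q hne 0
    rw [map_zero, sub_zero] at hT hdvd
    rw [hT, Polynomial.eval₂_mul, Polynomial.eval₂_X_pow] at hQ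
    have hTp := (hp.mem_or_mem hQ).resolve_left
      fun h => hrp (hp.mem_of_pow_mem _ h)
    have hTq := hpq hTp
    rw [← Polynomial.divX_mul_X_add T, Polynomial.eval₂_add, Polynomial.eval₂_mul,
      Polynomial.eval₂_X, Polynomial.eval₂_C,
      Ideal.add_mem_iff_right _ (Ideal.mul_mem_left _ _ hrq)] at hTq
    have h0 : T.coeff 0 ∈ q.comap β := hTq
    rw [hβ, Ideal.mem_bot] at h0
    exact hdvd (Polynomial.X_dvd_iff.2 h0)
  refine ⟨(Polynomial.eval₂AlgHom β r fun a => mul_comm _ _).comp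
    (optionEquivLeft ℂ σ).toAlgHom, (Submodule.eq_bot_iff _).2 fun P hP => ?_⟩
  exact (map_eq_zero_iff _ (optionEquivLeft ℂ σ).injective).1 (key _ hP)

theorem mem_orbit_of_isAlmostPrincipalPt {n : ℕ} {G : Set (Matrix (Fin n) (Fin n) ℂ)}
    (hG : IsMatSubgroup ℂ n G) (hz : IsZClosedInGL ℂ n G) {u w : Fin n → ℂ}
    (hw : IsAlmostPrincipalPt ℂ n G w) (hwu : w ∈ zclosure ℂ n (orbit ℂ n G u)) :
    u ∈ orbit ℂ n G w := by
  obtain ⟨β, hβ⟩ := exists_coordinates_orbit hG hz w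
  have hbot : ⊥ ∈ ((vanishingIdeal ℂ n (orbit ℂ n G w)).comap β.toRingHom).minimalPrimes := by
    have h : (vanishingIdeal ℂ n (orbit ℂ n G w)).comap β.toRingHom = ⊥ := hβ
    rw [h]
    exact ⟨⟨Ideal.isPrime_bot, le_rfl⟩, fun _ _ _ => bot_le⟩
  obtain ⟨q, hq, hqβ⟩ := Ideal.exists_minimalPrimes_comap_eq
    (I := vanishingIdeal ℂ n (orbit ℂ n G w)) β.toRingHom ⊥ hbot
  have := hq.1.1
  obtain ⟨p, hp, hpq⟩ := Ideal.exists_minimalPrimes_le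
    ((vanishingIdeal_le_of_mem_zclosure hG hwu).trans hq.1.2)
  have := hp.1.1
  rcases hpq.eq_or_lt with rfl | hlt
  · obtain ⟨h₁, hh₁, H₁⟩ := exists_dense_open_subset_orbit hz u p hp (AlgHom.id ℂ _)
    obtain ⟨h₂, hh₂, H₂⟩ := exists_dense_open_subset_orbit hz w p hq (AlgHom.id ℂ _)
    obtain ⟨z, hz0, hz1⟩ := exists_zero_forall_ne_zero p ![h₁, h₂] (by
      intro i
      fin_cases i
      · exact hh₁
      · exact hh₂)
    obtain ⟨y₁, hy₁, e₁⟩ := H₁ z hz0 (hz1 0)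
    obtain ⟨y₂, hy₂, e₂⟩ := H₂ z hz0 (hz1 1)
    have hy : y₁ = y₂ := funext fun i => by
      have h1 := e₁ (X i)
      have h2 := e₂ (X i)
      simp only [eval_X, AlgHom.id_apply] at h1 h2
      rw [← h1, h2]
    obtain ⟨g, hg, rfl⟩ := hy₁
    exact mem_orbit_of_mulVec_mem hG hg (by rwa [← hy] at hy₂)
  · obtain ⟨r, hrq, hrp⟩ := Set.exists_of_ssubset hlt
    obtain ⟨γ, hγ⟩ := exists_comap_option_eq_bot hp.1.1 hpq hrp hrq β hqβ
    have h1 := card_le_finrank_orbitTangent hG hz u hp γ hγ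
    have h2 := finrank_orbitTangent_le_of_isAlmostPrincipalPt hG hz hw u
    rw [Fintype.card_option, Fintype.card_fin] at h1
    omega

end AlmostPrincipalOrbit

section PolynomialTransport

theorem exists_eval_mul_mul {n : ℕ} (a b : Matrix (Fin n) (Fin n) ℂ)
    (p : MvPolynomial (Fin n × Fin n) ℂ) :
    ∃ q : MvPolynomial (Fin n × Fin n) ℂ, ∀ g : Matrix (Fin n) (Fin n) ℂ,
      eval (fun ij => g ij.1 ij.2) q = eval (fun ij => (a * g * b) ij.1 ij.2) p := by
  refine ⟨aeval (fun ij : Fin n × Fin n =>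
    ∑ l, ∑ j, C (a ij.1 j) * X (j, l) * C (b l ij.2)) p, fun g => ?_⟩
  induction p using MvPolynomial.induction_on with
  | C c => simp
  | add p q hp hq => simp only [map_add, hp, hq]
  | mul_X p i hp =>
    simp only [map_mul, hp, aeval_X, eval_X]
    congr 1
    simp [Matrix.mul_apply, Finset.sum_mul]

theorem exists_eval_conjTranspose {n : ℕ} (p : MvPolynomial (Fin n × Fin n) ℂ) :
    ∃ q : MvPolynomial (Fin n × Fin n) ℂ, ∀ g : Matrix (Fin n) (Fin n) ℂ,
      eval (fun ij => g ij.1 ij.2) q = star (eval (fun ij => g.conjTranspose ij.1 ij.2) p) := by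
  refine ⟨eval₂ (C.comp (starRingEnd ℂ)) (fun ij : Fin n × Fin n => X (ij.2, ij.1)) p, fun g => ?_⟩
  induction p using MvPolynomial.induction_on with
  | C c => simp
  | add p q hp hq => simp only [map_add, eval₂_add, hp, hq, star_add]
  | mul_X p i hp => simp [hp, Matrix.conjTranspose_apply]

theorem exists_eval_diagonal {n : ℕ} (p : MvPolynomial (Fin n × Fin n) ℂ) :
    ∃ q : MvPolynomial (Fin n) ℂ, ∀ x : Fin n → ℂ,
      eval x q = eval (fun ij => Matrix.diagonal x ij.1 ij.2) p := by
  refine ⟨aeval (fun ij : Fin n × Fin n => if ij.1 = ij.2 then X ij.1 else 0) p, fun x => ?_⟩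
  induction p using MvPolynomial.induction_on with
  | C c => simp
  | add p q hp hq => simp only [map_add, hp, hq]
  | mul_X p i hp =>
    simp only [map_mul, hp, aeval_X, eval_X, Matrix.diagonal_apply]
    congr 1
    split_ifs <;> simp

/-- A polynomial vanishing at all natural powers of a positive real vector vanishes at all its
complex powers. -/
theorem eval_exp_eq_zero_of_nat {σ : Type} (q : MvPolynomial σ ℂ) (μ : σ → ℝ)
    (h : ∀ m : ℕ, eval (fun i => Complex.exp (m * μ i)) q = 0) (t : ℂ) :
    eval (fun i => Complex.exp (t * μ i)) q = 0 := by
  obtain ⟨L, hL⟩ : ∃ L : (σ →₀ ℕ) → ℝ, ∀ d, L d = d.sum fun i k => k * μ i := ⟨_, fun _ => rfl⟩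
  have hev : ∀ s : ℂ, eval (fun i => Complex.exp (s * μ i)) q =
      ∑ d ∈ q.support, coeff d q * Complex.exp (s * L d) := by
    intro s
    rw [eval_eq]
    refine Finset.sum_congr rfl fun d _ => ?_
    congr 1
    simp_rw [← Complex.exp_nat_mul]
    rw [← Complex.exp_sum, hL, Finsupp.sum]
    push_cast
    rw [Finset.mul_sum]
    congr 1
    exact Finset.sum_congr rfl fun i _ => by ring
  have hinj : Set.InjOn (fun x : ℝ => Complex.exp x) (q.support.image L : Set ℝ) := by
    intro x _ y _ hxy
    have hxy' : Complex.exp x = Complex.exp y := hxy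
    rw [← Complex.ofReal_exp, ← Complex.ofReal_exp, Complex.ofReal_inj] at hxy'
    exact Real.exp_injective hxy'
  obtain ⟨r, hr⟩ : ∃ r : Polynomial ℂ, ∀ x ∈ q.support.image L,
      r.eval (Complex.exp x) = Complex.exp (t * x) :=
    ⟨Lagrange.interpolate (q.support.image L) (fun x : ℝ => Complex.exp x)
      fun x => Complex.exp (t * x), fun x hx => Lagrange.eval_interpolate_at_node _ hinj hx⟩
  rw [hev]
  calc _ = ∑ d ∈ q.support, coeff d q * r.eval (Complex.exp (L d)) :=
        Finset.sum_congr rfl fun d hd => by rw [hr _ (Finset.mem_image_of_mem L hd)]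
    _ = ∑ m ∈ r.support, r.coeff m * ∑ d ∈ q.support, coeff d q * Complex.exp (m * L d) := by
        simp_rw [Polynomial.eval_eq_sum, Polynomial.sum_def, Finset.mul_sum]
        rw [Finset.sum_comm]
        refine Finset.sum_congr rfl fun m _ => Finset.sum_congr rfl fun d _ => ?_
        rw [Complex.exp_nat_mul]
        ring
    _ = 0 := Finset.sum_eq_zero fun m _ => by rw [← hev, h m, mul_zero]

end PolynomialTransport

section Polar

open scoped Matrix.Norms.Operator ComplexOrder

theorem isZClosedInGL_mul_left {n : ℕ} {G : Set (Matrix (Fin n) (Fin n) ℂ)}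
    (hz : IsZClosedInGL ℂ n G) {u : Matrix (Fin n) (Fin n) ℂ} (hu : IsUnit u) :
    IsZClosedInGL ℂ n {g | u * g ∈ G} := by
  obtain ⟨P, rfl⟩ := hz
  choose q hq using exists_eval_mul_mul u 1
  refine ⟨q '' P, Set.ext fun g => ?_⟩
  obtain ⟨u, rfl⟩ := hu
  simp only [Set.mem_ofPred_eq, Set.forall_mem_image, hq, mul_one, Units.isUnit_units_mul]

theorem exp_conj_diagonal {n : ℕ} {U : Matrix (Fin n) (Fin n) ℂ}
    (hU : U ∈ Matrix.unitaryGroup (Fin n) ℂ) (d : Fin n → ℂ) :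
    NormedSpace.exp (U * Matrix.diagonal d * star U) =
      U * Matrix.diagonal (fun i => Complex.exp (d i)) * star U := by
  have h1 : U * star U = 1 := (Matrix.mem_unitaryGroup_iff).1 hU
  have h2 : U⁻¹ = star U := Matrix.inv_eq_right_inv h1
  rw [← h2, Matrix.exp_conj _ _ (IsUnit.of_mul_eq_one _ h1), Matrix.exp_diagonal]
  congr
  funext i
  rw [Pi.coe_exp, Complex.exp_eq_exp_ℂ]

/-- If all natural powers of a positive matrix lie in an algebraic subset of `GL_n`, so do all
its complex powers. -/
theorem exp_smul_mem_of_nat {n : ℕ} {G : Set (Matrix (Fin n) (Fin n) ℂ)}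
    (hz : IsZClosedInGL ℂ n G) {B : Matrix (Fin n) (Fin n) ℂ} (hB : B.IsHermitian)
    (h : ∀ m : ℕ, NormedSpace.exp (m • B) ∈ G) (t : ℂ) : NormedSpace.exp (t • B) ∈ G := by
  obtain ⟨P, rfl⟩ := hz
  refine ⟨isUnit_nexp _, fun p hp => ?_⟩
  obtain ⟨U, hU, μ, hBU⟩ : ∃ U ∈ Matrix.unitaryGroup (Fin n) ℂ, ∃ μ : Fin n → ℝ,
      B = U * Matrix.diagonal (fun i => (μ i : ℂ)) * star U :=
    ⟨hB.eigenvectorUnitary, hB.eigenvectorUnitary.2, hB.eigenvalues, hB.spectral_theorem⟩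
  have hexp : ∀ s : ℂ, NormedSpace.exp (s • B) =
      U * Matrix.diagonal (fun i => Complex.exp (s * μ i)) * star U := fun s => by
    rw [← exp_conj_diagonal hU, hBU]
    congr 1
    rw [← smul_mul_assoc, ← mul_smul_comm, ← Matrix.diagonal_smul]
    rfl
  obtain ⟨q₁, hq₁⟩ := exists_eval_mul_mul U (star U) p
  obtain ⟨q, hq⟩ := exists_eval_diagonal q₁
  have hev : ∀ s : ℂ, eval (fun i => Complex.exp (s * μ i)) q =
      eval (fun ij => NormedSpace.exp (s • B) ij.1 ij.2) p := fun s => by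
    rw [hq, hq₁, hexp]
  rw [← hev]
  refine eval_exp_eq_zero_of_nat q μ (fun m => ?_) t
  rw [hev, Nat.cast_smul_eq_nsmul]
  exact (h m).2 p hp

theorem exists_isHermitian_exp_eq {n : ℕ} {P : Matrix (Fin n) (Fin n) ℂ} (hP : P.PosDef) :
    ∃ B : Matrix (Fin n) (Fin n) ℂ, B.IsHermitian ∧ NormedSpace.exp B = P := by
  obtain ⟨U, hU, μ, hμ, hPU⟩ : ∃ U ∈ Matrix.unitaryGroup (Fin n) ℂ, ∃ μ : Fin n → ℝ,
      (∀ i, 0 < μ i) ∧ P = U * Matrix.diagonal (fun i => (μ i : ℂ)) * star U :=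
    ⟨hP.1.eigenvectorUnitary, hP.1.eigenvectorUnitary.2, hP.1.eigenvalues, hP.eigenvalues_pos,
      hP.1.spectral_theorem⟩
  refine ⟨U * Matrix.diagonal (fun i => (Real.log (μ i) : ℂ)) * star U, ?_, ?_⟩
  · rw [Matrix.star_eq_conjTranspose]
    refine Matrix.isHermitian_mul_mul_conjTranspose U ?_
    exact Matrix.isHermitian_diagonal_of_self_adjoint _ (funext fun i => Complex.conj_ofReal _)
  · rw [exp_conj_diagonal hU, hPU]
    congr
    funext i
    rw [← Complex.ofReal_exp, Real.exp_log (hμ i)]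

theorem conjTranspose_mem {n : ℕ} {G K : Set (Matrix (Fin n) (Fin n) ℂ)}
    (hG : IsMatSubgroup ℂ n G) (hz : IsZClosedInGL ℂ n G) (hKG : K ⊆ G)
    (hK : ∀ k ∈ K, k ∈ Matrix.unitaryGroup (Fin n) ℂ)
    (hd : ∀ p : MvPolynomial (Fin n × Fin n) ℂ, (∀ k ∈ K, eval (fun ij => k ij.1 ij.2) p = 0) →
      ∀ g ∈ G, eval (fun ij => g ij.1 ij.2) p = 0) {g : Matrix (Fin n) (Fin n) ℂ} (hg : g ∈ G) :
    g.conjTranspose ∈ G := by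
  have hinv : ∀ k ∈ K, k.conjTranspose ∈ G := fun k hk => by
    rw [← Matrix.star_eq_conjTranspose,
      ← Matrix.inv_eq_right_inv (Matrix.mem_unitaryGroup_iff.1 (hK k hk))]
    exact (hG.2.2 k (hKG hk)).2
  have hgu := (hG.2.2 g hg).1
  obtain ⟨P, rfl⟩ := hz
  refine ⟨(Matrix.isUnit_conjTranspose _).2 hgu, fun p hp => ?_⟩
  obtain ⟨q, hq⟩ := exists_eval_conjTranspose p
  have := hd q (fun k hk => by rw [hq, (hinv k hk).2 p hp, star_zero]) g hg
  rwa [hq, star_eq_zero] at this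

/-- Polar decomposition in a self-adjoint algebraic group. -/
theorem exists_polar {n : ℕ} {G : Set (Matrix (Fin n) (Fin n) ℂ)}
    (hG : IsMatSubgroup ℂ n G) (hz : IsZClosedInGL ℂ n G)
    (hstar : ∀ g ∈ G, g.conjTranspose ∈ G) {g : Matrix (Fin n) (Fin n) ℂ} (hg : g ∈ G) :
    ∃ B : Matrix (Fin n) (Fin n) ℂ, B.IsHermitian ∧ (∀ t : ℂ, NormedSpace.exp (t • B) ∈ G) ∧
      g.conjTranspose * g = NormedSpace.exp B * NormedSpace.exp B := by
  obtain ⟨A, hA, hAg⟩ := exists_isHermitian_exp_eq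
    (Matrix.PosDef.conjTranspose_mul_self g (Matrix.mulVec_injective_of_isUnit (hG.2.2 g hg).1))
  have hΓ := isClosedUnitSubgroup_of_isZClosedInGL hG hz
  have hmem := exp_smul_mem_of_nat hz hA fun m => by
    rw [Matrix.exp_nsmul, hAg]
    exact hΓ.pow_mem (hG.2.1 _ (hstar g hg) _ hg) m
  refine ⟨(1 / 2 : ℝ) • A, hA.smul (.all _), fun t => ?_, ?_⟩
  · have := hmem (t * (1 / 2 : ℝ))
    rwa [mul_smul, Complex.coe_smul] at this
  · have h := nexp_add_of_commute (Commute.refl ((1 / 2 : ℝ) • A))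
    rw [← add_smul, add_halves, one_smul] at h
    exact hAg.symm.trans h

end Polar

section KempfNess

open scoped Matrix.Norms.Operator

theorem isMatSubgroup_isotropy {n : ℕ} {G : Set (Matrix (Fin n) (Fin n) ℂ)}
    (hG : IsMatSubgroup ℂ n G) (w : Fin n → ℂ) : IsMatSubgroup ℂ n (isotropy ℂ n G w) := by
  refine ⟨⟨hG.1, Matrix.one_mulVec w⟩, fun a ha b hb => ⟨hG.2.1 a ha.1 b hb.1, ?_⟩,
    fun a ha => ⟨(hG.2.2 a ha.1).1, (hG.2.2 a ha.1).2, ?_⟩⟩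
  · rw [← Matrix.mulVec_mulVec, hb.2, ha.2]
  · have hd := (Matrix.isUnit_iff_isUnit_det a).1 (hG.2.2 a ha.1).1
    conv_lhs => rw [← ha.2]
    rw [Matrix.mulVec_mulVec, Matrix.nonsing_inv_mul a hd, Matrix.one_mulVec]

theorem isZClosedInGL_isotropy {n : ℕ} {G : Set (Matrix (Fin n) (Fin n) ℂ)}
    (hz : IsZClosedInGL ℂ n G) (w : Fin n → ℂ) : IsZClosedInGL ℂ n (isotropy ℂ n G w) := by
  obtain ⟨P, rfl⟩ := hz
  refine ⟨P ∪ Set.range fun i => ∑ j, X (i, j) * C (w j) - C (w i), Set.ext fun g => ?_⟩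
  have h : (∀ i, ∑ j, g i j * w j = w i) ↔ g.mulVec w = w := by
    rw [funext_iff]
    rfl
  simp only [isotropy, Set.mem_ofPred_eq, Set.mem_union, or_imp, forall_and, Set.forall_mem_range,
    map_sub, map_sum, map_mul, eval_X, eval_C, sub_eq_zero, h, and_assoc]

theorem ofReal_norm_toLp_sq {n : ℕ} (v : Fin n → ℂ) :
    ((‖WithLp.toLp 2 v‖ ^ 2 : ℝ) : ℂ) = star v ⬝ᵥ v := by
  rw [EuclideanSpace.norm_sq_eq, dotProduct]
  push_cast
  refine Finset.sum_congr rfl fun i _ => ?_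
  rw [Pi.star_apply, RCLike.star_def, Complex.conj_mul']

theorem star_mulVec_dotProduct {n : ℕ} (M : Matrix (Fin n) (Fin n) ℂ) (v w : Fin n → ℂ) :
    star (M.mulVec v) ⬝ᵥ w = star v ⬝ᵥ (M.conjTranspose.mulVec w) := by
  rw [Matrix.star_mulVec, Matrix.dotProduct_mulVec]

theorem norm_toLp_mulVec_of_mem_unitaryGroup {n : ℕ} {U : Matrix (Fin n) (Fin n) ℂ}
    (hU : U ∈ Matrix.unitaryGroup (Fin n) ℂ) (v : Fin n → ℂ) :
    ‖WithLp.toLp 2 (U.mulVec v)‖ = ‖WithLp.toLp 2 v‖ := by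
  rw [← sq_eq_sq₀ (norm_nonneg _) (norm_nonneg _), ← Complex.ofReal_inj, ofReal_norm_toLp_sq,
    ofReal_norm_toLp_sq, star_mulVec_dotProduct, Matrix.mulVec_mulVec,
    ← Matrix.star_eq_conjTranspose, Matrix.mem_unitaryGroup_iff'.1 hU, Matrix.one_mulVec]

/-- If `a` does not decrease the norm of `w` and `a²` preserves it, then `a²` fixes `w`. -/
theorem mulVec_mulVec_eq_of_norm_le {n : ℕ} {a : Matrix (Fin n) (Fin n) ℂ} (ha : a.IsHermitian)
    {w : Fin n → ℂ} (h₁ : ‖WithLp.toLp 2 w‖ ≤ ‖WithLp.toLp 2 (a.mulVec w)‖)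
    (h₂ : ‖WithLp.toLp 2 (a.mulVec (a.mulVec w))‖ = ‖WithLp.toLp 2 w‖) :
    a.mulVec (a.mulVec w) = w := by
  have e : ‖WithLp.toLp 2 (a.mulVec (a.mulVec w) - w)‖ ^ 2 =
      ‖WithLp.toLp 2 (a.mulVec (a.mulVec w))‖ ^ 2 + ‖WithLp.toLp 2 w‖ ^ 2 -
        2 * ‖WithLp.toLp 2 (a.mulVec w)‖ ^ 2 := by
    apply Complex.ofReal_injective
    rw [Complex.ofReal_sub, Complex.ofReal_add, Complex.ofReal_mul]
    simp only [ofReal_norm_toLp_sq]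
    rw [star_sub, sub_dotProduct, dotProduct_sub, dotProduct_sub]
    have e1 : star (a.mulVec (a.mulVec w)) ⬝ᵥ w = star (a.mulVec w) ⬝ᵥ (a.mulVec w) := by
      rw [star_mulVec_dotProduct, ha.eq]
    have e2 : star w ⬝ᵥ a.mulVec (a.mulVec w) = star (a.mulVec w) ⬝ᵥ (a.mulVec w) := by
      rw [star_mulVec_dotProduct, ha.eq]
    rw [e1, e2]
    push_cast
    ring
  have h0 : ‖WithLp.toLp 2 (a.mulVec (a.mulVec w) - w)‖ ^ 2 ≤ 0 := by
    rw [e, h₂]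
    nlinarith [norm_nonneg (WithLp.toLp 2 w)]
  have h3 : WithLp.toLp 2 (a.mulVec (a.mulVec w) - w) = 0 := by
    rw [← norm_eq_zero]
    exact pow_eq_zero_iff two_ne_zero |>.1 (le_antisymm h0 (sq_nonneg _))
  exact sub_eq_zero.1 (congrArg WithLp.ofLp h3)

theorem exists_polar_isotropy {n : ℕ} {G : Set (Matrix (Fin n) (Fin n) ℂ)}
    (hG : IsMatSubgroup ℂ n G) (hz : IsZClosedInGL ℂ n G)
    (hstar : ∀ g ∈ G, g.conjTranspose ∈ G) {w : Fin n → ℂ}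
    (hw : ∀ g ∈ G, ‖WithLp.toLp 2 w‖ ≤ ‖WithLp.toLp 2 (g.mulVec w)‖)
    {g : Matrix (Fin n) (Fin n) ℂ} (hg : g ∈ isotropy ℂ n G w) :
    ∃ B : Matrix (Fin n) (Fin n) ℂ, B.IsHermitian ∧
      (∀ t : ℂ, NormedSpace.exp (t • B) ∈ isotropy ℂ n G w) ∧
      g.conjTranspose * g = NormedSpace.exp B * NormedSpace.exp B := by
  obtain ⟨B, hB, hBG, hgB⟩ := exists_polar hG hz hstar hg.1
  obtain ⟨a, ha⟩ : ∃ a, a = NormedSpace.exp ((1 / 2 : ℝ) • B) := ⟨_, rfl⟩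
  have haH : a.IsHermitian := by
    rw [ha]
    exact Matrix.IsHermitian.exp (hB.smul (.all _))
  have haa : NormedSpace.exp B = a * a := by
    have h := nexp_add_of_commute (Commute.refl ((1 / 2 : ℝ) • B))
    rw [← add_smul, add_halves, one_smul] at h
    rw [ha]
    exact h
  have hBw : (NormedSpace.exp B).mulVec w = w := by
    rw [haa, ← Matrix.mulVec_mulVec]
    refine mulVec_mulVec_eq_of_norm_le haH (hw a ?_) ?_
    · have := hBG ((1 / 2 : ℝ) : ℂ)
      rwa [Complex.coe_smul, ← ha] at this
    · rw [← sq_eq_sq₀ (norm_nonneg _) (norm_nonneg _), ← Complex.ofReal_inj, ofReal_norm_toLp_sq,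
        Matrix.mulVec_mulVec, ← haa, star_mulVec_dotProduct, (Matrix.IsHermitian.exp hB).eq,
        Matrix.mulVec_mulVec, ← hgB, ← Matrix.mulVec_mulVec, ← star_mulVec_dotProduct, hg.2,
        ofReal_norm_toLp_sq]
  refine ⟨B, hB, exp_smul_mem_of_nat (isZClosedInGL_isotropy hz w) hB fun m => ?_, hgB⟩
  rw [Matrix.exp_nsmul]
  refine (isClosedUnitSubgroup_of_isZClosedInGL (isMatSubgroup_isotropy hG w)
    (isZClosedInGL_isotropy hz w)).pow_mem ⟨?_, hBw⟩ m
  simpa using hBG 1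

/-- The isotropy group of a vector of minimal norm is determined by its unitary part. -/
theorem isotropy_subset_of_unitary {n : ℕ} {G H : Set (Matrix (Fin n) (Fin n) ℂ)}
    (hG : IsMatSubgroup ℂ n G) (hz : IsZClosedInGL ℂ n G)
    (hstar : ∀ g ∈ G, g.conjTranspose ∈ G) {w : Fin n → ℂ}
    (hw : ∀ g ∈ G, ‖WithLp.toLp 2 w‖ ≤ ‖WithLp.toLp 2 (g.mulVec w)‖)
    (hH : IsZClosedInGL ℂ n H)
    (h : ∀ g ∈ isotropy ℂ n G w, g ∈ Matrix.unitaryGroup (Fin n) ℂ → g ∈ H) :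
    isotropy ℂ n G w ⊆ H := by
  intro g hg
  obtain ⟨B, hB, hBw, hgB⟩ := exists_polar_isotropy hG hz hstar hw hg
  have hGw := isMatSubgroup_isotropy hG w
  obtain ⟨u, hu⟩ : ∃ u, u = g * NormedSpace.exp (-B) := ⟨_, rfl⟩
  have hB1 : NormedSpace.exp B * NormedSpace.exp (-B) = 1 := nexp_mul_neg B
  have hB2 : NormedSpace.exp (-B) * NormedSpace.exp B = 1 := nexp_neg_mul B
  have huw : u ∈ isotropy ℂ n G w := by
    rw [hu]
    refine hGw.2.1 _ hg _ ?_
    simpa using hBw (-1)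
  have huU : u ∈ Matrix.unitaryGroup (Fin n) ℂ := by
    rw [Matrix.mem_unitaryGroup_iff', Matrix.star_eq_conjTranspose, hu, Matrix.conjTranspose_mul,
      (Matrix.IsHermitian.exp hB.neg).eq]
    calc _ = NormedSpace.exp (-B) * (g.conjTranspose * g) * NormedSpace.exp (-B) := by
          simp only [mul_assoc]
      _ = (NormedSpace.exp (-B) * NormedSpace.exp B) *
          (NormedSpace.exp B * NormedSpace.exp (-B)) := by rw [hgB]; simp only [mul_assoc]
      _ = 1 := by rw [hB1, hB2, one_mul]
  have hmem := exp_smul_mem_of_real (isZClosedInGL_mul_left hH (hGw.2.2 u huw).1)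
    (A := Complex.I • B) (fun t => ?_) (-Complex.I)
  · rw [smul_smul, neg_mul, Complex.I_mul_I, neg_neg, one_smul] at hmem
    have : u * NormedSpace.exp B = g := by rw [hu, mul_assoc, hB2, mul_one]
    exact this ▸ hmem
  · have hE : NormedSpace.exp (t • Complex.I • B) ∈ isotropy ℂ n G w := by
      rw [← Complex.coe_smul, smul_smul]
      exact hBw _
    refine h _ (hGw.2.1 _ huw _ hE) (mul_mem huU ?_)
    rw [Matrix.mem_unitaryGroup_iff', Matrix.star_eq_conjTranspose, ← Matrix.exp_conjTranspose]
    have : (t • Complex.I • B).conjTranspose = -(t • Complex.I • B) := by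
      rw [Matrix.conjTranspose_smul, Matrix.conjTranspose_smul, hB.eq]
      simp
    rw [this]
    exact nexp_neg_mul _

end KempfNess

section StabilizerTypes

open Filter Topology
open scoped RealInnerProductSpace

theorem exists_norm_nexp_sub_one_sub_le {𝔸 : Type} [NormedRing 𝔸] [NormedAlgebra ℝ 𝔸]
    [CompleteSpace 𝔸] : ∃ C > 0, ∀ᶠ X : 𝔸 in 𝓝 0, ‖NormedSpace.exp X - 1 - X‖ ≤ C * ‖X‖ ^ 2 := by
  have h := (NormedSpace.exp_hasFPowerSeriesAt_zero (𝕂 := ℝ) (𝔸 := 𝔸)).isBigO_sub_partialSum_pow 2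
  obtain ⟨C, hC, h⟩ := h.exists_pos
  refine ⟨C, hC, h.bound.mono fun X hX => ?_⟩
  simpa [FormalMultilinearSeries.partialSum, Finset.sum_range_succ, NormedSpace.expSeries_apply_eq,
    sub_sub] using hX

variable {E : Type} [NormedAddCommGroup E] [InnerProductSpace ℝ E] {Γ : Set (E →L[ℝ] E)}

theorem IsClosedUnitSubgroup.inv_apply_mem (hΓ : IsClosedUnitSubgroup Γ) {g : E →L[ℝ] E}
    (hg : g ∈ Γ) : ∃ b ∈ Γ, g * b = 1 ∧ (∀ x, g (b x) = x) ∧ ∀ x, b (g x) = x := by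
  obtain ⟨b, hb, h1, h2⟩ := hΓ.exists_inv g hg
  exact ⟨b, hb, h1, fun x => by simpa using congrArg (fun T : E →L[ℝ] E => T x) h1,
    fun x => by simpa using congrArg (fun T : E →L[ℝ] E => T x) h2⟩

/-- The vectors fixed by every element of `Γ` which fixes `v`. -/
def stabilizerFixed (Γ : Set (E →L[ℝ] E)) (v : E) : Submodule ℝ E where
  carrier := {x | ∀ g ∈ Γ, g v = v → g x = x}
  add_mem' hx hy g hg hv := by rw [map_add, hx g hg hv, hy g hg hv]
  zero_mem' g _ _ := map_zero g
  smul_mem' c x hx g hg hv := by rw [map_smul, hx g hg hv]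

theorem stabilizerFixed_anti {v w : E} (h : ∀ g ∈ Γ, g v = v → g w = w) :
    stabilizerFixed Γ w ≤ stabilizerFixed Γ v :=
  fun _ hx g hg hv => hx g hg (h g hg hv)

theorem IsClosedUnitSubgroup.exists_near_one (hΓ : IsClosedUnitSubgroup Γ) (hc : IsCompact Γ)
    (w : E) {N : Set (E →L[ℝ] E)} (hN : N ∈ 𝓝 1) :
    ∃ δ > 0, ∀ g ∈ Γ, ‖g w - w‖ < δ → ∃ g' ∈ Γ, g' ∈ N ∧ g' w = g w := by
  obtain ⟨N', hN'N, hN'o, hN'1⟩ := mem_nhds_iff.1 hN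
  let O : Set (E →L[ℝ] E) := ⋃ h ∈ {h | h ∈ Γ ∧ h w = w}, (fun g => g * h) ⁻¹' N'
  have hO : IsOpen O := isOpen_biUnion fun h _ => hN'o.preimage (continuous_mul_const h)
  have key : ∀ g ∈ Γ, g ∈ O → ∃ g' ∈ Γ, g' ∈ N ∧ g' w = g w := by
    intro g hg hgO
    obtain ⟨h, ⟨hh, hw⟩, hgh⟩ := Set.mem_iUnion₂.1 hgO
    exact ⟨g * h, hΓ.mul_mem _ hg _ hh, hN'N hgh, by simp [hw]⟩
  have hS : IsCompact (Γ \ O) := hc.diff hO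
  rcases (Γ \ O).eq_empty_or_nonempty with he | hne
  · exact ⟨1, one_pos, fun g hg _ => key g hg (Set.sdiff_eq_empty.1 he hg)⟩
  · obtain ⟨g₀, hg₀, hmin⟩ := hS.exists_isMinOn hne
      (f := fun g => ‖g w - w‖) (Continuous.continuousOn (by fun_prop))
    refine ⟨‖g₀ w - w‖, ?_, fun g hg hlt => key g hg ?_⟩
    · rw [gt_iff_lt, norm_pos_iff, sub_ne_zero]
      intro h0
      obtain ⟨b, hb, h1, -, h2⟩ := hΓ.inv_apply_mem hg₀.1
      refine hg₀.2 (Set.mem_iUnion₂.2 ⟨b, ⟨hb, ?_⟩, ?_⟩)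
      · conv_lhs => rw [← h0]
        exact h2 w
      · simpa [h1] using hN'1
    · by_contra hgO
      exact absurd (hmin (a := g) ⟨hg, hgO⟩) (not_le.2 hlt)

variable [FiniteDimensional ℝ E]

theorem nexp_apply_eq_self {B : E →L[ℝ] E} {w : E} (h : B w = 0) : NormedSpace.exp B w = w := by
  have h1 := (NormedSpace.exp_series_hasSum_exp' (𝕂 := ℝ) B).mapL
    (ContinuousLinearMap.apply ℝ E w)
  have h2 : HasSum (fun m : ℕ => (ContinuousLinearMap.apply ℝ E w)
      (((m.factorial : ℝ))⁻¹ • B ^ m)) w := by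
    convert hasSum_single (f := fun m : ℕ => (ContinuousLinearMap.apply ℝ E w)
      (((m.factorial : ℝ))⁻¹ • B ^ m)) 0 ?_ using 1
    · simp
    · intro m hm
      obtain ⟨k, rfl⟩ := Nat.exists_eq_succ_of_ne_zero hm
      simp [pow_succ, h]
  exact h1.unique h2

theorem IsClosedUnitSubgroup.exists_apply_eq_nexp_apply (hΓ : IsClosedUnitSubgroup Γ)
    (hc : IsCompact Γ) (w : E) : ∃ δ > 0, ∃ C > 0, ∀ g ∈ Γ, ‖g w - w‖ < δ →
      ∃ A ∈ hΓ.lie, ‖g w - w - A w‖ ≤ C * ‖g w - w‖ ^ 2 := by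
  let h : Submodule ℝ (E →L[ℝ] E) :=
    hΓ.lie ⊓ LinearMap.ker (ContinuousLinearMap.apply ℝ E w : (E →L[ℝ] E) →ₗ[ℝ] E)
  have hhl : h ≤ hΓ.lie := inf_le_left
  obtain ⟨c', hc'⟩ := exists_isCompl h
  obtain ⟨c, hceq⟩ : ∃ c, c = c' ⊓ hΓ.lie := ⟨_, rfl⟩
  have hch : c ⊔ h = hΓ.lie := by
    rw [hceq, sup_comm, ← sup_inf_assoc_of_le _ hhl, hc'.sup_eq_top, top_inf_eq]
  let L : c →ₗ[ℝ] E := (ContinuousLinearMap.apply ℝ E w : (E →L[ℝ] E) →ₗ[ℝ] E).comp c.subtype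
  have hL : LinearMap.ker L = ⊥ := by
    rw [LinearMap.ker_eq_bot']
    intro A hA
    have h2 : (A : E →L[ℝ] E) ∈ c' ⊓ hΓ.lie := hceq ▸ A.2
    have : (A : E →L[ℝ] E) ∈ h ⊓ c' := ⟨⟨h2.2, hA⟩, h2.1⟩
    rw [hc'.inf_eq_bot] at this
    exact Subtype.ext this
  obtain ⟨K, hK, hKL⟩ := LinearMap.exists_antilipschitzWith (𝕜 := ℝ) (E := c) (F := E) L hL
  have hKA : ∀ A ∈ c, ‖A‖ ≤ K * ‖A w‖ := fun A hA => by
    simpa [L] using hKL.le_mul_dist (⟨A, hA⟩ : c) 0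
  obtain ⟨C, hC, hexp⟩ := exists_norm_nexp_sub_one_sub_le (𝔸 := E →L[ℝ] E)
  obtain ⟨ε₀, hε₀, hexp⟩ := Metric.eventually_nhds_iff.1 hexp
  have hpos : 0 < 2 * C * K * (‖w‖ + 1) := by positivity
  obtain ⟨δ, hδ, hnear⟩ := hΓ.exists_near_one hc w
    (hΓ.eventually_eq_exp_mul_exp hch (lt_min hε₀ (inv_pos.2 hpos)))
  refine ⟨δ, hδ, C * (‖w‖ + 1) * (2 * K) ^ 2, by positivity, fun g hg hgδ => ?_⟩
  obtain ⟨g', hg', hgN, hgw⟩ := hnear g hg hgδ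
  obtain ⟨A, hA, B, hB, hAε, -, rfl⟩ := hgN hg'
  have hBw : NormedSpace.exp B w = w := nexp_apply_eq_self hB.2
  rw [← hgw]
  have hy : (NormedSpace.exp A * NormedSpace.exp B) w = NormedSpace.exp A w := by
    simp [hBw]
  rw [hy]
  refine ⟨A, hch ▸ Submodule.mem_sup_left hA, ?_⟩
  have h1 : ‖NormedSpace.exp A w - w - A w‖ ≤ C * ‖A‖ ^ 2 * (‖w‖ + 1) := by
    have := (NormedSpace.exp A - 1 - A).le_opNorm w
    have h2 := hexp (y := A) (by simpa using hAε.trans_le (min_le_left _ _))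
    calc _ = ‖(NormedSpace.exp A - 1 - A) w‖ := by simp
      _ ≤ _ := this
      _ ≤ _ := by gcongr; linarith
  have hAε' : ‖A‖ * (2 * C * K * (‖w‖ + 1)) ≤ 1 := by
    have := (hAε.trans_le (min_le_right _ _)).le
    calc _ ≤ (2 * C * K * (‖w‖ + 1))⁻¹ * (2 * C * K * (‖w‖ + 1)) := by gcongr
      _ = 1 := inv_mul_cancel₀ hpos.ne'
  have h2 : ‖A w‖ ≤ ‖NormedSpace.exp A w - w‖ + ‖NormedSpace.exp A w - w - A w‖ := by
    have := norm_sub_le (NormedSpace.exp A w - w) (NormedSpace.exp A w - w - A w)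
    simpa using this
  have h3 := hKA A hA
  have h4 : C * ‖A‖ ^ 2 * (‖w‖ + 1) ≤ ‖A w‖ / 2 := by
    have : C * ‖A‖ ^ 2 * (‖w‖ + 1) ≤ C * (‖A‖ * (K * ‖A w‖)) * (‖w‖ + 1) := by
      rw [sq]; gcongr
    calc _ ≤ _ := this
      _ = ‖A‖ * (2 * C * K * (‖w‖ + 1)) * (‖A w‖ / 2) := by ring
      _ ≤ 1 * (‖A w‖ / 2) := by gcongr
      _ = _ := one_mul _
  have h5 : ‖A‖ ≤ 2 * K * ‖NormedSpace.exp A w - w‖ := by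
    have : ‖A w‖ ≤ 2 * ‖NormedSpace.exp A w - w‖ := by linarith
    calc _ ≤ _ := h3
      _ ≤ K * (2 * ‖NormedSpace.exp A w - w‖) := by gcongr
      _ = _ := by ring
  calc _ ≤ _ := h1
    _ ≤ C * (2 * K * ‖NormedSpace.exp A w - w‖) ^ 2 * (‖w‖ + 1) := by gcongr
    _ = _ := by ring

theorem inner_apply_eq_zero_of_isMin (hΓ : IsClosedUnitSubgroup Γ) {A : E →L[ℝ] E}
    (hA : A ∈ hΓ.lie) {w v : E} (hmin : ∀ g ∈ Γ, ‖w - v‖ ≤ ‖g w - v‖) : ⟪A w, v - w⟫ = 0 := by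
  have h1 : HasDerivAt (fun t : ℝ => NormedSpace.exp (t • A)) A 0 := by
    simpa using hasDerivAt_exp_smul_const (𝕂 := ℝ) A 0
  have h2 : HasDerivAt (fun t : ℝ => NormedSpace.exp (t • A) w - v) (A w) 0 := by
    simpa using ((ContinuousLinearMap.apply ℝ E w).hasFDerivAt.comp_hasDerivAt 0 h1).sub_const v
  have h3 := h2.norm_sq
  have h4 : IsLocalMin (fun t : ℝ => ‖NormedSpace.exp (t • A) w - v‖ ^ 2) 0 := by
    refine Filter.Eventually.of_forall fun t => ?_
    have := hmin _ (hA t)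
    simp only [zero_smul, NormedSpace.exp_zero, one_apply_eq_self]
    gcongr
  have h5 := h4.hasDerivAt_eq_zero h3
  simp only [zero_smul, NormedSpace.exp_zero, one_apply_eq_self] at h5
  rw [← neg_sub w v, inner_neg_right, real_inner_comm]
  linarith

theorem IsClosedUnitSubgroup.exists_nhds_stabilizer_le (hΓ : IsClosedUnitSubgroup Γ)
    (hc : IsCompact Γ) (hiso : ∀ g ∈ Γ, ∀ x, ‖g x‖ = ‖x‖) (w : E) :
    ∃ δ > 0, ∀ v, ‖v - w‖ < δ → ∃ k ∈ Γ, ∀ g ∈ Γ, g (k v) = k v → g w = w := by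
  obtain ⟨δ, hδ, C, hC, h⟩ := hΓ.exists_apply_eq_nexp_apply hc w
  refine ⟨min (δ / 2) (2 * C)⁻¹, by positivity, fun v hv => ?_⟩
  obtain ⟨k, hk, hmin⟩ := hc.exists_isMinOn ⟨1, hΓ.one_mem⟩
    (f := fun g => ‖w - g v‖) (Continuous.continuousOn (by fun_prop))
  have hmin' : ∀ g ∈ Γ, ‖w - k v‖ ≤ ‖g w - k v‖ := by
    intro g hg
    obtain ⟨b, hb, -, h1, h2⟩ := hΓ.inv_apply_mem hg
    have h3 : ‖w - k v‖ ≤ ‖w - b (k v)‖ := hmin (a := b * k) (hΓ.mul_mem _ hb _ hk)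
    rw [← hiso g hg (w - b (k v)), map_sub, h1] at h3
    exact h3
  have hle : ‖w - k v‖ < min (δ / 2) (2 * C)⁻¹ := by
    refine lt_of_le_of_lt ?_ hv
    rw [norm_sub_rev v]
    exact hmin (a := 1) hΓ.one_mem
  refine ⟨k, hk, fun g hg hgv => ?_⟩
  have heq : ‖g w - k v‖ = ‖w - k v‖ := by
    conv_lhs => rw [← hgv, ← map_sub, hiso g hg]
  have hlt : ‖g w - w‖ < δ := by
    have h1 := norm_sub_le (g w - k v) (w - k v)
    rw [sub_sub_sub_cancel_right] at h1
    have := hle.trans_le (min_le_left _ _)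
    linarith
  obtain ⟨A, hA, hAle⟩ := h g hg hlt
  have hinner : ‖g w - w‖ ^ 2 = 2 * ⟪g w - w, k v - w⟫ := by
    have h1 : ‖(g w - w) - (k v - w)‖ = ‖k v - w‖ := by
      rw [sub_sub_sub_cancel_right, heq, norm_sub_rev]
    have h2 := norm_sub_sq_real (g w - w) (k v - w)
    rw [h1] at h2
    linarith
  have hA0 := inner_apply_eq_zero_of_isMin hΓ hA hmin'
  have h2 : ⟪g w - w, k v - w⟫ = ⟪g w - w - A w, k v - w⟫ := by
    rw [inner_sub_left _ (A w), hA0, sub_zero]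
  have h3 := real_inner_le_norm (g w - w - A w) (k v - w)
  by_contra hne
  have hpos : 0 < ‖g w - w‖ ^ 2 := by
    have := norm_pos_iff.2 (sub_ne_zero.2 hne); positivity
  have h4 : ‖k v - w‖ < (2 * C)⁻¹ := by
    rw [norm_sub_rev]; exact hle.trans_le (min_le_right _ _)
  have h5 : ‖g w - w‖ ^ 2 < ‖g w - w‖ ^ 2 := by
    calc ‖g w - w‖ ^ 2 = 2 * ⟪g w - w - A w, k v - w⟫ := by rw [hinner, h2]
      _ ≤ 2 * (C * ‖g w - w‖ ^ 2 * ‖k v - w‖) := by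
        have : ‖g w - w - A w‖ * ‖k v - w‖ ≤ C * ‖g w - w‖ ^ 2 * ‖k v - w‖ := by gcongr
        linarith
      _ < 2 * (C * ‖g w - w‖ ^ 2 * (2 * C)⁻¹) := by gcongr
      _ = ‖g w - w‖ ^ 2 := by field_simp
  exact lt_irrefl _ h5

theorem IsClosedUnitSubgroup.finrank_stabilizerFixed_le (hΓ : IsClosedUnitSubgroup Γ)
    {k : E →L[ℝ] E} (hk : k ∈ Γ) (v : E) :
    Module.finrank ℝ (stabilizerFixed Γ v) ≤ Module.finrank ℝ (stabilizerFixed Γ (k v)) := by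
  obtain ⟨b, hb, -, h1, h2⟩ := hΓ.inv_apply_mem hk
  have hinj : Function.Injective (k : E →ₗ[ℝ] E) := Function.LeftInverse.injective h2
  have hle : (stabilizerFixed Γ v).map (k : E →ₗ[ℝ] E) ≤ stabilizerFixed Γ (k v) := by
    rintro _ ⟨x, hx, rfl⟩ g hg hv
    have := hx (b * g * k) (hΓ.mul_mem _ (hΓ.mul_mem _ hb _ hg) _ hk) (by simp [hv, h2])
    have h3 := congrArg k this
    simpa [h1] using h3
  calc _ = Module.finrank ℝ ((stabilizerFixed Γ v).map (k : E →ₗ[ℝ] E)) :=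
      (LinearEquiv.finrank_eq (Submodule.equivMapOfInjective _ hinj _))
    _ ≤ _ := Submodule.finrank_mono hle

theorem IsClosedUnitSubgroup.exists_countable_stabilizers (hΓ : IsClosedUnitSubgroup Γ)
    (hc : IsCompact Γ) (hiso : ∀ g ∈ Γ, ∀ x, ‖g x‖ = ‖x‖) :
    ∃ T : Set E, T.Countable ∧ ∀ v, ∃ t ∈ T, ∃ k ∈ Γ, ∀ g ∈ Γ, g t = t ↔ g (k v) = k v := by
  choose δ hδ h using hΓ.exists_nhds_stabilizer_le hc hiso
  let V : ℕ → Set E := fun d => {v | Module.finrank ℝ (stabilizerFixed Γ v) = d}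
  have hcov : ∀ d, ∃ t ⊆ V d, t.Countable ∧ V d ⊆ ⋃ x ∈ t, Metric.ball x (δ x) := fun d =>
    TopologicalSpace.countable_cover_nhdsWithin
      fun x _ => mem_nhdsWithin_of_mem_nhds (Metric.ball_mem_nhds x (hδ x))
  choose T hTV hT hcov using hcov
  refine ⟨⋃ d, T d, Set.countable_iUnion hT, fun v => ?_⟩
  obtain ⟨d, hd⟩ : ∃ d, v ∈ V d := ⟨_, rfl⟩
  obtain ⟨t, ht, hvt⟩ := Set.mem_iUnion₂.1 (hcov d hd)
  obtain ⟨k, hk, hkv⟩ := h t v (by simpa [dist_eq_norm] using hvt)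
  refine ⟨t, Set.mem_iUnion.2 ⟨d, ht⟩, k, hk, fun g hg => ⟨fun hgt => ?_, hkv g hg⟩⟩
  have hle := stabilizerFixed_anti hkv
  have hrank : Module.finrank ℝ (stabilizerFixed Γ (k v)) ≤
      Module.finrank ℝ (stabilizerFixed Γ t) := by
    obtain ⟨b, hb, -, h1, h2⟩ := hΓ.inv_apply_mem hk
    have h3 := hΓ.finrank_stabilizerFixed_le hb (k v)
    rw [h2] at h3
    exact h3.trans (le_of_eq (hd.trans (hTV d ht).symm))
  have heq := Submodule.eq_of_le_of_finrank_le hle hrank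
  have hmem : k v ∈ stabilizerFixed Γ (k v) := fun _ _ h => h
  rw [← heq] at hmem
  exact hmem g hg hgt

end StabilizerTypes

section ConjugacyClasses

open Filter Topology

theorem conjIsotropy_symm {n : ℕ} {G : Set (Matrix (Fin n) (Fin n) ℂ)} (hG : IsMatSubgroup ℂ n G)
    {v w : Fin n → ℂ} (h : ConjIsotropy ℂ n G v w) : ConjIsotropy ℂ n G w v := by
  obtain ⟨g, hg, hgw⟩ := h
  obtain ⟨hu, hi⟩ := hG.2.2 g hg
  have hd := (Matrix.isUnit_iff_isUnit_det g).1 hu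
  refine ⟨g⁻¹, hi, ?_⟩
  rw [hgw, Set.image_image, Matrix.nonsing_inv_nonsing_inv g hd]
  conv_lhs => rw [← Set.image_id (isotropy ℂ n G v)]
  refine Set.image_congr fun h _ => ?_
  rw [id, mul_assoc, mul_assoc, Matrix.nonsing_inv_mul g hd, mul_one, ← mul_assoc,
    Matrix.nonsing_inv_mul g hd, one_mul]

theorem conjIsotropy_trans {n : ℕ} {G : Set (Matrix (Fin n) (Fin n) ℂ)} (hG : IsMatSubgroup ℂ n G)
    {u v w : Fin n → ℂ} (h₁ : ConjIsotropy ℂ n G u v) (h₂ : ConjIsotropy ℂ n G v w) :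
    ConjIsotropy ℂ n G u w := by
  obtain ⟨a, ha, hav⟩ := h₁
  obtain ⟨b, hb, hbw⟩ := h₂
  refine ⟨b * a, hG.2.1 b hb a ha, ?_⟩
  rw [hbw, hav, Set.image_image]
  refine Set.image_congr fun h _ => ?_
  simp only [Matrix.mul_inv_rev, mul_assoc]

theorem conjIsotropy_mulVec {n : ℕ} {G : Set (Matrix (Fin n) (Fin n) ℂ)} (hG : IsMatSubgroup ℂ n G)
    {g : Matrix (Fin n) (Fin n) ℂ} (hg : g ∈ G) (v : Fin n → ℂ) :
    ConjIsotropy ℂ n G v (g.mulVec v) := by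
  obtain ⟨hu, hi⟩ := hG.2.2 g hg
  have hd := (Matrix.isUnit_iff_isUnit_det g).1 hu
  refine ⟨g, hg, Set.ext fun a => ⟨fun ha => ⟨g⁻¹ * a * g, ⟨?_, ?_⟩, ?_⟩, ?_⟩⟩
  · exact hG.2.1 _ (hG.2.1 _ hi _ ha.1) _ hg
  · rw [← Matrix.mulVec_mulVec, ← Matrix.mulVec_mulVec, ha.2, Matrix.mulVec_mulVec,
      Matrix.nonsing_inv_mul g hd, Matrix.one_mulVec]
  · simp only [← mul_assoc]
    rw [Matrix.mul_nonsing_inv g hd, one_mul, mul_assoc, Matrix.mul_nonsing_inv g hd, mul_one]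
  · rintro ⟨h, hh, rfl⟩
    refine ⟨hG.2.1 _ (hG.2.1 _ hg _ hh.1) _ hi, ?_⟩
    rw [Matrix.mulVec_mulVec, mul_assoc, Matrix.nonsing_inv_mul g hd, mul_one,
      ← Matrix.mulVec_mulVec, hh.2]

/-- The action of complex matrices on Euclidean space, as real-linear operators. -/
def realAction (n : ℕ) : Matrix (Fin n) (Fin n) ℂ →ₗ[ℝ]
    (EuclideanSpace ℂ (Fin n) →L[ℝ] EuclideanSpace ℂ (Fin n)) where
  toFun M := (Matrix.toEuclideanCLM (n := Fin n) (𝕜 := ℂ) M).restrictScalars ℝ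
  map_add' _ _ := by ext; simp
  map_smul' c M := by
    ext x i
    simp [Matrix.smul_mulVec]

theorem realAction_toLp {n : ℕ} (M : Matrix (Fin n) (Fin n) ℂ) (v : Fin n → ℂ) :
    realAction n M (WithLp.toLp 2 v) = WithLp.toLp 2 (M.mulVec v) := rfl

theorem realAction_mul {n : ℕ} (M N : Matrix (Fin n) (Fin n) ℂ) :
    realAction n (M * N) = realAction n M * realAction n N := by
  ext x i
  simp [realAction]

theorem realAction_one {n : ℕ} : realAction n 1 = 1 := by
  ext x i
  simp [realAction]

theorem continuous_realAction {n : ℕ} : Continuous (realAction n) :=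
  LinearMap.continuous_of_finiteDimensional _

theorem isCompact_inter_unitaryGroup {n : ℕ} {G : Set (Matrix (Fin n) (Fin n) ℂ)}
    (hG : IsMatSubgroup ℂ n G) (hz : IsZClosedInGL ℂ n G) :
    IsCompact (G ∩ (Matrix.unitaryGroup (Fin n) ℂ : Set (Matrix (Fin n) (Fin n) ℂ))) := by
  have hU : IsClosed (Matrix.unitaryGroup (Fin n) ℂ : Set (Matrix (Fin n) (Fin n) ℂ)) := by
    have : (Matrix.unitaryGroup (Fin n) ℂ : Set (Matrix (Fin n) (Fin n) ℂ)) =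
        {U | U * U.conjTranspose = 1} := Set.ext fun U => Matrix.mem_unitaryGroup_iff
    rw [this]
    exact isClosed_eq (continuous_id.matrix_mul continuous_id.matrix_conjTranspose)
      continuous_const
  have hcl : IsClosed (G ∩ (Matrix.unitaryGroup (Fin n) ℂ : Set (Matrix (Fin n) (Fin n) ℂ))) := by
    refine isClosed_of_closure_subset fun a ha => ?_
    have haU : a ∈ (Matrix.unitaryGroup (Fin n) ℂ : Set (Matrix (Fin n) (Fin n) ℂ)) :=
      closure_minimal Set.inter_subset_right hU ha
    refine ⟨?_, haU⟩
    obtain ⟨P, rfl⟩ := hz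
    refine ⟨IsUnit.of_mul_eq_one _ (Matrix.mem_unitaryGroup_iff.1 haU), fun p hp => ?_⟩
    have hc : IsClosed {g : Matrix (Fin n) (Fin n) ℂ | eval (fun ij => g ij.1 ij.2) p = 0} := by
      refine isClosed_eq ((MvPolynomial.continuous_eval p).comp ?_) continuous_const
      exact continuous_pi fun ij => (continuous_id.matrix_elem ij.1 ij.2)
    exact (closure_minimal (fun g hg => hg.1.2 p hp) hc ha :)
  have hB : IsCompact (Set.univ.pi fun _ : Fin n => Set.univ.pi fun _ : Fin n =>
      Metric.closedBall (0 : ℂ) 1) :=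
    isCompact_univ_pi fun _ => isCompact_univ_pi fun _ => isCompact_closedBall _ _
  refine hB.of_isClosed_subset hcl fun U hU i _ j _ => ?_
  simpa using entry_norm_bound_of_unitary hU.2 i j

theorem exists_countable_unitary_stabilizers {n : ℕ} {G : Set (Matrix (Fin n) (Fin n) ℂ)}
    (hG : IsMatSubgroup ℂ n G) (hz : IsZClosedInGL ℂ n G) :
    ∃ T : Set (Fin n → ℂ), T.Countable ∧ ∀ v, ∃ t ∈ T,
      ∃ k ∈ G, k ∈ Matrix.unitaryGroup (Fin n) ℂ ∧
        ∀ g ∈ G, g ∈ Matrix.unitaryGroup (Fin n) ℂ →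
          (g.mulVec t = t ↔ g.mulVec (k.mulVec v) = k.mulVec v) := by
  have hc := (isCompact_inter_unitaryGroup hG hz).image (continuous_realAction (n := n))
  have hΓ : IsClosedUnitSubgroup (realAction n '' (G ∩ Matrix.unitaryGroup (Fin n) ℂ)) := by
    refine ⟨⟨1, ⟨hG.1, one_mem _⟩, realAction_one⟩, ?_, ?_,
      fun a ha _ => hc.isClosed.closure_eq ▸ ha⟩
    · rintro _ ⟨a, ha, rfl⟩ _ ⟨b, hb, rfl⟩
      exact ⟨a * b, ⟨hG.2.1 a ha.1 b hb.1, mul_mem ha.2 hb.2⟩, realAction_mul a b⟩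
    · rintro _ ⟨a, ha, rfl⟩
      obtain ⟨hu, hi⟩ := hG.2.2 a ha.1
      have hd := (Matrix.isUnit_iff_isUnit_det a).1 hu
      have hinv : a⁻¹ = star a := Matrix.inv_eq_right_inv (Matrix.mem_unitaryGroup_iff.1 ha.2)
      refine ⟨_, ⟨a⁻¹, ⟨hi, hinv ▸ Unitary.star_mem ha.2⟩, rfl⟩, ?_, ?_⟩
      · rw [← realAction_mul, Matrix.mul_nonsing_inv a hd, realAction_one]
      · rw [← realAction_mul, Matrix.nonsing_inv_mul a hd, realAction_one]
  obtain ⟨T, hT, h⟩ := hΓ.exists_countable_stabilizers hc (by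
    rintro _ ⟨a, ha, rfl⟩ x
    exact norm_toLp_mulVec_of_mem_unitaryGroup ha.2 x.ofLp)
  have hiff : ∀ (g : Matrix (Fin n) (Fin n) ℂ) (x : EuclideanSpace ℂ (Fin n)),
      realAction n g x = x ↔ g.mulVec x.ofLp = x.ofLp := fun g x =>
    ⟨fun h => congrArg WithLp.ofLp h, fun h => (WithLp.ofLp_injective 2) h⟩
  refine ⟨WithLp.ofLp '' T, hT.image _, fun v => ?_⟩
  obtain ⟨t, ht, _, ⟨k, hk, rfl⟩, hkv⟩ := h (WithLp.toLp 2 v)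
  refine ⟨_, ⟨t, ht, rfl⟩, k, hk.1, hk.2, fun g hg hgU => ?_⟩
  have := hkv _ ⟨g, ⟨hg, hgU⟩, rfl⟩
  rwa [hiff, hiff, realAction_toLp] at this

theorem exists_min_norm {n : ℕ} {G : Set (Matrix (Fin n) (Fin n) ℂ)}
    (hG : IsMatSubgroup ℂ n G) {u : Fin n → ℂ} (hu : IsClosed (orbit ℂ n G u)) :
    ∃ a ∈ G, ∀ g ∈ G, ‖WithLp.toLp 2 (a.mulVec u)‖ ≤
      ‖WithLp.toLp 2 (g.mulVec (a.mulVec u))‖ := by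
  have hcl : IsClosed ((WithLp.ofLp : EuclideanSpace ℂ (Fin n) → _) ⁻¹' orbit ℂ n G u) :=
    hu.preimage (PiLp.continuous_ofLp 2 _)
  obtain ⟨y, ⟨a, ha, hay⟩, hmin⟩ := hcl.exists_infDist_eq_dist
    ⟨WithLp.toLp 2 u, ⟨1, hG.1, Matrix.one_mulVec u⟩⟩ 0
  refine ⟨a, ha, fun g hg => ?_⟩
  have hy : WithLp.toLp 2 (a.mulVec u) = y := WithLp.ofLp_injective 2 hay
  have h1 := Metric.infDist_le_dist_of_mem (x := (0 : EuclideanSpace ℂ (Fin n)))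
    (s := (WithLp.ofLp : EuclideanSpace ℂ (Fin n) → _) ⁻¹' orbit ℂ n G u)
    (y := WithLp.toLp 2 (g.mulVec (a.mulVec u)))
    ⟨g * a, hG.2.1 g hg a ha, (Matrix.mulVec_mulVec u g a).symm⟩
  rw [hmin, dist_zero_left, dist_zero_left] at h1
  rwa [hy]

theorem exists_countable_conjIsotropy_of_conjTranspose_mem {n : ℕ}
    {G : Set (Matrix (Fin n) (Fin n) ℂ)} (hG : IsMatSubgroup ℂ n G) (hz : IsZClosedInGL ℂ n G)
    (hstar : ∀ g ∈ G, g.conjTranspose ∈ G) :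
    ∃ T : Set (Fin n → ℂ), T.Countable ∧
      ∀ u, IsClosed (orbit ℂ n G u) → ∃ t ∈ T, ConjIsotropy ℂ n G t u := by
  obtain ⟨T, hT, h⟩ := exists_countable_unitary_stabilizers hG hz
  let Rel : (Fin n → ℂ) → (Fin n → ℂ) → Prop := fun t w =>
    (∀ g ∈ G, ‖WithLp.toLp 2 w‖ ≤ ‖WithLp.toLp 2 (g.mulVec w)‖) ∧
      ∃ k ∈ G, k ∈ Matrix.unitaryGroup (Fin n) ℂ ∧ ∀ g ∈ G, g ∈ Matrix.unitaryGroup (Fin n) ℂ →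
          (g.mulVec t = t ↔ g.mulVec (k.mulVec w) = k.mulVec w)
  have hmin : ∀ w, (∀ g ∈ G, ‖WithLp.toLp 2 w‖ ≤ ‖WithLp.toLp 2 (g.mulVec w)‖) → ∀ k ∈ G,
      k ∈ Matrix.unitaryGroup (Fin n) ℂ → ∀ g ∈ G,
        ‖WithLp.toLp 2 (k.mulVec w)‖ ≤ ‖WithLp.toLp 2 (g.mulVec (k.mulVec w))‖ := by
    intro w hw k hk hkU g hg
    rw [norm_toLp_mulVec_of_mem_unitaryGroup hkU, Matrix.mulVec_mulVec]
    exact hw _ (hG.2.1 g hg k hk)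
  have hRel : ∀ t w w', Rel t w → Rel t w' → ConjIsotropy ℂ n G w w' := by
    rintro t w w' ⟨hw, k, hk, hkU, hkw⟩ ⟨hw', k', hk', hkU', hkw'⟩
    have hsub : isotropy ℂ n G (k.mulVec w) = isotropy ℂ n G (k'.mulVec w') := by
      refine Set.Subset.antisymm ?_ ?_
      · exact isotropy_subset_of_unitary hG hz hstar (hmin w hw k hk hkU)
          (isZClosedInGL_isotropy hz _)
          fun g hg hgU => ⟨hg.1, (hkw' g hg.1 hgU).1 ((hkw g hg.1 hgU).2 hg.2)⟩
      · exact isotropy_subset_of_unitary hG hz hstar (hmin w' hw' k' hk' hkU')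
          (isZClosedInGL_isotropy hz _)
          fun g hg hgU => ⟨hg.1, (hkw g hg.1 hgU).1 ((hkw' g hg.1 hgU).2 hg.2)⟩
    refine conjIsotropy_trans hG (conjIsotropy_mulVec hG hk w) (conjIsotropy_trans hG ?_
      (conjIsotropy_symm hG (conjIsotropy_mulVec hG hk' w')))
    exact ⟨1, hG.1, by simp [hsub]⟩
  choose! W hW using fun t (ht : ∃ w, Rel t w) => ht
  refine ⟨W '' T, hT.image _, fun u hu => ?_⟩
  obtain ⟨a, ha, hau⟩ := exists_min_norm hG hu
  obtain ⟨t, ht, hk⟩ := h (a.mulVec u)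
  have hR : Rel t (a.mulVec u) := ⟨hau, hk⟩
  exact ⟨W t, ⟨t, ht, rfl⟩, conjIsotropy_trans hG (hRel t _ _ (hW t ⟨_, hR⟩) hR)
    (conjIsotropy_symm hG (conjIsotropy_mulVec hG ha u))⟩

end ConjugacyClasses

section UnitaryTrick

open scoped Matrix.Norms.Operator ComplexOrder MatrixOrder

theorem exists_conjTranspose_mul_mul_eq {n : ℕ} {K : Set (Matrix (Fin n) (Fin n) ℂ)}
    (hK : IsMatSubgroup ℂ n K) (hc : IsCompact K) :
    ∃ Q : Matrix (Fin n) (Fin n) ℂ, Q.PosDef ∧ ∀ k ∈ K, k.conjTranspose * Q * k = Q := by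
  let ρ : Matrix (Fin n) (Fin n) ℂ → Matrix (Fin n) (Fin n) ℂ →ₗ[ℝ] Matrix (Fin n) (Fin n) ℂ :=
    fun k =>
      { toFun := fun Q => k.conjTranspose * Q * k
        map_add' := fun _ _ => by rw [mul_add, add_mul]
        map_smul' := fun _ _ => by simp }
  have hq : ∀ (k Q : Matrix (Fin n) (Fin n) ℂ) (v : Fin n → ℂ),
      star v ⬝ᵥ (ρ k Q).mulVec v = star (k.mulVec v) ⬝ᵥ Q.mulVec (k.mulVec v) := by
    intro k Q v
    rw [star_mulVec_dotProduct, Matrix.mulVec_mulVec, Matrix.mulVec_mulVec]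
    rfl
  let C : Set (Matrix (Fin n) (Fin n) ℂ) := {Q | Q.IsHermitian ∧ ∀ (v : Fin n → ℂ) (r : ℝ),
    (∀ k ∈ K, r ≤ ‖WithLp.toLp 2 (k.mulVec v)‖ ^ 2) → r ≤ (star v ⬝ᵥ Q.mulVec v).re}
  have hcont : ∀ v : Fin n → ℂ, Continuous fun Q : Matrix (Fin n) (Fin n) ℂ =>
      (star v ⬝ᵥ Q.mulVec v).re := fun v =>
    Complex.continuous_re.comp
      (continuous_const.dotProduct (continuous_id.matrix_mulVec continuous_const))
  have hex : ∃ Q ∈ C, ∀ k ∈ K, ρ k Q = Q := by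
    refine exists_fixed_of_compact K hc ⟨1, hK.1⟩ ρ ?_ ?_ ?_ C ?_ ?_ ?_ ?_
    · exact ((continuous_fst.matrix_conjTranspose).matrix_mul continuous_snd).matrix_mul
        continuous_fst
    · intro h hh k hk
      refine ⟨h * k, hK.2.1 h hh k hk, fun Q => ?_⟩
      change (h * k).conjTranspose * Q * (h * k) =
        k.conjTranspose * (h.conjTranspose * Q * h) * k
      simp only [Matrix.conjTranspose_mul, mul_assoc]
    · intro k hk
      obtain ⟨hu, hi⟩ := hK.2.2 k hk
      have hd := (Matrix.isUnit_iff_isUnit_det k).1 hu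
      refine ⟨k⁻¹, hi, fun Q => ?_⟩
      change k⁻¹.conjTranspose * (k.conjTranspose * Q * k) * k⁻¹ = Q
      have h1 : k⁻¹.conjTranspose * k.conjTranspose = 1 := by
        rw [← Matrix.conjTranspose_mul, Matrix.mul_nonsing_inv k hd, Matrix.conjTranspose_one]
      calc _ = (k⁻¹.conjTranspose * k.conjTranspose) * Q * (k * k⁻¹) := by simp only [mul_assoc]
        _ = Q := by rw [h1, Matrix.mul_nonsing_inv k hd, one_mul, mul_one]
    · refine IsClosed.and (isClosed_eq continuous_id.matrix_conjTranspose continuous_id) ?_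
      simp only [Set.ofPred_forall]
      exact isClosed_iInter fun v => isClosed_iInter fun r => isClosed_iInter fun _ =>
        isClosed_le continuous_const (hcont v)
    · rintro P ⟨hP, hP'⟩ Q ⟨hQ, hQ'⟩ a b ha hb hab
      refine ⟨?_, fun v r hr => ?_⟩
      · rw [Matrix.IsHermitian, Matrix.conjTranspose_add, Matrix.conjTranspose_smul,
          Matrix.conjTranspose_smul, hP, hQ, star_trivial, star_trivial]
      · have h1 := mul_le_mul_of_nonneg_left (hP' v r hr) ha
        have h2 := mul_le_mul_of_nonneg_left (hQ' v r hr) hb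
        have h3 : (star v ⬝ᵥ (a • P + b • Q).mulVec v).re =
            a * (star v ⬝ᵥ P.mulVec v).re + b * (star v ⬝ᵥ Q.mulVec v).re := by
          simp [Matrix.add_mulVec, Matrix.smul_mulVec, dotProduct_add, dotProduct_smul]
        rw [h3]
        calc r = a * r + b * r := by rw [← add_mul, hab, one_mul]
          _ ≤ _ := add_le_add h1 h2
    · refine ⟨1, Matrix.isHermitian_one, fun v r hr => ?_⟩
      have := hr 1 hK.1
      rw [Matrix.one_mulVec, ← Complex.ofReal_re (‖WithLp.toLp 2 v‖ ^ 2),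
        ofReal_norm_toLp_sq] at this
      rwa [Matrix.one_mulVec]
    · rintro k hk Q ⟨hQ, hQ'⟩
      refine ⟨Matrix.isHermitian_conjTranspose_mul_mul k hQ, fun v r hr => ?_⟩
      rw [hq]
      refine hQ' _ r fun k' hk' => ?_
      rw [Matrix.mulVec_mulVec]
      exact hr _ (hK.2.1 k' hk' k hk)
  obtain ⟨Q, hQ, hfix⟩ := hex
  refine ⟨Q, .of_dotProduct_mulVec_pos hQ.1 fun v hv => ?_, hfix⟩
  obtain ⟨k₀, hk₀, hmin⟩ := hc.exists_isMinOn ⟨1, hK.1⟩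
    (f := fun k : Matrix (Fin n) (Fin n) ℂ => ‖WithLp.toLp 2 (k.mulVec v)‖ ^ 2)
    (((PiLp.continuous_toLp 2 _).comp
      (continuous_id.matrix_mulVec continuous_const)).norm.pow 2).continuousOn
  have h1 := hQ.2 v _ fun k hk => hmin hk
  have h2 : (star v ⬝ᵥ Q.mulVec v).im = 0 := hQ.1.im_star_dotProduct_mulVec_self v
  rw [Complex.lt_def]
  refine ⟨lt_of_lt_of_le ?_ h1, h2.symm⟩
  have : k₀.mulVec v ≠ 0 := fun h0 => hv ((Matrix.mulVec_injective_iff_isUnit.2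
    (hK.2.2 k₀ hk₀).1) (h0.trans (Matrix.mulVec_zero k₀).symm))
  have h3 : WithLp.toLp 2 (k₀.mulVec v) ≠ 0 := fun h0 => this (congrArg WithLp.ofLp h0)
  have := norm_pos_iff.2 h3
  simp only [Complex.zero_re]
  positivity

theorem exists_conj_mem_unitaryGroup {n : ℕ} {K : Set (Matrix (Fin n) (Fin n) ℂ)}
    (hK : IsMatSubgroup ℂ n K) (hc : IsCompact K) :
    ∃ b : (Matrix (Fin n) (Fin n) ℂ)ˣ,
      ∀ k ∈ K, (b : Matrix (Fin n) (Fin n) ℂ) * k * (b⁻¹ : (Matrix (Fin n) (Fin n) ℂ)ˣ) ∈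
        Matrix.unitaryGroup (Fin n) ℂ := by
  obtain ⟨Q, hQ, h⟩ := exists_conjTranspose_mul_mul_eq hK hc
  obtain ⟨B, hB⟩ := CStarAlgebra.nonneg_iff_eq_star_mul_self.mp hQ.posSemidef.nonneg
  have hBu : IsUnit B := by
    have h1 := hQ.isUnit
    rw [hB, Matrix.isUnit_iff_isUnit_det, Matrix.det_mul] at h1
    exact (Matrix.isUnit_iff_isUnit_det B).2 (isUnit_of_mul_isUnit_right h1)
  obtain ⟨b, rfl⟩ := hBu
  refine ⟨b, fun k hk => Matrix.mem_unitaryGroup_iff'.2 ?_⟩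
  have h2 := h k hk
  rw [hB, ← Matrix.star_eq_conjTranspose] at h2
  have h3 : star ((b⁻¹ : (Matrix (Fin n) (Fin n) ℂ)ˣ) : Matrix (Fin n) (Fin n) ℂ) * star b.val =
      1 := by rw [← star_mul, Units.mul_inv, star_one]
  calc _ = star ((b⁻¹ : (Matrix (Fin n) (Fin n) ℂ)ˣ) : Matrix (Fin n) (Fin n) ℂ) *
        (star k * (star b.val * b.val) * k) * (b⁻¹ : (Matrix (Fin n) (Fin n) ℂ)ˣ) := by
        simp only [star_mul, mul_assoc]
    _ = 1 := by rw [h2, ← mul_assoc, h3, one_mul, Units.mul_inv]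

theorem conjIsotropy_iff {n : ℕ} {G : Set (Matrix (Fin n) (Fin n) ℂ)} (hG : IsMatSubgroup ℂ n G)
    {v w : Fin n → ℂ} : ConjIsotropy ℂ n G v w ↔
      ∃ g ∈ G, ∀ h, g * h * g⁻¹ ∈ isotropy ℂ n G w ↔ h ∈ isotropy ℂ n G v := by
  refine exists_congr fun g => and_congr_right fun hg => ?_
  have hd := (Matrix.isUnit_iff_isUnit_det g).1 (hG.2.2 g hg).1
  have hinj : Function.Injective fun h : Matrix (Fin n) (Fin n) ℂ => g * h * g⁻¹ := by
    refine Function.LeftInverse.injective (g := fun h => g⁻¹ * h * g) fun h => ?_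
    simp only [mul_assoc, Matrix.nonsing_inv_mul g hd, mul_one]
    rw [← mul_assoc, Matrix.nonsing_inv_mul g hd, one_mul]
  constructor
  · intro h x
    rw [h]
    exact hinj.mem_set_image
  · refine fun h => Set.ext fun x => ⟨fun hx => ⟨g⁻¹ * x * g, ?_, ?_⟩, ?_⟩
    · rw [← h]
      simp only [mul_assoc, Matrix.mul_nonsing_inv g hd, mul_one]
      rwa [← mul_assoc, Matrix.mul_nonsing_inv g hd, one_mul]
    · simp only [mul_assoc, Matrix.mul_nonsing_inv g hd, mul_one]
      rw [← mul_assoc, Matrix.mul_nonsing_inv g hd, one_mul]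
    · rintro ⟨y, hy, rfl⟩
      exact (h y).2 hy

theorem isClosed_orbit_of_hasClosedOrbit {n : ℕ} {G : Set (Matrix (Fin n) (Fin n) ℂ)}
    {u : Fin n → ℂ} (hu : HasClosedOrbit ℂ n G u) : IsClosed (orbit ℂ n G u) := by
  have h : orbit ℂ n G u = zclosure ℂ n (orbit ℂ n G u) :=
    Set.Subset.antisymm (subset_zclosure _) hu
  rw [h]
  have : zclosure ℂ n (orbit ℂ n G u) =
      ⋂ p ∈ vanishingIdeal ℂ n (orbit ℂ n G u), {v | eval v p = 0} := by
    ext v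
    simp only [Set.mem_iInter]
    rfl
  rw [this]
  exact isClosed_biInter fun p _ => isClosed_eq (MvPolynomial.continuous_eval p) continuous_const

theorem exists_countable_conjIsotropy {n : ℕ} {G : Set (Matrix (Fin n) (Fin n) ℂ)}
    (hG : IsReductiveGroup ℂ n G) :
    ∃ T : Set (Fin n → ℂ), T.Countable ∧ (∀ t ∈ T, HasClosedOrbit ℂ n G t) ∧
      ∀ u, HasClosedOrbit ℂ n G u → ∃ t ∈ T, ConjIsotropy ℂ n G t u := by
  obtain ⟨hGg, hz, K, hKG, hc, hK, hd⟩ := hG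
  obtain ⟨b, hb⟩ := exists_conj_mem_unitaryGroup hK hc
  obtain ⟨B, hBdef⟩ : ∃ B : Matrix (Fin n) (Fin n) ℂ, B = b := ⟨_, rfl⟩
  obtain ⟨A, hAdef⟩ : ∃ A : Matrix (Fin n) (Fin n) ℂ, A = (b⁻¹ : (Matrix (Fin n) (Fin n) ℂ)ˣ) :=
    ⟨_, rfl⟩
  have hAB : A * B = 1 := by rw [hAdef, hBdef, Units.inv_mul]
  have hBA : B * A = 1 := by rw [hAdef, hBdef, Units.mul_inv]
  have hAB' : ∀ M, A * (B * M) = M := fun M => by rw [← mul_assoc, hAB, one_mul]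
  have hBA' : ∀ M, B * (A * M) = M := fun M => by rw [← mul_assoc, hBA, one_mul]
  rw [← hBdef, ← hAdef] at hb
  let G' : Set (Matrix (Fin n) (Fin n) ℂ) := {g | A * g * B ∈ G}
  have hunit : ∀ g, IsUnit (A * g * B) ↔ IsUnit g := fun g => by
    rw [hAdef, hBdef, Units.isUnit_mul_units, Units.isUnit_units_mul]
  have hinv : ∀ g, (A * g * B)⁻¹ = A * g⁻¹ * B := fun g => by
    have h1 : A⁻¹ = B := Matrix.inv_eq_right_inv hAB
    have h2 : B⁻¹ = A := Matrix.inv_eq_right_inv hBA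
    rw [Matrix.mul_inv_rev, Matrix.mul_inv_rev, h1, h2, mul_assoc]
  have hG' : IsMatSubgroup ℂ n G' := by
    refine ⟨?_, fun x hx y hy => ?_, fun x hx => ⟨(hunit x).1 (hGg.2.2 _ hx).1, ?_⟩⟩
    · change A * 1 * B ∈ G
      rw [mul_one, hAB]
      exact hGg.1
    · have := hGg.2.1 _ hx _ hy
      simp only [mul_assoc, hBA'] at this
      simpa only [G', Set.mem_ofPred_eq, mul_assoc] using this
    · have := (hGg.2.2 _ hx).2
      rwa [hinv] at this
  have hz' : IsZClosedInGL ℂ n G' := by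
    obtain ⟨P, hP⟩ := hz
    choose q hq using exists_eval_mul_mul A B
    refine ⟨q '' P, Set.ext fun g => ?_⟩
    simp only [G', hP, Set.mem_ofPred_eq, Set.forall_mem_image, hq, hunit]
  have hstar : ∀ g ∈ G', g.conjTranspose ∈ G' := by
    intro g hg
    refine conjTranspose_mem hG' hz' (K := (fun k => B * k * A) '' K) ?_ ?_ ?_ hg
    · rintro _ ⟨k, hk, rfl⟩
      change A * (B * k * A) * B ∈ G
      simpa only [mul_assoc, hAB', hAB, mul_one] using hKG hk
    · rintro _ ⟨k, hk, rfl⟩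
      exact hb k hk
    · intro p hp g hg
      obtain ⟨q, hq⟩ := exists_eval_mul_mul B A p
      have h1 := hd q (fun k hk => by rw [hq]; exact hp _ ⟨k, hk, rfl⟩) _ hg
      rw [hq] at h1
      simpa only [mul_assoc, hBA', hBA, mul_one] using h1
  obtain ⟨T, hT, h⟩ := exists_countable_conjIsotropy_of_conjTranspose_mem hG' hz' hstar
  have hiso : ∀ x v, x ∈ isotropy ℂ n G' v ↔ A * x * B ∈ isotropy ℂ n G (A.mulVec v) := by
    intro x v
    refine and_congr_right fun _ => ?_
    rw [Matrix.mulVec_mulVec, mul_assoc, hBA, mul_one, ← Matrix.mulVec_mulVec]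
    exact ((Matrix.mulVec_injective_iff_isUnit.2 (hAdef ▸ Units.isUnit _)).eq_iff).symm
  have hAT : ∀ u, HasClosedOrbit ℂ n G u → ∃ t ∈ T, ConjIsotropy ℂ n G (A.mulVec t) u := by
    intro u hu
    have hcl : IsClosed (orbit ℂ n G' (B.mulVec u)) := by
      have : orbit ℂ n G' (B.mulVec u) = (fun x => A.mulVec x) ⁻¹' orbit ℂ n G u := by
        ext x
        constructor
        · rintro ⟨g, hg, rfl⟩
          exact ⟨_, hg, by simp only [Matrix.mulVec_mulVec, mul_assoc]⟩
        · rintro ⟨g, hg, hgx⟩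
          refine ⟨B * g * A, ?_, ?_⟩
          · change A * (B * g * A) * B ∈ G
            simpa only [mul_assoc, hAB', hAB, mul_one] using hg
          · have h1 := congrArg B.mulVec hgx
            simp only [Matrix.mulVec_mulVec, hBA, Matrix.one_mulVec] at h1
            simp only [Matrix.mulVec_mulVec, mul_assoc, hAB, mul_one, h1]
      rw [this]
      exact (isClosed_orbit_of_hasClosedOrbit hu).preimage
        (continuous_const.matrix_mulVec continuous_id)
    obtain ⟨t, ht, hc⟩ := h _ hcl
    refine ⟨t, ht, ?_⟩
    obtain ⟨g, hg, hgc⟩ := (conjIsotropy_iff hG').1 hc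
    refine (conjIsotropy_iff hGg).2 ⟨_, hg, fun x => ?_⟩
    have h1 := hgc (B * x * A)
    rw [hiso, hiso, Matrix.mulVec_mulVec, hAB, Matrix.one_mulVec] at h1
    rw [hinv]
    simpa only [mul_assoc, hAB', hBA', hAB, mul_one] using h1
  choose! W hW using fun t (ht : ∃ u, HasClosedOrbit ℂ n G u ∧
    ConjIsotropy ℂ n G (A.mulVec t) u) => ht
  refine ⟨W '' (T ∩ {t | ∃ u, HasClosedOrbit ℂ n G u ∧ ConjIsotropy ℂ n G (A.mulVec t) u}),
    (hT.mono Set.inter_subset_left).image _, ?_, fun u hu => ?_⟩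
  · rintro _ ⟨t, ⟨-, ht⟩, rfl⟩
    exact (hW t ht).1
  · obtain ⟨t, ht, htu⟩ := hAT u hu
    have hex : ∃ u, HasClosedOrbit ℂ n G u ∧ ConjIsotropy ℂ n G (A.mulVec t) u := ⟨u, hu, htu⟩
    exact ⟨W t, ⟨t, ⟨ht, hex⟩, rfl⟩,
      conjIsotropy_trans hGg (conjIsotropy_symm hGg (hW t hex).2) htu⟩

end UnitaryTrick

/-- **Theorem 1.4(1).** Let `G` be a complex reductive group, `V = ℂⁿ` a stable `G`-module
and `Y ⊆ V` a `G`-stable algebraic subset.  Suppose `π(Y) ⊆ V//G` is the zero set of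
invariants `f_1, …, f_k`, that `Y_apr` is Zariski dense in `Y`, and that every stratum of
`V` which intersects `Y \ Y_apr` has codimension at least `k + 1` in `V`.  Then `Y` is
`G`-saturated. -/
theorem saturated_of_apr_dense_and_codim
    (n : ℕ) (G : Set (Matrix (Fin n) (Fin n) ℂ)) (hG : IsReductiveGroup ℂ n G)
    (hstab : IsStableModule ℂ n G)
    (Y : Set (Fin n → ℂ)) (hYalg : IsAlgebraicSet ℂ n Y) (hYstab : Stabilizes ℂ n G Y)
    (k : ℕ) (f : Fin k → MvPolynomial (Fin n) ℂ) (hf : ∀ i, Invariant ℂ n G (f i))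
    (hzero : saturation ℂ n G Y = {v | ∀ i, eval v (f i) = 0})
    (hdense : ZDenseIn ℂ n (Y ∩ aprPoints ℂ n G) Y)
    (hcodim : ∀ v : Fin n → ℂ, HasClosedOrbit ℂ n G v →
      ((stratumOf ℂ n G v) ∩ (Y \ aprPoints ℂ n G)).Nonempty →
      adim ℂ n (stratumOf ℂ n G v) + ((k + 1 : ℕ) : WithBot ℕ∞) ≤ (n : WithBot ℕ∞)) :
    IsSaturated ℂ n G Y := by
  obtain ⟨hGg, hz, -⟩ := id hG
  refine Set.Subset.antisymm (fun y hy => ⟨y, hy, fun _ _ => rfl⟩) fun v₀ hv₀ => ?_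
  by_contra hv₀Y
  obtain ⟨S, hS⟩ := id hYalg
  obtain ⟨r₀, hr₀S, hr₀⟩ : ∃ r ∈ S, eval v₀ r ≠ 0 := by
    by_contra! hcon
    exact hv₀Y (hS ▸ hcon)
  have hv₀f : ∀ i, eval v₀ (f i) = 0 := by rwa [hzero] at hv₀
  obtain ⟨P, hP, hr₀P⟩ : ∃ P ∈ (Ideal.span (Set.range f)).minimalPrimes, r₀ ∉ P := by
    by_contra! hcon
    have h1 : r₀ ∈ (Ideal.span (Set.range f)).radical := by
      rw [← Ideal.sInf_minimalPrimes]
      exact Submodule.mem_sInf.2 hcon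
    obtain ⟨m, hm⟩ := h1
    have h2 : Ideal.span (Set.range f) ≤ RingHom.ker (eval v₀) := by
      rw [Ideal.span_le]
      rintro _ ⟨i, rfl⟩
      exact hv₀f i
    have h3 : eval v₀ (r₀ ^ m) = 0 := h2 hm
    rw [map_pow] at h3
    exact hr₀ (pow_eq_zero_iff (n := m) (by rintro rfl; simp at h3) |>.1 h3)
  have hPp : P.IsPrime := hP.1.1
  obtain ⟨T, hT, hTc, hTall⟩ := exists_countable_conjIsotropy hG
  let T' : Set (Fin n → ℂ) :=
    {t ∈ T | (stratumOf ℂ n G t ∩ (Y \ aprPoints ℂ n G)).Nonempty}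
  have hT' : ∀ t : T', ∃ r ∈ vanishingIdeal ℂ n (stratumOf ℂ n G t), r ∉ P := fun t =>
    SetLike.not_le_iff_exists.1 (not_vanishingIdeal_le_of_adim n k f P hP _
      (hcodim t (hTc t t.2.1) t.2.2))
  choose r hr hrP using hT'
  have hcount : Countable T' := (hT.mono fun _ h => h.1).to_subtype
  obtain ⟨z, hzP, hz'⟩ := exists_zero_forall_ne_zero P (fun o : Option T' => o.elim r₀ r)
    (by rintro (_ | t); exacts [hr₀P, hrP t])
  have hzX : z ∈ saturation ℂ n G Y := by
    rw [hzero]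
    exact fun i => hzP _ (hP.1.2 (Ideal.subset_span ⟨i, rfl⟩))
  obtain ⟨w, hwz, hwc⟩ := exists_closed_orbit hGg hz z
  have hwY := mem_of_closed_orbit_of_mem_saturation hG hYalg hYstab hzX hwz hwc
  obtain ⟨t, ht, htw⟩ := hTall w hwc
  have hapr : w ∈ aprPoints ℂ n G := by
    by_contra hw
    have ht' : t ∈ T' := ⟨ht, w, ⟨w, hwc, subset_zclosure _ (mem_orbit_self hGg w), htw⟩, hwY, hw⟩
    exact hz' (some ⟨t, ht'⟩) (hr ⟨t, ht'⟩ z ⟨w, hwc, hwz, htw⟩)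
  obtain ⟨g, hg, rfl⟩ := mem_orbit_of_isAlmostPrincipalPt hGg hz hapr hwz
  have h1 := hYstab g hg w hwY
  rw [hS] at h1
  exact hz' none (h1 r₀ hr₀S)

end ZPaper
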